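/- arXiv:math/0602252 — 3 statements merged into one kernel-verified Lean document; each statement's English description precedes it below -/
import Mathlib

section
/- Let R be a commutative Noetherian ring, M ∈ D_qc(R), i ∈ ℤ, and let p, p' be primes with p ⊆ p' and p ∈ Ass H_i(M). Then for every integer t ≥ i, the object s^t(R/p') lies in every cocomplete preaisle of D(R) that contains M. -/
open CategoryTheory CategoryTheory.Limits CategoryTheory.Pretriangulated

universe w

section Defs

variable (R : Type) [CommRing R] [HasDerivedCategory.{w} (ModuleCat R)]

/-- The `n`-th homology (homological indexing, so that `H_n (s M) = H_{n-1} M` where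
`s = ⟦1⟧`) of an object of the derived category `D(R)` of `R`-modules. -/
noncomputable def Hh (n : ℤ) (M : DerivedCategory (ModuleCat R)) : ModuleCat R :=
  (DerivedCategory.homologyFunctor (ModuleCat R) (-n)).obj M

/-- The object `s^n M` of `D(R)` given by a module `M` concentrated in homological
degree `n`. -/
noncomputable def sdeg (n : ℤ) (M : ModuleCat R) : DerivedCategory (ModuleCat R) :=
  (DerivedCategory.singleFunctor (ModuleCat R) (-n)).obj M

/-- Membership in `D_qc(R)`: all homology modules are finitely generated over `R`,
and all but finitely many of them vanish. -/
def memDqc (M : DerivedCategory (ModuleCat R)) : Prop :=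
  (∀ n : ℤ, Module.Finite R ↥(Hh R n M)) ∧
    {n : ℤ | ¬ IsZero (Hh R n M)}.Finite

/-- A cocomplete preaisle in `D(R)`: a class of objects closed under isomorphism,
suspension (`s = ⟦1⟧`), extensions, and arbitrary coproducts. -/
structure IsCocompletePreaisle (S : Set (DerivedCategory (ModuleCat R))) : Prop where
  mem_of_iso : ∀ ⦃X Y : DerivedCategory (ModuleCat R)⦄, (X ≅ Y) → X ∈ S → Y ∈ S
  shift_mem : ∀ ⦃X : DerivedCategory (ModuleCat R)⦄, X ∈ S → X⟦(1 : ℤ)⟧ ∈ S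
  ext_mem : ∀ ⦃X Y Z : DerivedCategory (ModuleCat R)⦄ (f : X ⟶ Y) (g : Y ⟶ Z)
    (h : Z ⟶ X⟦(1 : ℤ)⟧),
    (Triangle.mk f g h ∈ distTriang (DerivedCategory (ModuleCat R))) →
    X ∈ S → Z ∈ S → Y ∈ S
  coproduct_mem : ∀ ⦃ι : Type⦄ (X : ι → DerivedCategory (ModuleCat R)) (c : Cofan X),
    IsColimit c → (∀ i, X i ∈ S) → c.pt ∈ S

end Defs

section P1
variable {R : Type} [CommRing R]

lemma cofan_span {F : ℕ → ModuleCat.{0} R} (c : Cofan F) (hc : IsColimit c) :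
    (⨆ k, LinearMap.range (c.inj k).hom) = ⊤ := by
  set N := ⨆ k, LinearMap.range (c.inj k).hom with hN
  have h : (ModuleCat.ofHom N.mkQ) = (0 : c.pt ⟶ ModuleCat.of R (c.pt ⧸ N)) := by
    apply Cofan.IsColimit.hom_ext hc
    intro k
    ext x
    have : (c.inj k).hom x ∈ N := by
      apply Submodule.mem_iSup_of_mem k
      exact ⟨x, rfl⟩
    simpa using this
  rw [eq_top_iff]
  intro x _
  have := congrArg (fun f => f.hom x) h
  simpa using this

open HomologicalComplex

noncomputable def eN (K : ℕ → CochainComplex (ModuleCat.{0} R) ℤ) (N : ℕ) : (∐ K) ⟶ (∐ K) :=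
  ∑ k ∈ Finset.range N, Sigma.π K k ≫ Sigma.ι K k

lemma eN_f (K : ℕ → CochainComplex (ModuleCat.{0} R) ℤ) (n : ℤ) (x : (∐ K).X n) :
    ∃ N, ∀ M, N ≤ M → ((eN K M).f n).hom x = x := by
  have hc : IsColimit (Cofan.mk ((∐ K).X n) (fun k => (Sigma.ι K k).f n)) := by
    have := isColimitOfPreserves (HomologicalComplex.eval (ModuleCat.{0} R) (ComplexShape.up ℤ) n) (coproductIsCoproduct K)
    exact isColimitCofanMkObjOfIsColimit (HomologicalComplex.eval (ModuleCat.{0} R) (ComplexShape.up ℤ) n) K _ (coproductIsCoproduct K)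
  have h := cofan_span _ hc
  have hx : x ∈ (⨆ k, LinearMap.range ((Sigma.ι K k).f n).hom) := by
    have h2 : x ∈ (⊤ : Submodule R ((∐ K).X n)) := trivial
    rw [← h] at h2
    exact h2
  induction hx using Submodule.iSup_induction' with
  | mem k x hx =>
    obtain ⟨y, rfl⟩ := hx
    refine ⟨k+1, fun M hM => ?_⟩
    have : Sigma.ι K k ≫ eN K M = Sigma.ι K k := by
      simp only [eN, Preadditive.comp_sum]
      rw [Finset.sum_eq_single k]
      · simp
      · intro b _ hb
        rw [Sigma.ι_π_of_ne_assoc K hb.symm, zero_comp]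
      · intro hk; exact absurd (Finset.mem_range.2 (by omega)) hk
    have h3 := congrArg (fun f => (f.f n).hom y) this
    simpa using h3
  | zero => exact ⟨0, fun M _ => by simp⟩
  | add x y _ _ hx hy =>
    obtain ⟨a, ha⟩ := hx
    obtain ⟨b, hb⟩ := hy
    exact ⟨max a b, fun M hM => by
      rw [map_add, ha M (le_trans (le_max_left _ _) hM), hb M (le_trans (le_max_right _ _) hM)]⟩

lemma eN_homology (K : ℕ → CochainComplex (ModuleCat.{0} R) ℤ) (n : ℤ) (y : (∐ K).homology n) :
    ∃ N, ∀ M, N ≤ M → (homologyMap (eN K M) n).hom y = y := by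
  obtain ⟨z, rfl⟩ := (ModuleCat.epi_iff_surjective ((∐ K).homologyπ n)).1 inferInstance y
  obtain ⟨N, hN⟩ := eN_f K n (((∐ K).iCycles n).hom z)
  refine ⟨N, fun M hM => ?_⟩
  have hz : (cyclesMap (eN K M) n).hom z = z := by
    apply (ModuleCat.mono_iff_injective ((∐ K).iCycles n)).1 inferInstance
    have := congrArg (fun f => f.hom z) (cyclesMap_i (eN K M) n)
    simp only [ModuleCat.hom_comp, LinearMap.comp_apply] at this
    exact this.trans (hN M hM)
  have := congrArg (fun f => f.hom z) (homologyπ_naturality (eN K M) n)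
  simp only [ModuleCat.hom_comp, LinearMap.comp_apply] at this
  exact this.trans (by rw [hz])

lemma sigma_hom_eq_zero_homology {K : ℕ → CochainComplex (ModuleCat.{0} R) ℤ} (n : ℤ) (y : (∐ K).homology n)
    (h : ∀ k, (homologyMap (Sigma.π K k) n).hom y = 0) : y = 0 := by
  obtain ⟨N, hN⟩ := eN_homology K n y
  rw [← hN N le_rfl]
  have : homologyMap (eN K N) n = ∑ k ∈ Finset.range N, homologyMap (Sigma.π K k) n ≫ homologyMap (Sigma.ι K k) n := by
    have := (homologyFunctor (ModuleCat.{0} R) (ComplexShape.up ℤ) n).map_sum (fun k => Sigma.π K k ≫ Sigma.ι K k) (Finset.range N)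
    simp only [homologyFunctor_map, homologyMap_comp] at this
    exact this
  rw [this]
  simp [ModuleCat.hom_sum, h]

lemma quasiIso_sigma_map {K L : ℕ → CochainComplex (ModuleCat.{0} R) ℤ} (s : ∀ k, K k ⟶ L k)
    (hs : ∀ k, QuasiIso (s k)) : QuasiIso (Limits.Sigma.map s) := by
  rw [quasiIso_iff]
  intro n
  rw [quasiIsoAt_iff_isIso_homologyMap, ConcreteCategory.isIso_iff_bijective]
  have hπ : ∀ k, Limits.Sigma.map s ≫ Sigma.π L k = Sigma.π K k ≫ s k := by
    intro k
    apply Sigma.hom_ext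
    intro j
    by_cases h : j = k
    · subst h; simp
    · simp [Sigma.ι_π_of_ne _ h, Sigma.ι_π_of_ne_assoc _ h]
  constructor
  · rw [injective_iff_map_eq_zero]
    intro y hy
    apply sigma_hom_eq_zero_homology
    intro k
    have h1 := congrArg (fun f => f.hom y) (congrArg (fun f => homologyMap f n) (hπ k))
    simp only [homologyMap_comp, ModuleCat.hom_comp, LinearMap.comp_apply] at h1
    erw [hy, map_zero] at h1
    have : Function.Injective (homologyMap (s k) n).hom := ((ConcreteCategory.isIso_iff_bijective (homologyMap (s k) n)).1 inferInstance).1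
    exact this (by rw [← h1, map_zero])
  · intro y
    obtain ⟨N, hN⟩ := eN_homology L n y
    have : homologyMap (eN L N) n = ∑ k ∈ Finset.range N, homologyMap (Sigma.π L k) n ≫ homologyMap (Sigma.ι L k) n := by
      have := (homologyFunctor (ModuleCat.{0} R) (ComplexShape.up ℤ) n).map_sum (fun k => Sigma.π L k ≫ Sigma.ι L k) (Finset.range N)
      simp only [homologyFunctor_map, homologyMap_comp] at this
      exact this
    refine ⟨∑ k ∈ Finset.range N, (homologyMap (Sigma.ι K k) n).hom ((inv (homologyMap (s k) n)).hom ((homologyMap (Sigma.π L k) n).hom y)), ?_⟩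
    have h2 : ∀ k, homologyMap (Sigma.ι K k) n ≫ homologyMap (Limits.Sigma.map s) n = homologyMap (s k) n ≫ homologyMap (Sigma.ι L k) n := by
      intro k; rw [← homologyMap_comp, ← homologyMap_comp]; simp
    conv_rhs => rw [← hN N le_rfl, this]
    change (homologyMap (Limits.Sigma.map s) n).hom _ = _
    rw [map_sum]
    simp only [ModuleCat.hom_sum, LinearMap.sum_apply]
    refine Finset.sum_congr rfl fun k _ => ?_
    have h3 := congrArg (fun f => f.hom ((inv (homologyMap (s k) n)).hom ((homologyMap (Sigma.π L k) n).hom y))) (h2 k)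
    simp only [ModuleCat.hom_comp, LinearMap.comp_apply] at h3
    rw [h3]
    have h4 : ∀ w, (homologyMap (s k) n).hom ((inv (homologyMap (s k) n)).hom w) = w := by
      intro w
      have := congrArg (fun f => f.hom w) (IsIso.inv_hom_id (homologyMap (s k) n))
      simpa using this
    rw [h4]; rfl
end P1

abbrev DD (R : Type) [CommRing R] [HasDerivedCategory.{w} (ModuleCat.{0} R)] := DerivedCategory (ModuleCat.{0} R)
noncomputable abbrev HH (R : Type) [CommRing R] [HasDerivedCategory.{w} (ModuleCat.{0} R)] (n : ℤ) := DerivedCategory.homologyFunctor (ModuleCat.{0} R) n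
section P2
variable {R : Type} [CommRing R] [HasDerivedCategory.{w} (ModuleCat.{0} R)]


lemma HH_comp_apply {X Y Z : (DD R)} (f : X ⟶ Y) (g : Y ⟶ Z) (n : ℤ) (x : (HH R n).obj X) :
    ((HH R n).map (f ≫ g)).hom x = ((HH R n).map g).hom (((HH R n).map f).hom x) := by
  simp

lemma HH_id_apply {X : (DD R)} (n : ℤ) (x : (HH R n).obj X) :
    ((HH R n).map (𝟙 X)).hom x = x := by
  simp

lemma HH_sub_apply {X Y : (DD R)} (f g : X ⟶ Y) (n : ℤ) (x : (HH R n).obj X) :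
    ((HH R n).map (f - g)).hom x = ((HH R n).map f).hom x - ((HH R n).map g).hom x := by
  rw [Functor.map_sub]; rfl

lemma HH_zero_apply {X Y : (DD R)} (n : ℤ) (x : (HH R n).obj X) :
    ((HH R n).map (0 : X ⟶ Y)).hom x = 0 := by
  rw [Functor.map_zero]; rfl

lemma HH_isIso_iff {X Y : (DD R)} (f : X ⟶ Y) :
    IsIso f ↔ ∀ n, Function.Bijective ((HH R n).map f).hom := by
  rw [DerivedCategory.isIso_iff]
  exact forall_congr' fun n => ConcreteCategory.isIso_iff_bijective _

lemma HH_Q_map {K L : CochainComplex (ModuleCat.{0} R) ℤ} (f : K ⟶ L) (n : ℤ)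
    (y : (HH R n).obj (DerivedCategory.Q.obj K)) :
    ((HH R n).map (DerivedCategory.Q.map f)).hom y =
      ((DerivedCategory.homologyFunctorFactors (ModuleCat.{0} R) n).inv.app L).hom
      ((HomologicalComplex.homologyMap f n).hom
       (((DerivedCategory.homologyFunctorFactors (ModuleCat.{0} R) n).hom.app K).hom y)) := by
  have h2 := NatIso.naturality_2 (DerivedCategory.homologyFunctorFactors (ModuleCat.{0} R) n) f
  exact (congrArg (fun g => g.hom y) h2).symm

lemma eN_HH (K : ℕ → CochainComplex (ModuleCat.{0} R) ℤ) (n : ℤ)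
    (y : (HH R n).obj (DerivedCategory.Q.obj (∐ K))) :
    ∃ N, ∀ M, N ≤ M → ((HH R n).map (DerivedCategory.Q.map (eN K M))).hom y = y := by
  obtain ⟨N, hN⟩ := eN_homology K n (((DerivedCategory.homologyFunctorFactors (ModuleCat.{0} R) n).hom.app (∐ K)).hom y)
  refine ⟨N, fun M hM => ?_⟩
  rw [HH_Q_map]
  erw [hN M hM]
  have := congrArg (fun f => f.hom y) ((DerivedCategory.homologyFunctorFactors (ModuleCat.{0} R) n).hom_inv_id_app (∐ K))
  exact this

lemma QSigma_desc (K : ℕ → CochainComplex (ModuleCat.{0} R) ℤ) (Y : (DD R))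
    (g : ∀ k, DerivedCategory.Q.obj (K k) ⟶ Y) :
    ∃ d : DerivedCategory.Q.obj (∐ K) ⟶ Y, ∀ k, DerivedCategory.Q.map (Sigma.ι K k) ≫ d = g k := by
  let e := DerivedCategory.Q.objObjPreimageIso Y
  have h := fun k => DerivedCategory.right_fac (g k ≫ e.inv)
  choose L s hs f hf using h
  have hq : QuasiIso (Limits.Sigma.map s) := by
    apply quasiIso_sigma_map
    intro k
    exact (DerivedCategory.isIso_Q_map_iff_quasiIso _ _).1 (hs k)
  refine ⟨inv (DerivedCategory.Q.map (Limits.Sigma.map s)) ≫ DerivedCategory.Q.map (Sigma.desc f) ≫ e.hom, fun k => ?_⟩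
  have h1 : DerivedCategory.Q.map (Sigma.ι K k) ≫ inv (DerivedCategory.Q.map (Limits.Sigma.map s))
     = inv (DerivedCategory.Q.map (s k)) ≫ DerivedCategory.Q.map (Sigma.ι L k) := by
    rw [IsIso.eq_inv_comp, ← Category.assoc, IsIso.comp_inv_eq, ← Functor.map_comp, ← Functor.map_comp]
    simp
  rw [reassoc_of% h1, ← Functor.map_comp_assoc, Sigma.ι_desc, ← Category.assoc, ← hf]
  simp

lemma HH_iso_of_inj (K : ℕ → CochainComplex (ModuleCat.{0} R) ℤ) 
    (e : DerivedCategory.Q.obj (∐ K) ⟶ DerivedCategory.Q.obj (∐ K)) 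
    (he : ∀ k, DerivedCategory.Q.map (Sigma.ι K k) ≫ e = DerivedCategory.Q.map (Sigma.ι K k)) :
    IsIso e := by
  have : ∀ n y, ((HH R n).map e).hom y = y := by
    intro n y
    obtain ⟨N, hN⟩ := eN_HH K n y
    conv_lhs => rw [← hN N le_rfl]
    rw [← HH_comp_apply]
    have : DerivedCategory.Q.map (eN K N) ≫ e = DerivedCategory.Q.map (eN K N) := by
      simp only [eN, Functor.map_sum, Preadditive.sum_comp, Functor.map_comp, Category.assoc, he]
    rw [this, hN N le_rfl]
  rw [HH_isIso_iff]
  intro n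
  have : ⇑((HH R n).map e).hom = id := funext (this n)
  rw [this]
  exact Function.bijective_id

lemma QSigma_ext (K : ℕ → CochainComplex (ModuleCat.{0} R) ℤ) (Y : (DD R))
    (d : DerivedCategory.Q.obj (∐ K) ⟶ Y) 
    (hd : ∀ k, DerivedCategory.Q.map (Sigma.ι K k) ≫ d = 0) : d = 0 := by
  obtain ⟨W, a, b, hT⟩ := distinguished_cocone_triangle₁ d
  have := fun k => Triangle.coyoneda_exact₂ _ hT _ (hd k)
  choose g hg using this
  obtain ⟨σ, hσ⟩ := QSigma_desc K W g
  have hi : IsIso (σ ≫ a) := HH_iso_of_inj K _ (fun k => by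
    rw [reassoc_of% (hσ k)]; exact (hg k).symm)
  rw [← cancel_epi (σ ≫ a), comp_zero, Category.assoc]
  have := comp_distTriang_mor_zero₁₂ _ hT
  exact (congrArg (σ ≫ ·) this).trans comp_zero

theorem exists_coprod (f : ℕ → (DD R)) : ∃ (c : (DD R)) (ι : ∀ k, f k ⟶ c) (π : ∀ k, c ⟶ f k),
    (∀ k, ι k ≫ π k = 𝟙 _) ∧ (∀ j k, j ≠ k → ι j ≫ π k = 0) ∧
    (∀ n (y : (HH R n).obj c), ∃ N, ∀ M, N ≤ M → 
      ((HH R n).map (∑ k ∈ Finset.range M, π k ≫ ι k)).hom y = y) ∧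
    Nonempty (IsColimit (Cofan.mk c ι)) := by
  let K := fun k => DerivedCategory.Q.objPreimage (f k)
  let e : ∀ k, DerivedCategory.Q.obj (K k) ≅ f k := fun k => DerivedCategory.Q.objObjPreimageIso (f k)
  refine ⟨DerivedCategory.Q.obj (∐ K), fun k => (e k).inv ≫ DerivedCategory.Q.map (Sigma.ι K k),
    fun k => DerivedCategory.Q.map (Sigma.π K k) ≫ (e k).hom, ?_, ?_, ?_, ⟨?_⟩⟩
  · intro k
    simp only [Category.assoc, ← Functor.map_comp_assoc]
    simp
  · intro j k h
    simp only [Category.assoc, ← Functor.map_comp_assoc]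
    simp [Sigma.ι_π_of_ne _ h]
  · intro n y
    obtain ⟨N, hN⟩ := eN_HH K n y
    refine ⟨N, fun M hM => ?_⟩
    conv_rhs => rw [← hN M hM]
    congr 3
    simp [eN]
  · have h := fun (s : Cofan f) => QSigma_desc K s.pt (fun k => (e k).hom ≫ s.inj k)
    choose d hd using h
    refine Cofan.IsColimit.mk _ d ?_ ?_
    · intro s j
      simp [hd]
    · intro s m hm
      rw [← sub_eq_zero]
      apply QSigma_ext
      intro k
      have := hm k
      simp at this
      simp [hd, ← this]
end P2

section P3
variable {R : Type} [CommRing R] [HasDerivedCategory.{w} (ModuleCat.{0} R)]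

theorem hocolim_mem {S : Set (DD R)} (hS : IsCocompletePreaisle R S) (f : ℕ → DD R)
    (t : ∀ k, f k ⟶ f (k+1)) (x : DD R) (p : ∀ k, f k ⟶ x) (hp : ∀ k, t k ≫ p (k+1) = p k)
    (hiso : ∀ n : ℤ, ∃ k0, ∀ k, k0 ≤ k → Function.Bijective ((HH R n).map (p k)).hom)
    (hf : ∀ k, f k ∈ S) : x ∈ S := by
  obtain ⟨c, ι, π, h1, h0, hsum, ⟨hc⟩⟩ := exists_coprod f
  have hcS : c ∈ S := hS.coproduct_mem f _ hc hf
  have hext : ∀ {Y : DD R} (a b : c ⟶ Y), (∀ k, ι k ≫ a = ι k ≫ b) → a = b :=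
    fun a b h => Cofan.IsColimit.hom_ext hc _ _ h
  obtain ⟨θ, hθ⟩ : ∃ θ : c ⟶ c, ∀ k, ι k ≫ θ = ι k - t k ≫ ι (k+1) :=
    ⟨Cofan.IsColimit.desc hc (fun k => ι k - t k ≫ ι (k+1)), fun k => Cofan.IsColimit.fac hc _ k⟩
  obtain ⟨P, hP⟩ : ∃ P : c ⟶ x, ∀ k, ι k ≫ P = p k :=
    ⟨Cofan.IsColimit.desc hc p, fun k => Cofan.IsColimit.fac hc _ k⟩
  have hθP : θ ≫ P = 0 := by
    apply hext
    intro k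
    rw [← Category.assoc, hθ, Preadditive.sub_comp, Category.assoc, hP, hP, hp, sub_self, comp_zero]
  have hθ0 : θ ≫ π 0 = π 0 := by
    apply hext
    intro k
    rw [← Category.assoc, hθ, Preadditive.sub_comp, Category.assoc, h0 (k+1) 0 (by omega), comp_zero, sub_zero]
  have hθs : ∀ k, θ ≫ π (k+1) = π (k+1) - π k ≫ t k := by
    intro k
    apply hext
    intro j
    rw [← Category.assoc, hθ, Preadditive.sub_comp, Preadditive.comp_sub, Category.assoc]
    congr 1
    by_cases hj : j = k
    · subst hj
      rw [h1, ← Category.assoc, h1, Category.comp_id, Category.id_comp]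
    · rw [h0 _ _ (by omega), ← Category.assoc, h0 _ _ hj, comp_zero, zero_comp]
  have hsum' : ∀ (n : ℤ) (y : (HH R n).obj c), ∃ N, y = ∑ k ∈ Finset.range N, ((HH R n).map (ι k)).hom (((HH R n).map (π k)).hom y) := by
    intro n y
    obtain ⟨N, hN⟩ := hsum n y
    refine ⟨N, ?_⟩
    conv_lhs => rw [← hN N le_rfl]
    rw [Functor.map_sum]
    simp [ModuleCat.hom_sum]
  have hinj : ∀ n, Function.Injective ((HH R n).map θ).hom := by
    intro n
    rw [injective_iff_map_eq_zero]
    intro y hy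
    have hk : ∀ k, ((HH R n).map (π k)).hom y = 0 := by
      intro k
      induction k with
      | zero => rw [← hθ0, HH_comp_apply, hy, map_zero]
      | succ k ih =>
        have := congrArg (fun g => ((HH R n).map g).hom y) (hθs k)
        rw [HH_comp_apply, hy, map_zero, HH_sub_apply, HH_comp_apply, ih, map_zero, sub_zero] at this
        exact this.symm
    obtain ⟨N, hN⟩ := hsum' n y
    rw [hN]
    simp [hk]
  have hred : ∀ (n : ℤ) (y : (HH R n).obj c), ∃ N0, ∀ N, N0 ≤ N → ∃ z w, y = ((HH R n).map θ).hom z + ((HH R n).map (ι N)).hom w := by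
    intro n y
    obtain ⟨M, hM⟩ := hsum' n y
    rw [hM]
    refine Finset.sum_induction _ (fun y : (HH R n).obj c => ∃ N0, ∀ N, N0 ≤ N → ∃ z w, y = ((HH R n).map θ).hom z + ((HH R n).map (ι N)).hom w) ?_ ?_ ?_
    · rintro a b ⟨Na, ha⟩ ⟨Nb, hb⟩
      refine ⟨max Na Nb, fun N hN => ?_⟩
      obtain ⟨z, w, h⟩ := ha N (le_trans (le_max_left _ _) hN)
      obtain ⟨z', w', h'⟩ := hb N (le_trans (le_max_right _ _) hN)
      exact ⟨z + z', w + w', by rw [h, h', map_add, map_add]; abel⟩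
    · exact ⟨0, fun N _ => ⟨0, 0, by simp⟩⟩
    · intro k _
      refine ⟨k, fun N hN => ?_⟩
      induction N, hN using Nat.le_induction with
      | base => exact ⟨0, ((HH R n).map (π k)).hom y, by simp⟩
      | succ N hN ih =>
        obtain ⟨z, w, h⟩ := ih
        have := congrArg (fun g => ((HH R n).map g).hom w) (hθ N)
        rw [HH_comp_apply, HH_sub_apply, HH_comp_apply] at this
        refine ⟨z + ((HH R n).map (ι N)).hom w, ((HH R n).map (t N)).hom w, ?_⟩
        rw [h, map_add, this]; abel
  have hker : ∀ (n : ℤ) (y : (HH R n).obj c), ((HH R n).map P).hom y = 0 → ∃ z, y = ((HH R n).map θ).hom z := by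
    intro n y hy
    obtain ⟨N0, hN0⟩ := hred n y
    obtain ⟨k0, hk0⟩ := hiso n
    obtain ⟨z, w, h⟩ := hN0 (max N0 k0) (le_max_left _ _)
    rw [h, map_add, ← HH_comp_apply, ← HH_comp_apply, hθP, HH_zero_apply, zero_add, hP] at hy
    have hw : w = 0 := (hk0 _ (le_max_right _ _)).1 (by rw [hy, map_zero])
    exact ⟨z, by rw [h, hw, map_zero, add_zero]⟩
  obtain ⟨h, g, δ, hT⟩ := distinguished_cocone_triangle θ
  obtain ⟨P', hP'⟩ : ∃ P' : h ⟶ x, P = g ≫ P' := Triangle.yoneda_exact₂ _ hT P hθP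
  have hhS : h ∈ S := hS.ext_mem g δ (-θ⟦(1:ℤ)⟧') (rot_of_distTriang _ hT) hcS (hS.shift_mem hcS)
  have hiso' : IsIso P' := by
    rw [HH_isIso_iff]
    intro n
    constructor
    · rw [injective_iff_map_eq_zero]
      intro u hu
      have hm : Mono ((HH R (n+1)).map θ) := (ModuleCat.mono_iff_injective _).2 (hinj _)
      have he : Epi ((HH R n).map g) := by
        have := (DerivedCategory.HomologySequence.mono_homologyMap_mor₁_iff _ hT n (n+1) rfl).1 hm
        exact (DerivedCategory.HomologySequence.epi_homologyMap_mor₂_iff _ hT n (n+1) rfl).2 this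
      obtain ⟨v, rfl⟩ := (ModuleCat.epi_iff_surjective _).1 he u
      obtain ⟨z, rfl⟩ := hker n v (by rw [hP', HH_comp_apply]; exact hu)
      have h3 : θ ≫ g = 0 := comp_distTriang_mor_zero₁₂ _ hT
      exact (HH_comp_apply θ g n z).symm.trans (by rw [h3, HH_zero_apply])
    · intro y
      obtain ⟨k0, hk0⟩ := hiso n
      obtain ⟨w, rfl⟩ := (hk0 k0 le_rfl).2 y
      refine ⟨((HH R n).map (ι k0 ≫ g)).hom w, ?_⟩
      rw [← HH_comp_apply, Category.assoc, ← hP', hP]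
  exact hS.mem_of_iso (asIso P') hhS

/-- The morphism has its fibre in `S`. -/
def FibIn (S : Set (DD R)) {X Y : DD R} (u : X ⟶ Y) : Prop :=
  ∃ (F : DD R) (i : F ⟶ X) (d : Y ⟶ F⟦(1:ℤ)⟧), Triangle.mk i u d ∈ distTriang (DD R) ∧ F ∈ S
end P3

section P4
variable {R : Type} [CommRing R] [HasDerivedCategory.{w} (ModuleCat.{0} R)]

lemma zero_mem_S {S : Set (DD R)} (hS : IsCocompletePreaisle R S) {X : DD R} (hX : IsZero X) : X ∈ S := by
  have := hS.coproduct_mem (ι := Empty) (fun a => a.elim) (Cofan.mk X (fun a => a.elim))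
    (Cofan.IsColimit.mk _ (fun s => hX.to_ _) (fun s j => j.elim) (fun s m _ => hX.eq_of_src _ _))
    (fun a => a.elim)
  exact this

lemma fibIn_iff {S : Set (DD R)} (hS : IsCocompletePreaisle R S) {X Y : DD R} (u : X ⟶ Y) :
    FibIn S u ↔ ∃ (C : DD R) (g : Y ⟶ C) (h : C ⟶ X⟦(1:ℤ)⟧), Triangle.mk u g h ∈ distTriang (DD R) ∧ C⟦(-1:ℤ)⟧ ∈ S := by
  constructor
  · rintro ⟨F, i, d, hT, hF⟩
    refine ⟨_, _, _, rot_of_distTriang _ hT, ?_⟩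
    exact hS.mem_of_iso (shiftShiftNeg (F) (1:ℤ)).symm hF
  · rintro ⟨C, g, h, hT, hC⟩
    exact ⟨_, _, _, inv_rot_of_distTriang _ hT, hC⟩

lemma fibIn_tri {S : Set (DD R)} (hS : IsCocompletePreaisle R S) {X Y : DD R} {u : X ⟶ Y}
    (hu : FibIn S u) {C : DD R} {g : Y ⟶ C} {h : C ⟶ X⟦(1:ℤ)⟧} (hT : Triangle.mk u g h ∈ distTriang (DD R)) :
    C⟦(-1:ℤ)⟧ ∈ S := by
  obtain ⟨C', g', h', hT', hC'⟩ := (fibIn_iff hS u).1 hu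
  have e := isoTriangleOfIso₁₂ _ _ hT' hT (Iso.refl _) (Iso.refl _) ((Category.comp_id u).trans (Category.id_comp u).symm)
  exact hS.mem_of_iso ((shiftFunctor (DD R) (-1:ℤ)).mapIso (Triangle.π₃.mapIso e)) hC'

lemma fibIn_comp {S : Set (DD R)} (hS : IsCocompletePreaisle R S) {X Y Z : DD R} {u : X ⟶ Y} {v : Y ⟶ Z}
    (hu : FibIn S u) (hv : FibIn S v) : FibIn S (u ≫ v) := by
  obtain ⟨C, g, h, hT, hC⟩ := (fibIn_iff hS u).1 hu
  obtain ⟨C', g', h', hT', hC'⟩ := (fibIn_iff hS v).1 hv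
  obtain ⟨C'', g'', h'', hT''⟩ := distinguished_cocone_triangle (u ≫ v)
  rw [fibIn_iff hS]
  refine ⟨C'', g'', h'', hT'', ?_⟩
  have O := Triangulated.someOctahedron rfl hT hT' hT''
  have := Triangle.shift_distinguished _ O.mem (-1)
  exact hS.ext_mem _ _ _ this hC hC'

lemma fibIn_of_isIso {S : Set (DD R)} (hS : IsCocompletePreaisle R S) {X Y : DD R} (u : X ⟶ Y) [IsIso u] : FibIn S u := by
  rw [fibIn_iff hS]
  obtain ⟨C, g, h, hT⟩ := distinguished_cocone_triangle u
  refine ⟨C, g, h, hT, zero_mem_S hS ?_⟩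
  have hz : IsZero C := (Triangle.isZero₃_iff_isIso₁ _ hT).2 (by assumption)
  exact (shiftFunctor (DD R) (-1:ℤ)).map_isZero hz

lemma fibIn_neg {S : Set (DD R)} (hS : IsCocompletePreaisle R S) {X Y : DD R} {u : X ⟶ Y}
    (hu : FibIn S u) : FibIn S (-u) := by
  have : IsIso (-𝟙 Y) := ⟨-𝟙 Y, by simp, by simp⟩
  have h := fibIn_comp hS hu (fibIn_of_isIso hS (-𝟙 Y))
  rwa [Preadditive.comp_neg, Category.comp_id] at h

lemma fibIn_shift {S : Set (DD R)} (hS : IsCocompletePreaisle R S) {X Y : DD R} {u : X ⟶ Y}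
    (hu : FibIn S u) : FibIn S (u⟦(1:ℤ)⟧') := by
  obtain ⟨F, i, d, hT, hF⟩ := hu
  have h := Triangle.shift_distinguished _ hT 1
  have h2 : FibIn S (Int.negOnePow 1 • (u⟦(1:ℤ)⟧')) := ⟨_, _, _, h, hS.shift_mem hF⟩
  have h3 := fibIn_neg hS h2
  simpa using h3

theorem approx_mem {S : Set (DD R)} (hS : IsCocompletePreaisle R S) (B : ℕ → DD R)
    (u : ∀ k, B k ⟶ B (k+1)) (hu : ∀ k, FibIn S (u k))
    (hz : ∀ n : ℤ, ∃ k0, ∀ k, k0 ≤ k → IsZero ((HH R n).obj (B k))) : B 0 ∈ S := by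
  let v : ∀ k, B 0 ⟶ B k := fun k => Nat.rec (𝟙 _) (fun k a => a ≫ u k) k
  have hv : ∀ k, FibIn S (v k) := by
    intro k
    induction k with
    | zero => exact fibIn_of_isIso hS (𝟙 _)
    | succ k ih => exact fibIn_comp hS ih (hu k)
  choose f p d hT hf using hv
  have ht : ∀ k, ∃ t : f k ⟶ f (k+1), t ≫ p (k+1) = p k := by
    intro k
    obtain ⟨t, ht, _⟩ := complete_distinguished_triangle_morphism₁ _ _ (hT k) (hT (k+1)) (𝟙 _) (u k) (Category.id_comp _).symm
    exact ⟨t, ht.symm.trans (Category.comp_id _)⟩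
  choose t ht using ht
  refine hocolim_mem hS f t (B 0) p ht ?_ hf
  intro n
  obtain ⟨a, ha⟩ := hz n
  obtain ⟨b, hb⟩ := hz (n-1)
  refine ⟨max a b, fun k hk => ?_⟩
  constructor
  · refine (ModuleCat.mono_iff_injective _).1 ((DerivedCategory.HomologySequence.mono_homologyMap_mor₁_iff _ (hT k) (n-1) n (by omega)).2 ?_)
    exact (hb k (le_trans (le_max_right _ _) hk)).eq_of_src _ _
  · refine (ModuleCat.epi_iff_surjective _).1 ((DerivedCategory.HomologySequence.epi_homologyMap_mor₁_iff _ (hT k) n).2 ?_)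
    exact (ha k (le_trans (le_max_left _ _) hk)).eq_of_tgt _ _

end P4

section P5
variable {R : Type} [CommRing R] [HasDerivedCategory.{w} (ModuleCat.{0} R)]

noncomputable def HH_shift (X : DD R) (k n m : ℤ) (h : k + n = m) : (HH R n).obj (X⟦k⟧) ≅ (HH R m).obj X :=
  ((DerivedCategory.homologyFunctor (ModuleCat.{0} R) 0).shiftIso k n m h).app X

noncomputable def sh (X : DD R) (k : ℕ) : DD R := Nat.rec (motive := fun _ => DD R → DD R) (fun X => X) (fun _ f X => f (X⟦(1:ℤ)⟧)) k X

lemma sh_succ (X : DD R) (k : ℕ) : sh X (k+1) = sh (X⟦(1:ℤ)⟧) k := rfl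

lemma sh_fibIn {S : Set (DD R)} (hS : IsCocompletePreaisle R S) (k : ℕ) : ∀ {X Y : DD R} (u : X ⟶ Y)
    (_ : FibIn S u), ∃ u' : sh X k ⟶ sh Y k, FibIn S u' := by
  induction k with
  | zero => intro X Y u hu; exact ⟨u, hu⟩
  | succ k ih => intro X Y u hu; exact ih _ (fibIn_shift hS hu)

lemma sh_isZero (k : ℕ) : ∀ {X : DD R} (n : ℤ) (_ : IsZero ((HH R (n+k)).obj X)), IsZero ((HH R n).obj (sh X k)) := by
  induction k with
  | zero => intro X n h; rw [Nat.cast_zero, add_zero] at h; exact h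
  | succ k ih =>
    intro X n h
    rw [sh_succ]
    refine ih n (h.of_iso (HH_shift X 1 (n+k) _ ?_))
    push_cast; ring

theorem cyc_mem {S : Set (DD R)} (hS : IsCocompletePreaisle R S) {x y w : DD R} (a : x ⟶ y) (b : y ⟶ x)
    (g : x ⟶ w) (h : w ⟶ x⟦(1:ℤ)⟧) (hT : Triangle.mk (a ≫ b) g h ∈ distTriang (DD R))
    (hy : y ∈ S) (hw : w ∈ S) (m0 : ℤ) (hx : ∀ m, m0 ≤ m → IsZero ((HH R m).obj x)) : x ∈ S := by
  obtain ⟨c, v12, w12, h12⟩ := distinguished_cocone_triangle a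
  obtain ⟨e, v23, w23, h23⟩ := distinguished_cocone_triangle b
  have O := Triangulated.someOctahedron rfl h12 h23 hT
  have f1 : FibIn S v23 := ⟨_, _, _, h23, hy⟩
  have f2 : FibIn S (w23 ≫ v12⟦(1:ℤ)⟧') := ⟨_, _, _, rot_of_distTriang _ O.mem, hw⟩
  have f3 : FibIn S w12 := ⟨_, _, _, rot_of_distTriang _ h12, hy⟩
  have f4 := fibIn_comp hS f1 (fibIn_comp hS f2 (fibIn_shift hS f3))
  have := fun k : ℕ => sh_fibIn hS (2 * k) _ f4
  choose u hu using this
  refine approx_mem hS (fun k => sh x (2 * k)) u hu ?_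
  intro n
  refine ⟨(m0 - n).toNat, fun k hk => sh_isZero _ _ (hx _ ?_)⟩
  push_cast
  omega

theorem resol_mem {S : Set (DD R)} (hS : IsCocompletePreaisle R S) (X : ℕ → DD R) 
    (u : ∀ k, X k ⟶ (X (k+1))⟦(1:ℤ)⟧) (hu : ∀ k, FibIn S (u k))
    (m0 : ℤ) (hx : ∀ k m, m0 ≤ m → IsZero ((HH R m).obj (X k))) : X 0 ∈ S := by
  have := fun k : ℕ => sh_fibIn hS k _ (hu k)
  choose u hu using this
  refine approx_mem hS (fun k => sh (X k) k) u hu ?_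
  intro n
  refine ⟨(m0 - n).toNat, fun k hk => sh_isZero _ _ (hx _ _ ?_)⟩
  omega
end P5

section P6
variable {R : Type} [CommRing R] [HasDerivedCategory.{w} (ModuleCat.{0} R)]

noncomputable def HH_single (n : ℤ) : DerivedCategory.singleFunctor (ModuleCat.{0} R) n ⋙ HH R n ≅ 𝟭 _ :=
  Functor.isoWhiskerRight (DerivedCategory.singleFunctorIsoCompQ (ModuleCat.{0} R) n) (HH R n) ≪≫
    Functor.associator _ _ _ ≪≫
    Functor.isoWhiskerLeft _ (DerivedCategory.homologyFunctorFactors (ModuleCat.{0} R) n) ≪≫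
    HomologicalComplex.homologyFunctorSingleIso (ModuleCat.{0} R) (ComplexShape.up ℤ) n

lemma HH_bij₁ {X Y Z : DD R} {f : X ⟶ Y} {g : Y ⟶ Z} {h : Z ⟶ X⟦(1:ℤ)⟧}
    (hT : Triangle.mk f g h ∈ distTriang (DD R)) (n : ℤ) (h0 : IsZero ((HH R (n-1)).obj Z))
    (h1 : IsZero ((HH R n).obj Z)) : IsIso ((HH R n).map f) := by
  have : Mono ((HH R n).map f) := (DerivedCategory.HomologySequence.mono_homologyMap_mor₁_iff _ hT (n-1) n (by omega)).2 (h0.eq_of_src _ _)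
  have : Epi ((HH R n).map f) := (DerivedCategory.HomologySequence.epi_homologyMap_mor₁_iff _ hT n).2 (h1.eq_of_tgt _ _)
  exact isIso_of_mono_of_epi _

lemma HH_bij₂ {X Y Z : DD R} {f : X ⟶ Y} {g : Y ⟶ Z} {h : Z ⟶ X⟦(1:ℤ)⟧}
    (hT : Triangle.mk f g h ∈ distTriang (DD R)) (n : ℤ) (h0 : IsZero ((HH R (n+1)).obj X))
    (h1 : IsZero ((HH R n).obj X)) : IsIso ((HH R n).map g) := by
  have : Mono ((HH R n).map g) := (DerivedCategory.HomologySequence.mono_homologyMap_mor₂_iff _ hT n).2 (h1.eq_of_src _ _)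
  have : Epi ((HH R n).map g) := (DerivedCategory.HomologySequence.epi_homologyMap_mor₂_iff _ hT n (n+1) (by omega)).2 (h0.eq_of_tgt _ _)
  exact isIso_of_mono_of_epi _

theorem trunc_tri (X : DD R) (n : ℤ) : ∃ (A B : DD R) (f : A ⟶ X) (g : X ⟶ B) (h : B ⟶ A⟦(1:ℤ)⟧),
    Triangle.mk f g h ∈ distTriang (DD R) ∧
    (∀ m, n < m → IsZero ((HH R m).obj A)) ∧ (∀ m, m ≤ n → IsZero ((HH R m).obj B)) ∧
    (∀ m, m ≤ n → IsIso ((HH R m).map f)) ∧ (∀ m, n < m → IsIso ((HH R m).map g)) := by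
  obtain ⟨A, B, hA, hB, f, g, h, hT⟩ := (DerivedCategory.TStructure.t (C := ModuleCat.{0} R)).exists_triangle X n (n+1) rfl
  have hA' := (DerivedCategory.isLE_iff A n).1 ⟨hA⟩
  have hB' := (DerivedCategory.isGE_iff B (n+1)).1 ⟨hB⟩
  refine ⟨A, B, f, g, h, hT, fun m hm => hA' m hm, fun m hm => hB' m (by omega), ?_, ?_⟩
  · intro m hm
    exact HH_bij₁ hT m (hB' _ (by omega)) (hB' _ (by omega))
  · intro m hm
    exact HH_bij₂ hT m (hA' _ (by omega)) (hA' _ (by omega))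

theorem devissage (C : ModuleCat.{0} R → Prop) (P : DD R → Prop)
    (hCiso : ∀ X Y : ModuleCat.{0} R, (X ≅ Y) → C X → C Y) (hC0 : ∀ X : ModuleCat.{0} R, IsZero X → C X)
    (hPiso : ∀ X Y : DD R, (X ≅ Y) → P X → P Y)
    (hPext : ∀ (X Y Z : DD R) (f : X ⟶ Y) (g : Y ⟶ Z) (h : Z ⟶ X⟦(1:ℤ)⟧),
      Triangle.mk f g h ∈ distTriang (DD R) → P X → P Z → P Y)
    (hPC : ∀ n Z, C Z → P ((DerivedCategory.singleFunctor (ModuleCat.{0} R) n).obj Z))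
    (a : ℤ) (k : ℕ) : ∀ (X : DD R) (_ : ∀ m, m < a → IsZero ((HH R m).obj X))
      (_ : ∀ m, a + k < m → IsZero ((HH R m).obj X)) (_ : ∀ n, C ((HH R n).obj X)), P X := by
  have single : ∀ (a : ℤ) (X : DD R) (_ : ∀ m, m < a → IsZero ((HH R m).obj X))
      (_ : ∀ m, a < m → IsZero ((HH R m).obj X)) (_ : ∀ n, C ((HH R n).obj X)), P X := by
    intro a X h1 h2 hC
    have := (DerivedCategory.isGE_iff X a).2 h1
    have := (DerivedCategory.isLE_iff X a).2 h2
    obtain ⟨Y, ⟨e⟩⟩ := DerivedCategory.exists_iso_singleFunctor_obj_of_isGE_of_isLE X a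
    refine hPiso _ _ e.symm (hPC _ _ ?_)
    exact hCiso _ _ ((HH R a).mapIso e ≪≫ (HH_single a).app Y) (hC a)
  induction k with
  | zero => intro X h1 h2 hC; exact single a X h1 (by simpa using h2) hC
  | succ k ih =>
    intro X h1 h2 hC
    obtain ⟨A, B, f, g, h, hT, hA, hB, hf, hg⟩ := trunc_tri X (a + k)
    push_cast at h2
    have eA : ∀ m, m ≤ a + k → ((HH R m).obj A ≅ (HH R m).obj X) := fun m hm =>
      haveI := hf m hm
      asIso ((HH R m).map f)
    have eB : ∀ m, a + k < m → ((HH R m).obj X ≅ (HH R m).obj B) := fun m hm =>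
      haveI := hg m hm
      asIso ((HH R m).map g)
    refine hPext _ _ _ f g h hT (ih A ?_ hA ?_) (single (a+k+1) B ?_ ?_ ?_)
    · intro m hm; exact (h1 m hm).of_iso (eA m (by omega))
    · intro n
      by_cases hn : n ≤ a + k
      · exact hCiso _ _ (eA n hn).symm (hC n)
      · exact hC0 _ (hA n (by omega))
    · intro m hm; exact hB m (by omega)
    · intro m hm; exact (h2 m (by omega)).of_iso (eB m (by omega)).symm
    · intro n
      by_cases hn : n ≤ a + k
      · exact hC0 _ (hB n hn)
      · exact hCiso _ _ (eB n (by omega)) (hC n)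
end P6

section P7
variable {R : Type} [CommRing R] [HasDerivedCategory.{w} (ModuleCat.{0} R)]

def PBd (P : CochainComplex (ModuleCat.{0} R) ℤ) : Prop :=
  (∃ b : ℤ, ∀ n, b < n → IsZero (P.X n)) ∧ ∀ n, Projective (P.X n)

lemma PBd.kproj {P : CochainComplex (ModuleCat.{0} R) ℤ} (h : PBd P) : P.IsKProjective := by
  obtain ⟨⟨b, hb⟩, hP⟩ := h
  have : P.IsStrictlyLE b := by
    rw [CochainComplex.isStrictlyLE_iff]; exact hb
  exact CochainComplex.isKProjective_of_projective P b

lemma lift_Q {K L : CochainComplex (ModuleCat.{0} R) ℤ} (hK : PBd K)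
    (f : DerivedCategory.Q.obj K ⟶ DerivedCategory.Q.obj L) : ∃ φ : K ⟶ L, DerivedCategory.Q.map φ = f := by
  have := hK.kproj
  let e := DerivedCategory.quotientCompQhIso (ModuleCat.{0} R)
  obtain ⟨ψ, hψ⟩ := (CochainComplex.IsKProjective.Qh_map_bijective K ((HomotopyCategory.quotient _ _).obj L)).2
    (e.hom.app K ≫ f ≫ e.inv.app L)
  obtain ⟨φ, rfl⟩ := (HomotopyCategory.quotient _ _).map_surjective ψ
  refine ⟨φ, ?_⟩
  have h := NatIso.naturality_1 e φ
  rw [← h]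
  have h2 : (HomotopyCategory.quotient (ModuleCat.{0} R) (ComplexShape.up ℤ) ⋙ DerivedCategory.Qh).map φ = e.hom.app K ≫ f ≫ e.inv.app L := hψ
  rw [h2]
  simp

lemma PBd.shift {P : CochainComplex (ModuleCat.{0} R) ℤ} (h : PBd P) (a : ℤ) : PBd (P⟦a⟧) := by
  obtain ⟨⟨b, hb⟩, hP⟩ := h
  exact ⟨⟨b - a, fun n hn => hb (n + a) (by omega)⟩, fun n => hP (n + a)⟩

lemma PBd.cone {P P' : CochainComplex (ModuleCat.{0} R) ℤ} (h : PBd P) (h' : PBd P') (φ : P ⟶ P') :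
    PBd (CochainComplex.mappingCone φ) := by
  obtain ⟨⟨b, hb⟩, hP⟩ := h
  obtain ⟨⟨b', hb'⟩, hP'⟩ := h'
  refine ⟨⟨max b b', fun n hn => ?_⟩, fun n => ?_⟩
  · exact HomologicalComplex.homotopyCofiber.isZero_X φ n (hb' n (lt_of_le_of_lt (le_max_right _ _) hn))
      (fun m hm => hb m (by
        have := le_max_left b b'
        have : n + 1 = m := hm
        omega))
  · have := hP (n+1)
    have := hP' n
    exact Projective.of_iso (HomologicalComplex.homotopyCofiber.XIsoBiprod φ n (n+1) rfl).symm inferInstance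

def PRes (X : DD R) : Prop := ∃ P : CochainComplex (ModuleCat.{0} R) ℤ, PBd P ∧ Nonempty (X ≅ DerivedCategory.Q.obj P)

lemma PRes.iso {X Y : DD R} (e : X ≅ Y) (h : PRes X) : PRes Y := by
  obtain ⟨P, hP, ⟨e'⟩⟩ := h
  exact ⟨P, hP, ⟨e.symm ≪≫ e'⟩⟩

lemma PRes.shift {X : DD R} (h : PRes X) (a : ℤ) : PRes (X⟦a⟧) := by
  obtain ⟨P, hP, ⟨e⟩⟩ := h
  exact ⟨P⟦a⟧, hP.shift a, ⟨(shiftFunctor (DD R) a).mapIso e ≪≫ (DerivedCategory.Q.commShiftIso a).symm.app P⟩⟩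

lemma PRes.cone {X Y Z : DD R} {f : X ⟶ Y} {g : Y ⟶ Z} {h : Z ⟶ X⟦(1:ℤ)⟧}
    (hT : Triangle.mk f g h ∈ distTriang (DD R)) (hX : PRes X) (hY : PRes Y) : PRes Z := by
  obtain ⟨P, hP, ⟨e⟩⟩ := hX
  obtain ⟨P', hP', ⟨e'⟩⟩ := hY
  obtain ⟨φ, hφ⟩ := lift_Q hP (e.inv ≫ f ≫ e'.hom)
  have hT' := DerivedCategory.mappingCone_triangle_distinguished φ
  refine ⟨_, hP.cone hP' φ, ⟨?_⟩⟩
  have c := isoTriangleOfIso₁₂ _ _ hT hT' e e' (by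
    change f ≫ e'.hom = e.hom ≫ DerivedCategory.Q.map φ
    rw [hφ]; simp)
  exact Triangle.π₃.mapIso c

lemma PRes.ext {X Y Z : DD R} {f : X ⟶ Y} {g : Y ⟶ Z} {h : Z ⟶ X⟦(1:ℤ)⟧}
    (hT : Triangle.mk f g h ∈ distTriang (DD R)) (hX : PRes X) (hZ : PRes Z) : PRes Y :=
  PRes.cone (inv_rot_of_distTriang _ hT) (hZ.shift (-1)) hX

lemma PRes.single (n : ℤ) (Z : ModuleCat.{0} R) : PRes ((DerivedCategory.singleFunctor (ModuleCat.{0} R) n).obj Z) := by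
  have h0 : PRes ((DerivedCategory.singleFunctor (ModuleCat.{0} R) 0).obj Z) := by
    let Q := (HasProjectiveResolution.out (Z := Z)).some
    refine ⟨Q.cochainComplex, ⟨⟨0, fun n hn => ?_⟩, fun n => inferInstance⟩, ⟨?_⟩⟩
    · exact CochainComplex.isZero_of_isStrictlyLE Q.cochainComplex 0 n hn
    · exact (DerivedCategory.singleFunctorIsoCompQ (ModuleCat.{0} R) 0).app Z ≪≫ (asIso (DerivedCategory.Q.map Q.π')).symm
  refine PRes.iso ?_ (h0.shift (-n))
  exact ((DerivedCategory.singleFunctors (ModuleCat.{0} R)).shiftIso (-n) n 0 (by omega)).app Z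

theorem exists_PRes (M : DD R) (a : ℤ) (k : ℕ) (h1 : ∀ m, m < a → IsZero ((HH R m).obj M))
      (h2 : ∀ m, a + k < m → IsZero ((HH R m).obj M)) : PRes M :=
  devissage (fun _ => True) PRes (fun _ _ _ _ => trivial) (fun _ _ => trivial) (fun _ _ e h => h.iso e)
    (fun _ _ _ _ _ _ hT hX hZ => PRes.ext hT hX hZ) (fun n Z _ => PRes.single n Z) a k M h1 h2 (fun _ => trivial)
end P7

section P8a
variable {R : Type} [CommRing R]

noncomputable abbrev TT (N : ModuleCat.{0} R) : CochainComplex (ModuleCat.{0} R) ℤ ⥤ CochainComplex (ModuleCat.{0} R) ℤ :=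
  (MonoidalCategory.tensorRight N).mapHomologicalComplex (ComplexShape.up ℤ)

noncomputable abbrev TTmap {N N' : ModuleCat.{0} R} (f : N ⟶ N') : TT N ⟶ TT N' :=
  NatTrans.mapHomologicalComplex ((MonoidalCategory.tensoringRight (ModuleCat.{0} R)).map f) (ComplexShape.up ℤ)

lemma TTmap_comp {N N' N'' : ModuleCat.{0} R} (f : N ⟶ N') (g : N' ⟶ N'') : TTmap (f ≫ g) = TTmap f ≫ TTmap g := by
  rw [TTmap, Functor.map_comp]; rfl

lemma TTmap_id (N : ModuleCat.{0} R) : TTmap (𝟙 N) = 𝟙 _ := by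
  rw [TTmap, CategoryTheory.Functor.map_id]; rfl

lemma TTmap_zero (N N' : ModuleCat.{0} R) (P : CochainComplex (ModuleCat.{0} R) ℤ) : (TTmap (0 : N ⟶ N')).app P = 0 := by
  ext n : 1
  exact MonoidalPreadditive.whiskerLeft_zero

noncomputable def TTiso {N N' : ModuleCat.{0} R} (e : N ≅ N') : TT N ≅ TT N' :=
  ⟨TTmap e.hom, TTmap e.inv, by rw [← TTmap_comp, e.hom_inv_id, TTmap_id], by rw [← TTmap_comp, e.inv_hom_id, TTmap_id]⟩

noncomputable def TTone (P : CochainComplex (ModuleCat.{0} R) ℤ) : (TT (ModuleCat.of R R)).obj P ≅ P :=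
  (NatIso.mapHomologicalComplex (MonoidalCategory.rightUnitorNatIso (ModuleCat.{0} R)) (ComplexShape.up ℤ)).app P ≪≫
   (Functor.mapHomologicalComplexIdIso _ (ComplexShape.up ℤ)).app P

noncomputable abbrev TTsc (S : ShortComplex (ModuleCat.{0} R)) (P : CochainComplex (ModuleCat.{0} R) ℤ) :
    ShortComplex (CochainComplex (ModuleCat.{0} R) ℤ) :=
  ShortComplex.mk ((TTmap S.f).app P) ((TTmap S.g).app P) (by
    rw [← NatTrans.comp_app, ← TTmap_comp, S.zero, TTmap_zero])

lemma TTsc_exact (S : ShortComplex (ModuleCat.{0} R)) (hS : S.ShortExact) (P : CochainComplex (ModuleCat.{0} R) ℤ)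
    (hP : ∀ n, Projective (P.X n)) : (TTsc S P).ShortExact := by
  apply HomologicalComplex.shortExact_of_degreewise_shortExact
  intro n
  have : Module.Projective R (P.X n) := (IsProjective.iff_projective _).2 (hP n)
  have h : (S.map (MonoidalCategory.tensorLeft (P.X n))).ShortExact := by
    refine ShortComplex.ShortExact.mk' (Module.Flat.lTensor_shortComplex_exact (P.X n) S hS.exact) ?_ ?_
    · rw [ModuleCat.mono_iff_injective]
      exact Module.Flat.lTensor_preserves_injective_linearMap _ ((ModuleCat.mono_iff_injective _).1 hS.mono_f)
    · rw [ModuleCat.epi_iff_surjective]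
      exact LinearMap.lTensor_surjective _ ((ModuleCat.epi_iff_surjective _).1 hS.epi_g)
  exact h

lemma exists_ses [IsNoetherianRing R] (N : ModuleCat.{0} R) [Module.Finite R N] :
    ∃ (n : ℕ) (N' : ModuleCat.{0} R) (_ : Module.Finite R N') (f : N' ⟶ ModuleCat.of R (Fin n → R)) (g : ModuleCat.of R (Fin n → R) ⟶ N) (w : f ≫ g = 0),
      (ShortComplex.mk f g w).ShortExact := by
  obtain ⟨n, g, hg⟩ := Module.Finite.exists_fin' R N
  refine ⟨n, ModuleCat.of R (LinearMap.ker g), inferInstance, ModuleCat.ofHom (LinearMap.ker g).subtype, ModuleCat.ofHom g, ?_, ?_⟩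
  · ext x; exact x.2
  · refine ShortComplex.ShortExact.mk' ?_ ?_ ?_
    · rw [ShortComplex.ShortExact.moduleCat_exact_iff_function_exact]
      exact LinearMap.exact_subtype_ker_map g
    · rw [ModuleCat.mono_iff_injective]; exact Subtype.val_injective
    · rw [ModuleCat.epi_iff_surjective]; exact hg

end P8a
section P8
variable {R : Type} [CommRing R] [HasDerivedCategory.{w} (ModuleCat.{0} R)]

lemma TT_ext {S : Set (DD R)} (hS : IsCocompletePreaisle R S) (P : CochainComplex (ModuleCat.{0} R) ℤ)
    (hP : ∀ n, Projective (P.X n)) (s : ShortComplex (ModuleCat.{0} R)) (hs : s.ShortExact)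
    (h1 : DerivedCategory.Q.obj ((TT s.X₁).obj P) ∈ S) (h3 : DerivedCategory.Q.obj ((TT s.X₃).obj P) ∈ S) :
    DerivedCategory.Q.obj ((TT s.X₂).obj P) ∈ S :=
  hS.ext_mem _ _ _ (DerivedCategory.triangleOfSES_distinguished (TTsc_exact s hs P hP)) h1 h3

lemma TT_free {S : Set (DD R)} (hS : IsCocompletePreaisle R S) (P : CochainComplex (ModuleCat.{0} R) ℤ)
    (hP : ∀ n, Projective (P.X n)) (hPS : DerivedCategory.Q.obj P ∈ S) (n : ℕ) :
    DerivedCategory.Q.obj ((TT (ModuleCat.of R (Fin n → R))).obj P) ∈ S := by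
  have one : DerivedCategory.Q.obj ((TT (ModuleCat.of R R)).obj P) ∈ S :=
    hS.mem_of_iso (DerivedCategory.Q.mapIso (TTone P).symm) hPS
  induction n with
  | zero =>
    refine zero_mem_S hS (Functor.map_isZero _ ?_)
    have h0 : IsZero (ModuleCat.of R (Fin 0 → R)) := ModuleCat.isZero_of_subsingleton _
    rw [IsZero.iff_id_eq_zero, ← NatTrans.id_app, ← TTmap_id, h0.eq_of_src (𝟙 _) 0, TTmap_zero]
  | succ n ih =>
    have e : ModuleCat.of R (R × (Fin n → R)) ≅ ModuleCat.of R (Fin (n+1) → R) :=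
      (Fin.consLinearEquiv R (fun _ => R)).toModuleIso
    refine hS.mem_of_iso (DerivedCategory.Q.mapIso ((TTiso e).app P)) ?_
    refine TT_ext hS P hP (ShortComplex.mk (X₁ := ModuleCat.of R R) (X₂ := ModuleCat.of R (R × (Fin n → R))) (X₃ := ModuleCat.of R (Fin n → R))
      (ModuleCat.ofHom (LinearMap.inl R R (Fin n → R))) (ModuleCat.ofHom (LinearMap.snd R R (Fin n → R))) ?_) ?_ one ih
    · ext; rfl
    · refine ShortComplex.ShortExact.mk' ?_ ?_ ?_
      · rw [ShortComplex.ShortExact.moduleCat_exact_iff_function_exact]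
        rintro ⟨x, y⟩
        simp [eq_comm]
      · rw [ModuleCat.mono_iff_injective]; exact LinearMap.inl_injective
      · rw [ModuleCat.epi_iff_surjective]; exact LinearMap.snd_surjective

theorem TT_mem [IsNoetherianRing R] {S : Set (DD R)} (hS : IsCocompletePreaisle R S) (P : CochainComplex (ModuleCat.{0} R) ℤ)
    (hP : PBd P) (hPS : DerivedCategory.Q.obj P ∈ S) (N : ModuleCat.{0} R) [hN : Module.Finite R N] :
    DerivedCategory.Q.obj ((TT N).obj P) ∈ S := by
  obtain ⟨⟨b, hb⟩, hP⟩ := hP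
  let T := {N : ModuleCat.{0} R // Module.Finite R N}
  have step : ∀ N : T, ∃ N' : T, ∃ u : DerivedCategory.Q.obj ((TT N.1).obj P) ⟶ (DerivedCategory.Q.obj ((TT N'.1).obj P))⟦(1:ℤ)⟧, FibIn S u := by
    rintro ⟨N, hN⟩
    obtain ⟨n, N', hN', f, g, w, hs⟩ := exists_ses N
    refine ⟨⟨N', hN'⟩, _, _, _, _, rot_of_distTriang _ (DerivedCategory.triangleOfSES_distinguished (TTsc_exact _ hs P hP)), ?_⟩
    exact TT_free hS P hP hPS n
  choose nx u hu using step
  let NN : ℕ → T := fun k => Nat.rec (⟨N, hN⟩ : T) (fun _ x => nx x) k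
  refine resol_mem hS (fun k => DerivedCategory.Q.obj ((TT (NN k).1).obj P)) (fun k => u (NN k)) (fun k => hu (NN k)) (b+1) ?_
  intro k m hm
  refine IsZero.of_iso ?_ ((DerivedCategory.homologyFunctorFactors _ m).app _)
  refine ShortComplex.isZero_homology_of_isZero_X₂ _ ?_
  exact Functor.map_isZero (MonoidalCategory.tensorRight (NN k).1) (hb m (by omega))

end P8

section P9
variable {R : Type} [CommRing R]

def ZZ (p : Ideal R) (H : Type) [AddCommGroup H] [Module R H] : Prop := ∀ z : H, ∃ s, s ∉ p ∧ s • z = 0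

lemma ZZ_fg (p : Ideal R) [hp : p.IsPrime] (H : Type) [AddCommGroup H] [Module R H] [Module.Finite R H] (h : ZZ p H) :
    ∃ s, s ∉ p ∧ ∀ z : H, s • z = 0 := by
  obtain ⟨T, hT⟩ := (Module.Finite.fg_top : (⊤ : Submodule R H).FG)
  choose s hs hz using h
  refine ⟨∏ t ∈ T, s t, ?_, ?_⟩
  · rw [hp.prod_mem_iff]; push Not; exact fun t _ => hs t
  · intro z
    have hz' : z ∈ Submodule.span R (T : Set H) := hT ▸ Submodule.mem_top
    induction hz' using Submodule.span_induction with
    | mem x hx =>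
      classical
      rw [← Finset.prod_erase_mul _ _ (Finset.mem_coe.1 hx), mul_smul, hz, smul_zero]
    | zero => simp
    | add x y _ _ h1 h2 => rw [smul_add, h1, h2, add_zero]
    | smul a x _ h => rw [smul_comm, h, smul_zero]

lemma ZZ_naka (p : Ideal R) [hp : p.IsPrime] (H : Type) [AddCommGroup H] [Module R H] [Module.Finite R H] (s : R)
    (hs : s ∉ p) (h : ∀ z : H, s • z ∈ (p • ⊤ : Submodule R H)) : ZZ p H := by
  obtain ⟨f, hf, hn, hc, h0⟩ := LinearMap.exists_monic_and_natDegree_eq_and_coeff_mem_pow_and_aeval_eq_zero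
    R (s • (LinearMap.id : Module.End R H)) p (by
      rintro _ ⟨z, rfl⟩; exact h z)
  have h1 : ∀ z : H, (f.eval s) • z = 0 := by
    intro z
    have := congrArg (fun g : Module.End R H => g z) h0
    have e : s • (LinearMap.id : Module.End R H) = algebraMap R (Module.End R H) s := by ext; simp
    simp only [e] at this
    rw [Polynomial.aeval_algebraMap_apply] at this
    simpa using this
  refine fun z => ⟨f.eval s, ?_, h1 z⟩
  intro hmem
  rw [Polynomial.eval_eq_sum_range, Finset.sum_range_succ, Polynomial.Monic.coeff_natDegree hf, one_mul] at hmem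
  have h2 : ∑ x ∈ Finset.range f.natDegree, f.coeff x * s ^ x ∈ p := by
    refine Ideal.sum_mem _ fun k hk => Ideal.mul_mem_right _ _ ?_
    have h3 := hc k
    have : k < f.natDegree := Finset.mem_range.1 hk
    exact Ideal.pow_le_self (by omega) h3
  exact hs (hp.mem_of_pow_mem _ ((Ideal.add_mem_iff_right _ h2).1 hmem))

theorem lemmaG [IsNoetherianRing R] (p : Ideal R) [hp : p.IsPrime] (H : Type) [AddCommGroup H] [Module R H] [Module.Finite R H] (h : ¬ ZZ p H) :
    ∃ f : H →ₗ[R] (R ⧸ p), f ≠ 0 := by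
  let A := R ⧸ p
  let V := H ⧸ (p • ⊤ : Submodule R H)
  let K := FractionRing A
  let _ : Module A V := inferInstance
  have : IsScalarTower R A V := inferInstance
  have : Module.Finite R V := inferInstance
  have : Module.Finite A V := Module.Finite.of_restrictScalars_finite R A V
  have hne : ∃ v : V, ∀ a : A, a ≠ 0 → a • v ≠ 0 := by
    by_contra hcon
    push Not at hcon
    have hZ : ZZ p V := by
      intro v
      obtain ⟨a, ha, hav⟩ := hcon v
      obtain ⟨s, rfl⟩ := Ideal.Quotient.mk_surjective a
      refine ⟨s, fun hs => ha (Ideal.Quotient.eq_zero_iff_mem.2 hs), ?_⟩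
      rw [← hav]; exact (algebraMap_smul A s v).symm
    obtain ⟨s, hs, hz⟩ := ZZ_fg p V hZ
    refine h (ZZ_naka p H s hs fun z => ?_)
    have := hz (Submodule.Quotient.mk z)
    rwa [← Submodule.Quotient.mk_smul, Submodule.Quotient.mk_eq_zero] at this
  obtain ⟨v, hv⟩ := hne
  let V' := LocalizedModule (nonZeroDivisors A) V
  let ι : V →ₗ[A] V' := LocalizedModule.mkLinearMap (nonZeroDivisors A) V
  have hιv : ι v ≠ 0 := by
    intro h0
    obtain ⟨c, hc⟩ := (IsLocalizedModule.eq_zero_iff (nonZeroDivisors A) ι).1 h0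
    exact hv c (nonZeroDivisors.ne_zero c.2) hc
  obtain ⟨d, hd⟩ : ∃ d : Module.Dual K V', d (ι v) ≠ 0 := by
    by_contra hcon
    push Not at hcon
    exact hιv ((Module.forall_dual_apply_eq_zero_iff K _).1 hcon)
  have : IsNoetherianRing A := inferInstance
  have : Module.FinitePresentation A V := Module.finitePresentation_of_finite A V
  obtain ⟨g, s, hg⟩ := Module.FinitePresentation.exists_lift_of_isLocalizedModule (nonZeroDivisors A) (Algebra.linearMap A K)
     ((d.restrictScalars A) ∘ₗ ι)
  refine ⟨(g.restrictScalars R) ∘ₗ (Submodule.mkQ _), fun h0 => ?_⟩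
  obtain ⟨x, rfl⟩ := Submodule.mkQ_surjective _ v
  have h1 : g (Submodule.mkQ _ x) = 0 := DFunLike.congr_fun h0 x
  have h2 := DFunLike.congr_fun hg (Submodule.mkQ _ x)
  simp only [LinearMap.comp_apply, h1, map_zero] at h2
  have h3 : s.1 • (d (ι (Submodule.mkQ _ x))) = 0 := h2.symm
  rcases smul_eq_zero.1 h3 with h4 | h4
  · exact nonZeroDivisors.ne_zero s.2 h4
  · exact hd h4
end P9

section P10a
variable {R : Type} [CommRing R]

lemma complex_homologyMap_smul (n : ℤ) {K L : CochainComplex (ModuleCat.{0} R) ℤ} (f : K ⟶ L) (s : R) :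
    HomologicalComplex.homologyMap (s • f) n = s • HomologicalComplex.homologyMap f n := by
  have hc : HomologicalComplex.cyclesMap (s • f) n = s • HomologicalComplex.cyclesMap f n := by
    rw [← cancel_mono (L.iCycles n), HomologicalComplex.cyclesMap_i, Linear.smul_comp, HomologicalComplex.cyclesMap_i,
      HomologicalComplex.smul_f_apply, Linear.comp_smul]
  rw [← cancel_epi (K.homologyπ n), HomologicalComplex.homologyπ_naturality, hc, Linear.smul_comp, Linear.comp_smul,
    HomologicalComplex.homologyπ_naturality]

end P10a
section P10
variable {R : Type} [CommRing R] [HasDerivedCategory.{w} (ModuleCat.{0} R)]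

lemma HH_smul_id (n : ℤ) (s : R) (X : DD R) : (HH R n).map (s • 𝟙 X) = s • 𝟙 _ := by
  have hQ : (DerivedCategory.Q ⋙ HH R n).Linear R := by
    have : (HomologicalComplex.homologyFunctor (ModuleCat.{0} R) (ComplexShape.up ℤ) n).Linear R := 
      ⟨fun f r => complex_homologyMap_smul n f r⟩
    exact Functor.linear_of_iso _ (DerivedCategory.homologyFunctorFactors (ModuleCat.{0} R) n).symm
  let K := DerivedCategory.Q.objPreimage X
  let e : DerivedCategory.Q.obj K ≅ X := DerivedCategory.Q.objObjPreimageIso X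
  have h1 : (DerivedCategory.Q ⋙ HH R n).map (s • 𝟙 K) = s • 𝟙 _ := by
    rw [Functor.map_smul, CategoryTheory.Functor.map_id]
  have h2 : (HH R n).map (s • 𝟙 (DerivedCategory.Q.obj K)) = s • 𝟙 _ := by
    refine Eq.trans ?_ h1
    rw [Functor.comp_map]
    congr 1
    rw [Functor.map_smul, CategoryTheory.Functor.map_id]
  have h3 : s • 𝟙 X = e.inv ≫ (s • 𝟙 (DerivedCategory.Q.obj K)) ≫ e.hom := by simp
  rw [h3, Functor.map_comp, Functor.map_comp, h2]
  simp [← Functor.map_comp]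

lemma smul_factor {X Y Z : DD R} {f : X ⟶ Y} {g : Y ⟶ Z} {h : Z ⟶ X⟦(1:ℤ)⟧}
    (hT : Triangle.mk f g h ∈ distTriang (DD R)) (s : R) (hs : s • 𝟙 Z = 0) : ∃ l : Y ⟶ X, s • 𝟙 Y = l ≫ f := by
  have h0 : (s • 𝟙 Y) ≫ g = 0 := by
    rw [Linear.smul_comp, Category.id_comp, ← Category.comp_id g, ← Linear.comp_smul, hs, comp_zero]
  obtain ⟨l, hl⟩ : ∃ l : Y ⟶ X, s • 𝟙 Y = l ≫ f := Triangle.coyoneda_exact₂ _ hT (s • 𝟙 Y) h0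
  exact ⟨l, hl⟩

lemma exists_ann (p : Ideal R) [hp : p.IsPrime] (B : DD R) (a : ℤ) (k : ℕ) (h1 : ∀ m, m < a → IsZero ((HH R m).obj B))
      (h2 : ∀ m, a + k < m → IsZero ((HH R m).obj B)) (hf : ∀ m, Module.Finite R ((HH R m).obj B))
      (hz : ∀ m, ZZ p ((HH R m).obj B)) : ∃ s, s ∉ p ∧ s • 𝟙 B = 0 := by
  refine devissage (fun Z => ∃ s, s ∉ p ∧ s • 𝟙 Z = 0) (fun Z => ∃ s, s ∉ p ∧ s • 𝟙 Z = 0) ?_ ?_ ?_ ?_ ?_ a k B h1 h2 ?_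
  · rintro X Y e ⟨s, hs, h⟩
    refine ⟨s, hs, ?_⟩
    have : s • 𝟙 Y = e.inv ≫ (s • 𝟙 X) ≫ e.hom := by simp
    rw [this, h]; simp
  · intro X hX
    exact ⟨1, (Ideal.ne_top_iff_one p).1 hp.ne_top, hX.eq_of_src _ _⟩
  · rintro X Y e ⟨s, hs, h⟩
    refine ⟨s, hs, ?_⟩
    have : s • 𝟙 Y = e.inv ≫ (s • 𝟙 X) ≫ e.hom := by simp
    rw [this, h]; simp
  · rintro X Y Z f g h hT ⟨s, hs, e1⟩ ⟨t, ht, e2⟩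
    refine ⟨s * t, fun hst => (hp.mem_or_mem hst).elim hs ht, ?_⟩
    obtain ⟨l, hl⟩ := smul_factor hT t e2
    rw [mul_smul, hl, ← Category.id_comp f, ← Linear.comp_smul, ← Linear.smul_comp, e1]
    simp
  · rintro n Z ⟨s, hs, h⟩
    refine ⟨s, hs, ?_⟩
    rw [← CategoryTheory.Functor.map_id, ← Functor.map_smul, h, Functor.map_zero]
  · intro n
    have := hf n
    obtain ⟨s, hs, h⟩ := ZZ_fg p _ (hz n)
    exact ⟨s, hs, by ext z; exact h z⟩

lemma ZZ_equiv (p : Ideal R) {X Y : ModuleCat.{0} R} (e : X ≅ Y) (h : ZZ p X) : ZZ p Y := by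
  intro z
  obtain ⟨s, hs, hz⟩ := h (e.inv z)
  refine ⟨s, hs, ?_⟩
  have := congrArg e.hom hz
  rw [map_smul, map_zero, Iso.inv_hom_id_apply] at this
  exact this

lemma ZZ_zero (p : Ideal R) [hp : p.IsPrime] {X : ModuleCat.{0} R} (h : IsZero X) : ZZ p X := by
  intro z
  have := ModuleCat.subsingleton_of_isZero h
  exact ⟨1, (Ideal.ne_top_iff_one p).1 hp.ne_top, Subsingleton.elim _ _⟩

theorem exists_b [IsNoetherianRing R] (p : Ideal R) [hp : p.IsPrime] (M : DD R) (b n : ℤ)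
    (h2 : ∀ m, b < m → IsZero ((HH R m).obj M)) (hf : ∀ m, Module.Finite R ((HH R m).obj M))
    (hz : ∀ m, n < m → ZZ p ((HH R m).obj M)) (hn : ¬ ZZ p ((HH R n).obj M)) :
    ∃ β : M ⟶ (DerivedCategory.singleFunctor (ModuleCat.{0} R) n).obj (ModuleCat.of R (R ⧸ p)), (HH R n).map β ≠ 0 := by
  obtain ⟨A, B, f, g, h, hT, hA, hB, hfi, hgi⟩ := trunc_tri M n
  have eB : ∀ m, n < m → ((HH R m).obj M ≅ (HH R m).obj B) := fun m hm =>
      haveI := hgi m hm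
      asIso ((HH R m).map g)
  obtain ⟨s, hs, hsB⟩ : ∃ s, s ∉ p ∧ s • 𝟙 B = 0 := by
    refine exists_ann p B n (b - n).toNat (fun m hm => hB m hm.le) (fun m hm => ?_) (fun m => ?_) (fun m => ?_)
    · exact (h2 m (by omega)).of_iso (eB m (by omega)).symm
    · by_cases hm : n < m
      · have := hf m
        exact Module.Finite.equiv (eB m hm).toLinearEquiv
      · have := ModuleCat.subsingleton_of_isZero (hB m (by omega))
        infer_instance
    · by_cases hm : n < m
      · exact ZZ_equiv p (eB m hm) (hz m hm)
      · exact ZZ_zero p (hB m (by omega))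
  obtain ⟨l, hl⟩ := smul_factor hT s hsB
  obtain ⟨A2, C, f', κ, h', hT', hA2, hC, hf', hκ⟩ := trunc_tri A (n-1)
  have hκn : IsIso ((HH R n).map κ) := hκ n (by omega)
  have hfn : IsIso ((HH R n).map f) := hfi n le_rfl
  have := (DerivedCategory.isGE_iff C n).2 (fun m hm => hC m (by omega))
  have := (DerivedCategory.isLE_iff C n).2 (fun m hm => by
    have := hκ m (by omega)
    exact (hA m hm).of_iso (asIso ((HH R m).map κ)).symm)
  obtain ⟨Y, ⟨e⟩⟩ := DerivedCategory.exists_iso_singleFunctor_obj_of_isGE_of_isLE C n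
  let eY : (HH R n).obj M ≅ Y := (asIso ((HH R n).map f)).symm ≪≫ (asIso ((HH R n).map κ)) ≪≫ (HH R n).mapIso e ≪≫ (HH_single n).app Y
  have := hf n
  have : Module.Finite R Y := Module.Finite.equiv eY.toLinearEquiv
  obtain ⟨b0, hb0⟩ := lemmaG p Y (fun h => hn (ZZ_equiv p eY.symm h))
  let b1 : Y ⟶ ModuleCat.of R (R ⧸ p) := ModuleCat.ofHom b0
  refine ⟨l ≫ κ ≫ e.hom ≫ (DerivedCategory.singleFunctor (ModuleCat.{0} R) n).map b1, fun h0 => hb0 ?_⟩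
  have e1 : (HH R n).map l ≫ (HH R n).map f = s • 𝟙 _ := by
    rw [← Functor.map_comp, ← hl, HH_smul_id]
  have e2 : (HH R n).map l = s • inv ((HH R n).map f) := by
    rw [← cancel_mono ((HH R n).map f), e1]; simp
  have e3 : (HH R n).map ((DerivedCategory.singleFunctor (ModuleCat.{0} R) n).map b1) = (HH_single n).hom.app Y ≫ b1 ≫ (HH_single n).inv.app _ :=
    (NatIso.naturality_2 (HH_single n) b1).symm
  rw [Functor.map_comp, Functor.map_comp, Functor.map_comp, e2, e3] at h0
  have e4 : s • (eY.hom ≫ b1) = 0 := by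
    have := congrArg (fun t => t ≫ (HH_single n).hom.app _) h0
    simp only [Category.assoc, zero_comp] at this
    rw [← this]
    simp [eY]
  have e5 : s • b1 = 0 := by
    have := congrArg (fun t => eY.inv ≫ t) e4
    simpa using this
  ext y
  have e6 : s • b0 y = 0 := by
    have := congrArg (fun t : Y ⟶ ModuleCat.of R (R ⧸ p) => t y) e5
    exact this
  obtain ⟨r, hr⟩ := Ideal.Quotient.mk_surjective (b0 y)
  rw [← hr] at e6
  have e7 : Ideal.Quotient.mk p (s * r) = 0 := e6
  rw [← hr, LinearMap.zero_apply]
  exact Ideal.Quotient.eq_zero_iff_mem.2 ((hp.mem_or_mem (Ideal.Quotient.eq_zero_iff_mem.1 e7)).resolve_left hs)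
end P10

section P11a
variable {R : Type} [CommRing R]

noncomputable abbrev CS (R : Type) [CommRing R] (n : ℤ) : ModuleCat.{0} R ⥤ CochainComplex (ModuleCat.{0} R) ℤ :=
  HomologicalComplex.single (ModuleCat.{0} R) (ComplexShape.up ℤ) n

lemma exists_z (P : CochainComplex (ModuleCat.{0} R) ℤ) (n : ℤ) (A : ModuleCat.{0} R) (φ : P ⟶ (CS R n).obj A)
    (hφ : HomologicalComplex.homologyMap φ n ≠ 0) :
    ∃ (z : (CS R n).obj (ModuleCat.of R R) ⟶ P) (β : ModuleCat.of R R ⟶ A), z ≫ φ = (CS R n).map β ∧ β ≠ 0 := by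
  have h1 : P.iCycles n ≫ φ.f n ≠ 0 := by
    intro h0
    apply hφ
    have hc : HomologicalComplex.cyclesMap φ n = 0 := by
      rw [← cancel_mono (((CS R n).obj A).iCycles n), HomologicalComplex.cyclesMap_i, h0, zero_comp]
    rw [← cancel_epi (P.homologyπ n), HomologicalComplex.homologyπ_naturality, hc, zero_comp, comp_zero]
  obtain ⟨c, hc⟩ : ∃ c, (P.iCycles n ≫ φ.f n).hom c ≠ 0 := by
    by_contra hcon
    push Not at hcon
    exact h1 (by ext c; exact hcon c)
  let q : ModuleCat.of R R ⟶ P.cycles n := ModuleCat.ofHom (LinearMap.toSpanSingleton R _ c)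
  have hq : q.hom (1 : R) = c := LinearMap.toSpanSingleton_apply_one R _ c
  let z : (CS R n).obj (ModuleCat.of R R) ⟶ P := HomologicalComplex.mkHomFromSingle (q ≫ P.iCycles n) (by
    intro k _
    rw [Category.assoc, HomologicalComplex.iCycles_d, comp_zero])
  obtain ⟨β, hβ⟩ := (CS R n).map_surjective (z ≫ φ)
  refine ⟨z, β, hβ.symm, ?_⟩
  rintro rfl
  rw [Functor.map_zero] at hβ
  have h2 := HomologicalComplex.congr_hom hβ n
  rw [HomologicalComplex.comp_f, HomologicalComplex.mkHomFromSingle_f, HomologicalComplex.zero_f, Category.assoc] at h2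
  have h3 : (q ≫ P.iCycles n) ≫ φ.f n = 0 := by
    rw [← cancel_epi (HomologicalComplex.singleObjXSelf (ComplexShape.up ℤ) n (ModuleCat.of R R)).hom, ← h2, comp_zero]
  apply hc
  rw [← hq]
  have := congrArg (fun t : ModuleCat.of R R ⟶ _ => t.hom (1:R)) h3
  exact this

lemma exists_ab (p : Ideal R) (P : CochainComplex (ModuleCat.{0} R) ℤ) (n : ℤ) 
    (φ : P ⟶ (CS R n).obj (ModuleCat.of R (R ⧸ p)))
    (hφ : HomologicalComplex.homologyMap φ n ≠ 0) :
    ∃ (r : R) (_ : r ∉ p) (a : (CS R n).obj (ModuleCat.of R (R ⧸ p)) ⟶ (TT (ModuleCat.of R (R ⧸ p))).obj P)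
      (b : (TT (ModuleCat.of R (R ⧸ p))).obj P ⟶ (CS R n).obj (ModuleCat.of R (R ⧸ p))),
      a ≫ b = (CS R n).map (r • 𝟙 _) := by
  obtain ⟨z, β, hz, hβ⟩ := exists_z P n _ φ hφ
  let A := ModuleCat.of R (R ⧸ p)
  obtain ⟨r, hr⟩ := Ideal.Quotient.mk_surjective (β.hom (1:R))
  let E := HomologicalComplex.singleMapHomologicalComplex (MonoidalCategory.tensorRight A) (ComplexShape.up ℤ) n
  let lu : A ⟶ (MonoidalCategory.tensorRight A).obj (ModuleCat.of R R) := (MonoidalCategoryStruct.leftUnitor A).inv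
  let μ : (MonoidalCategory.tensorRight A).obj A ⟶ A := ModuleCat.ofHom (LinearMap.mul' R (R ⧸ p))
  refine ⟨r, ?_, (CS R n).map lu ≫ E.inv.app _ ≫ (TT A).map z, (TT A).map φ ≫ E.hom.app _ ≫ (CS R n).map μ, ?_⟩
  · intro hrp
    apply hβ
    rw [Ideal.Quotient.eq_zero_iff_mem.2 hrp] at hr
    ext
    exact hr.symm
  · have h1 : (TT A).map z ≫ (TT A).map φ = (TT A).map ((CS R n).map β) := by rw [← Functor.map_comp, hz]
    have h2 : E.inv.app _ ≫ (TT A).map ((CS R n).map β) ≫ E.hom.app _ = (CS R n).map ((MonoidalCategory.tensorRight A).map β) :=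
      NatIso.naturality_1 E β
    have h3 : lu ≫ (MonoidalCategory.tensorRight A).map β ≫ μ = r • 𝟙 _ := by
      refine ModuleCat.hom_ext (LinearMap.ext fun (y : R ⧸ p) => ?_)
      change β.hom (1:R) * y = r • y
      rw [← hr]; rfl
    rw [← h3, Functor.map_comp, Functor.map_comp, ← h2, ← h1]
    simp only [Category.assoc]
end P11a
section P11
variable {R : Type} [CommRing R] [HasDerivedCategory.{w} (ModuleCat.{0} R)]

noncomputable abbrev sgl (R : Type) [CommRing R] [HasDerivedCategory.{w} (ModuleCat.{0} R)] (n : ℤ) : ModuleCat.{0} R ⥤ DD R :=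
  DerivedCategory.singleFunctor (ModuleCat.{0} R) n

theorem exists_cyc (p : Ideal R) (P : CochainComplex (ModuleCat.{0} R) ℤ) (hP : PBd P) (n : ℤ)
    (b : DerivedCategory.Q.obj P ⟶ (sgl R n).obj (ModuleCat.of R (R ⧸ p))) (hb : (HH R n).map b ≠ 0) :
    ∃ (r : R) (_ : r ∉ p) (a : (sgl R n).obj (ModuleCat.of R (R ⧸ p)) ⟶ DerivedCategory.Q.obj ((TT (ModuleCat.of R (R ⧸ p))).obj P))
      (b : DerivedCategory.Q.obj ((TT (ModuleCat.of R (R ⧸ p))).obj P) ⟶ (sgl R n).obj (ModuleCat.of R (R ⧸ p))),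
      a ≫ b = (sgl R n).map (r • 𝟙 _) := by
  obtain ⟨φ, hφ⟩ := lift_Q (L := (CS R n).obj (ModuleCat.of R (R ⧸ p))) hP b
  have h1 : HomologicalComplex.homologyMap φ n ≠ 0 := by
    intro h0
    apply hb
    rw [← hφ]
    have := NatIso.naturality_2 (DerivedCategory.homologyFunctorFactors (ModuleCat.{0} R) n) φ
    refine this.symm.trans ?_
    have h0' : (HomologicalComplex.homologyFunctor (ModuleCat.{0} R) (ComplexShape.up ℤ) n).map φ = 0 := h0
    rw [h0', zero_comp, comp_zero]
    rfl
  obtain ⟨r, hr, a, b', hab⟩ := exists_ab p P n φ h1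
  refine ⟨r, hr, DerivedCategory.Q.map a, DerivedCategory.Q.map b', ?_⟩
  exact (DerivedCategory.Q.map_comp a b').symm.trans (congrArg _ hab)
end P11

section P12
variable {R : Type} [CommRing R] [HasDerivedCategory.{w} (ModuleCat.{0} R)]

lemma sgl_tri (s : ShortComplex (ModuleCat.{0} R)) (hs : s.ShortExact) (n : ℤ) :
    ∃ δ, Triangle.mk ((sgl R n).map s.f) ((sgl R n).map s.g) δ ∈ distTriang (DD R) :=
  ⟨_, DerivedCategory.triangleOfSES_distinguished (hs.map_of_exact (CS R n))⟩

lemma sgl_fg [IsNoetherianRing R] {S : Set (DD R)} (hS : IsCocompletePreaisle R S) (n : ℤ) (p : Ideal R) (r : R) (hr : r ∉ p)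
    (hq : ∀ q : Ideal R, q.IsPrime → p < q → (sgl R n).obj (ModuleCat.of R (R ⧸ q)) ∈ S)
    (N : Type) [AddCommGroup N] [Module R N] [hN : Module.Finite R N] :
    (∀ x ∈ p ⊔ Ideal.span {r}, ∀ z : N, x • z = 0) → (sgl R n).obj (ModuleCat.of R N) ∈ S := by
  refine IsNoetherianRing.induction_on_isQuotientEquivQuotientPrime R hN
    (motive := fun N _ _ _ => (∀ x ∈ p ⊔ Ideal.span {r}, ∀ z : N, x • z = 0) → (sgl R n).obj (ModuleCat.of R N) ∈ S) ?_ ?_ ?_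
  · intro N _ _ _ _ _
    exact zero_mem_S hS (Functor.map_isZero _ (ModuleCat.isZero_of_subsingleton _))
  · intro N _ _ _ q e hx
    have hle : p ⊔ Ideal.span {r} ≤ q.1 := by
      intro x hxm
      have h1 := hx x hxm (e.symm (Ideal.Quotient.mk q.1 1))
      have h2 := congrArg e h1
      rw [map_smul, map_zero, LinearEquiv.apply_symm_apply] at h2
      have h3 : Ideal.Quotient.mk q.1 (x * 1) = 0 := h2
      rw [mul_one] at h3
      exact Ideal.Quotient.eq_zero_iff_mem.1 h3
    have hlt : p < q.1 := lt_of_le_of_ne (le_sup_left.trans hle) (by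
      intro h
      apply hr
      rw [h]
      exact hle (Ideal.mem_sup_right (Ideal.mem_span_singleton_self r)))
    have ee : ModuleCat.of R (R ⧸ q.1) ≅ ModuleCat.of R N := e.symm.toModuleIso
    exact hS.mem_of_iso ((sgl R n).mapIso ee) (hq q.1 q.2 hlt)
  · intro N₁ _ _ _ N₂ _ _ _ N₃ _ _ _ f g hf hg hfg h1 h3 hx
    have hs : (ShortComplex.mk (X₁ := ModuleCat.of R N₁) (X₂ := ModuleCat.of R N₂) (X₃ := ModuleCat.of R N₃)
        (ModuleCat.ofHom f) (ModuleCat.ofHom g) (by ext x; exact hfg.apply_apply_eq_zero x)).ShortExact := by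
      refine ShortComplex.ShortExact.mk' ?_ ?_ ?_
      · rw [ShortComplex.ShortExact.moduleCat_exact_iff_function_exact]; exact hfg
      · rw [ModuleCat.mono_iff_injective]; exact hf
      · rw [ModuleCat.epi_iff_surjective]; exact hg
    obtain ⟨δ, hT⟩ := sgl_tri _ hs n
    refine hS.ext_mem _ _ _ hT (h1 ?_) (h3 ?_)
    · intro x hxm z
      apply hf
      rw [map_smul, map_zero, hx x hxm]
    · intro x hxm z
      obtain ⟨y, rfl⟩ := hg z
      rw [← map_smul, hx x hxm, map_zero]

lemma sgl_shift {S : Set (DD R)} (hS : IsCocompletePreaisle R S) (N : ModuleCat.{0} R) (n : ℤ) (k : ℕ)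
    (h : (sgl R n).obj N ∈ S) : (sgl R (n - k)).obj N ∈ S := by
  induction k with
  | zero => simpa using h
  | succ k ih =>
    refine hS.mem_of_iso (((DerivedCategory.singleFunctors (ModuleCat.{0} R)).shiftIso 1 (n - (k+1 : ℕ)) (n-k) (by push_cast; ring)).app N) ?_
    exact hS.shift_mem ih

lemma sgl_step [IsNoetherianRing R] {S : Set (DD R)} (hS : IsCocompletePreaisle R S) (M : DD R) (hM : M ∈ S)
    (a : ℤ) (k : ℕ) (h1 : ∀ m, m < a → IsZero ((HH R m).obj M))
    (h2 : ∀ m, a + k < m → IsZero ((HH R m).obj M)) (hf : ∀ m, Module.Finite R ((HH R m).obj M))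
    (p : Ideal R) [hp : p.IsPrime] (n : ℤ) (hq : ∀ q : Ideal R, q.IsPrime → p < q → (sgl R n).obj (ModuleCat.of R (R ⧸ q)) ∈ S)
    (hz : ∀ m, n < m → ZZ p ((HH R m).obj M)) (hn : ¬ ZZ p ((HH R n).obj M)) :
    (sgl R n).obj (ModuleCat.of R (R ⧸ p)) ∈ S := by
  obtain ⟨b, hb⟩ := exists_b p M (a + k) n h2 hf hz hn
  obtain ⟨P, hP, ⟨e⟩⟩ := exists_PRes M a k h1 h2
  have hPS : DerivedCategory.Q.obj P ∈ S := hS.mem_of_iso e hM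
  have hb' : (HH R n).map (e.inv ≫ b) ≠ 0 := by
    intro h0
    apply hb
    have : b = e.hom ≫ e.inv ≫ b := by simp
    rw [this, Functor.map_comp, h0, comp_zero]
  obtain ⟨r, hr, u, v, huv⟩ := exists_cyc p P hP n (e.inv ≫ b) hb'
  let A := ModuleCat.of R (R ⧸ p)
  let ρ : (R ⧸ p) →ₗ[R] (R ⧸ p) := r • LinearMap.id
  have hs : (ShortComplex.mk (X₁ := A) (X₂ := A) (X₃ := ModuleCat.of R ((R ⧸ p) ⧸ LinearMap.range ρ))
      (r • 𝟙 A) (ModuleCat.ofHom (LinearMap.range ρ).mkQ) (by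
        refine ModuleCat.hom_ext (LinearMap.ext fun (y : R ⧸ p) => ?_)
        exact (Submodule.Quotient.mk_eq_zero _).2 ⟨y, rfl⟩)).ShortExact := by
    refine ShortComplex.ShortExact.mk' ?_ ?_ ?_
    · rw [ShortComplex.ShortExact.moduleCat_exact_iff_function_exact]
      exact LinearMap.exact_map_mkQ_range ρ
    · rw [ModuleCat.mono_iff_injective]
      have : Function.Injective ρ := by
        rw [injective_iff_map_eq_zero]
        intro y hy
        obtain ⟨x, rfl⟩ := Ideal.Quotient.mk_surjective y
        have h7 : Ideal.Quotient.mk p (r * x) = 0 := hy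
        exact Ideal.Quotient.eq_zero_iff_mem.2 ((hp.mem_or_mem (Ideal.Quotient.eq_zero_iff_mem.1 h7)).resolve_left hr)
      exact this
    · rw [ModuleCat.epi_iff_surjective]; exact Submodule.mkQ_surjective _
  obtain ⟨δ, hT⟩ := sgl_tri _ hs n
  have hw : (sgl R n).obj (ModuleCat.of R ((R ⧸ p) ⧸ LinearMap.range ρ)) ∈ S := by
    refine sgl_fg hS n p r hr hq _ ?_
    intro x hx z
    obtain ⟨y, rfl⟩ := Submodule.mkQ_surjective _ z
    obtain ⟨t, rfl⟩ := Ideal.Quotient.mk_surjective y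
    rw [← map_smul]
    refine (Submodule.Quotient.mk_eq_zero _).2 ?_
    obtain ⟨i, hi, j, hj, rfl⟩ := Submodule.mem_sup.1 hx
    obtain ⟨c, rfl⟩ := Ideal.mem_span_singleton'.1 hj
    refine ⟨Ideal.Quotient.mk p (c * t), ?_⟩
    change Ideal.Quotient.mk p (r * (c * t)) = Ideal.Quotient.mk p ((i + c * r) * t)
    rw [Ideal.Quotient.eq]
    have : r * (c * t) - (i + c * r) * t = - (i * t) := by ring
    rw [this]
    exact p.neg_mem (p.mul_mem_right _ hi)
  have hT' : Triangle.mk (u ≫ v) ((sgl R n).map (ModuleCat.ofHom (LinearMap.range ρ).mkQ)) δ ∈ distTriang (DD R) := by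
    rw [huv]; exact hT
  refine cyc_mem hS u v _ _ hT' (TT_mem hS P hP hPS A) hw (n+1) ?_
  intro m hm
  exact (DerivedCategory.isLE_iff ((sgl R n).obj A) n).1 inferInstance m (by omega)

theorem sgl_main [IsNoetherianRing R] {S : Set (DD R)} (hS : IsCocompletePreaisle R S) (M : DD R) (hM : M ∈ S)
    (a : ℤ) (k : ℕ) (h1 : ∀ m, m < a → IsZero ((HH R m).obj M))
    (h2 : ∀ m, a + k < m → IsZero ((HH R m).obj M)) (hf : ∀ m, Module.Finite R ((HH R m).obj M))
    (p : Ideal R) : p.IsPrime → ∀ n : ℤ, ¬ ZZ p ((HH R n).obj M) → (sgl R n).obj (ModuleCat.of R (R ⧸ p)) ∈ S := by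
  induction p using WellFoundedGT.induction with
  | ind p ih =>
    intro hp n hn
    obtain ⟨n0, hn0, hmax⟩ := Int.exists_greatest_of_bdd (P := fun m => ¬ ZZ p ((HH R m).obj M))
      ⟨a + k, fun m hm => by
        by_contra hcon
        exact hm (ZZ_zero p (h2 m (by omega)))⟩ ⟨n, hn⟩
    have hle := hmax n hn
    have key : (sgl R n0).obj (ModuleCat.of R (R ⧸ p)) ∈ S := by
      refine sgl_step hS M hM a k h1 h2 hf p n0 (fun q hq hpq => ih q hpq hq n0 ?_) (fun m hm => ?_) hn0
      · intro hZ
        apply hn0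
        intro z
        obtain ⟨s, hs, h⟩ := hZ z
        exact ⟨s, fun h' => hs (hpq.le h'), h⟩
      · by_contra hcon
        have := hmax m hcon
        omega
    have := sgl_shift hS _ n0 (n0 - n).toNat key
    rwa [show n0 - ((n0 - n).toNat : ℤ) = n by omega] at this
end P12


/-- Let `R` be Noetherian, `M ∈ D_qc(R)`, `i : ℤ`, and let `p ⊆ p'` be
primes with `p ∈ Ass H_i(M)`. Then for every `t ≥ i`, the object `s^t (R/p')` lies in
every cocomplete preaisle of `D(R)` containing `M`. -/
theorem stmt12 (R : Type) [CommRing R] [IsNoetherianRing R]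
    [HasDerivedCategory.{w} (ModuleCat R)]
    (M : DerivedCategory (ModuleCat R)) (hM : memDqc R M)
    (i : ℤ) (p p' : Ideal R) (hp : p.IsPrime) (hp' : p'.IsPrime) (hpp : p ≤ p')
    (hass : p ∈ associatedPrimes R ↥(Hh R i M)) :
    ∀ t : ℤ, i ≤ t →
      ∀ S : Set (DerivedCategory (ModuleCat R)), IsCocompletePreaisle R S → M ∈ S →
        sdeg R t (ModuleCat.of R (R ⧸ p')) ∈ S := by
  intro t ht S hS hMS
  obtain ⟨hfin, hbd⟩ := hM
  obtain ⟨lo, hlo⟩ := hbd.bddBelow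
  obtain ⟨hi, hhi⟩ := hbd.bddAbove
  have hz : ∀ m : ℤ, ¬ (-hi ≤ m ∧ m ≤ -lo) → IsZero ((HH R m).obj M) := by
    intro m hm
    by_contra hcon
    have hmem : -m ∈ {n : ℤ | ¬ IsZero (Hh R n M)} := by
      intro h0
      apply hcon
      unfold Hh at h0
      rw [neg_neg] at h0
      exact h0
    have := hlo hmem
    have := hhi hmem
    omega
  have hf : ∀ m : ℤ, Module.Finite R ((HH R m).obj M) := by
    intro m
    have := hfin (-m)
    unfold Hh at this
    rw [neg_neg] at this
    exact this
  have hn : ¬ ZZ p' ((HH R (-i)).obj M) := by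
    intro hZ
    obtain ⟨-, x, hx⟩ := hass
    obtain ⟨s, hs, hsx⟩ := hZ x
    apply hs
    apply hpp
    rw [hx]
    refine Ideal.le_radical ?_
    rw [Submodule.mem_colon_singleton]
    exact (Submodule.mem_bot R).2 hsx
  have key := sgl_main hS M hMS (-hi) (hi - lo).toNat (fun m hm => hz m (by omega)) (fun m hm => hz m (by omega)) hf p' hp' (-i) hn
  have := sgl_shift hS _ (-i) (t - i).toNat key
  unfold sdeg
  rwa [show -i - ((t - i).toNat : ℤ) = -t by omega] at this
end

section
/- Let R be a commutative Noetherian ring. For every f ∈ 𝒮, one has φ(N(f)) = f; that is, for every n ∈ ℤ and every prime p of R, p ∈ f(n) if and only if there exist M ∈ N(f) and q ∈ Ass H_n(M) with q ⊆ p. -/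
open CategoryTheory CategoryTheory.Limits CategoryTheory.Pretriangulated

universe w

section Invariants

variable (R : Type) [CommRing R] [HasDerivedCategory.{w} (ModuleCat R)]

/-- The invariant `φ`: for a class `A` of objects of `D_qc(R)` and `n : ℤ`,
`φ(A)(n)` is the set of primes `p` such that there are `M ∈ A` and
`q ∈ Ass H_n(M)` with `q ⊆ p`. -/
noncomputable def phi (A : Set (DerivedCategory (ModuleCat R))) (n : ℤ) :
    Set (PrimeSpectrum R) :=
  {p | ∃ M ∈ A, ∃ q ∈ associatedPrimes R ↥(Hh R n M), q ≤ p.asIdeal}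

/-- `N(f)`: the intersection with `D_qc(R)` of the smallest cocomplete preaisle of
`D(R)` containing `s^n (R/p)` for every `n : ℤ` and every `p ∈ f(n)`. -/
noncomputable def Nfun (f : ℤ → Set (PrimeSpectrum R)) :
    Set (DerivedCategory (ModuleCat R)) :=
  {M | memDqc R M ∧ ∀ S : Set (DerivedCategory (ModuleCat R)), IsCocompletePreaisle R S →
    (∀ (n : ℤ), ∀ p ∈ f n, sdeg R n (ModuleCat.of R (R ⧸ p.asIdeal)) ∈ S) → M ∈ S}

/-- A nullity class in `D_qc(R)`: the intersection of a cocomplete preaisle of `D(R)`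
with `D_qc(R)`. -/
def IsNullityClass (A : Set (DerivedCategory (ModuleCat R))) : Prop :=
  ∃ U : Set (DerivedCategory (ModuleCat R)), IsCocompletePreaisle R U ∧
    A = U ∩ {M | memDqc R M}

end Invariants

/-- Injective modules that separate the prime `q`. -/
def GoodInj (R : Type) [CommRing R] (q : Ideal R) (E : ModuleCat.{0} R) : Prop :=
  Injective E ∧ (∀ r : R, r ∉ q → ∀ e : E, r • e = 0 → e = 0)

theorem exists_goodInj (R : Type) [CommRing R] (q : Ideal R) [q.IsPrime] :
    ∃ E : ModuleCat.{0} R, GoodInj R q E ∧ ∃ e : E, e ≠ 0 ∧ ∀ r ∈ q, r • e = 0 := by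
  have hflat : Module.Flat R (Localization.AtPrime q) :=
    IsLocalization.flat (Localization.AtPrime q) q.primeCompl
  have hinj : Module.Injective R (CharacterModule (Localization.AtPrime q)) :=
    Module.Flat.iff_characterModule_injective.mp hflat
  refine ⟨ModuleCat.of R (CharacterModule (Localization.AtPrime q)),
    ⟨Module.injective_object_of_injective_module R _, ?_⟩, ?_⟩
  · intro r hr (e : CharacterModule (Localization.AtPrime q)) he
    have he' : r • e = 0 := he
    change e = 0
    ext x
    obtain ⟨u, hu⟩ := IsLocalization.map_units (Localization.AtPrime q) (⟨r, hr⟩ : q.primeCompl)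
    have h := DFunLike.congr_fun he' ((↑u⁻¹ : Localization.AtPrime q) * x)
    rw [CharacterModule.smul_apply, Algebra.smul_def, ← mul_assoc] at h
    simp only at hu
    rw [← hu, Units.mul_inv, one_mul] at h
    exact h
  · obtain ⟨c, hc⟩ := CharacterModule.exists_character_apply_ne_zero_of_ne_zero
      (one_ne_zero (α := q.ResidueField))
    let e : CharacterModule (Localization.AtPrime q) :=
      AddMonoidHom.comp (c : q.ResidueField →+ AddCircle (1 : ℚ))
        (IsLocalRing.residue (Localization.AtPrime q)).toAddMonoidHom
    have hev : ∀ x, e x = c (IsLocalRing.residue _ x) := fun _ => rfl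
    refine ⟨e, ?_, ?_⟩
    · intro h0
      apply hc
      have := DFunLike.congr_fun (show e = 0 from h0) 1
      rw [hev, map_one] at this
      exact this
    · intro r hr
      change r • e = 0
      ext x
      rw [CharacterModule.smul_apply, hev, Algebra.smul_def, map_mul]
      have : IsLocalRing.residue _ (algebraMap R (Localization.AtPrime q) r) = 0 := by
        rw [IsLocalRing.residue_eq_zero_iff, ← Localization.AtPrime.map_eq_maximalIdeal]
        exact Ideal.mem_map_of_mem _ hr
      rw [this, zero_mul, map_zero]
      rfl

section cat

variable {C : Type*} [Category C] [Abelian C]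

theorem isKInj_single (E : C) [Injective E] (n : ℤ) :
    CochainComplex.IsKInjective ((HomologicalComplex.single C (ComplexShape.up ℤ) n).obj E) := by
  have : ∀ i : ℤ, Injective (((HomologicalComplex.single C (ComplexShape.up ℤ) n).obj E).X i) := by
    intro i
    by_cases h : i = n
    · subst h
      exact Injective.of_iso (HomologicalComplex.singleObjXSelf (ComplexShape.up ℤ) i E).symm
        inferInstance
    · have h0 := HomologicalComplex.isZero_single_obj_X (ComplexShape.up ℤ) n E i h
      exact Injective.of_iso h0.isoZero.symm inferInstance
  exact CochainComplex.isKInjective_of_injective _ n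

variable [HasDerivedCategory.{w} C]

theorem single_hom_eq_zero (A E : C) [Injective E] (m n : ℤ)
    (h : m = n → ∀ g : A ⟶ E, g = 0)
    (φ : (DerivedCategory.singleFunctor C m).obj A ⟶ (DerivedCategory.singleFunctor C n).obj E) :
    φ = 0 := by
  have := isKInj_single E n
  obtain ⟨g, hg⟩ := (CochainComplex.IsKInjective.Qh_map_bijective
    ((HomotopyCategory.quotient _ _).obj
      ((HomologicalComplex.single C (ComplexShape.up ℤ) m).obj A))
    ((HomologicalComplex.single C (ComplexShape.up ℤ) n).obj E)).2 φ
  obtain ⟨g', rfl⟩ := (HomotopyCategory.quotient _ _).map_surjective g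
  have hg' : g' = 0 := by
    by_cases hmn : m = n
    · subst hmn
      obtain ⟨k, rfl⟩ := (HomologicalComplex.single C (ComplexShape.up ℤ) m).map_surjective g'
      rw [h rfl k, Functor.map_zero]
    · apply HomologicalComplex.to_single_hom_ext
      exact (HomologicalComplex.isZero_single_obj_X (ComplexShape.up ℤ) m A n
        (Ne.symm hmn)).eq_of_src _ _
  rw [← hg, hg', Functor.map_zero, Functor.map_zero]
  rfl

theorem exists_hom_single (M : DerivedCategory C) (E : C) [Injective E] (n : ℤ)
    (g : (DerivedCategory.homologyFunctor C n).obj M ⟶ E)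
    (h : ∀ φ : M ⟶ (DerivedCategory.singleFunctor C n).obj E, φ = 0) : g = 0 := by
  let K := (DerivedCategory.Q (C := C)).objPreimage M
  let e : DerivedCategory.Q.obj K ≅ M := (DerivedCategory.Q (C := C)).objObjPreimageIso M
  let a : K.homology n ≅ (DerivedCategory.homologyFunctor C n).obj M :=
    ((DerivedCategory.homologyFunctorFactors C n).app K).symm ≪≫
      (DerivedCategory.homologyFunctor C n).mapIso e
  let k : K.opcycles n ⟶ E := Injective.factorThru (a.hom ≫ g) (K.homologyι n)
  have hk : K.homologyι n ≫ k = a.hom ≫ g := Injective.comp_factorThru _ _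
  let ψ : K ⟶ (HomologicalComplex.single C (ComplexShape.up ℤ) n).obj E :=
    HomologicalComplex.mkHomToSingle (K.pOpcycles n ≫ k) (by intro i _; simp)
  have hψ : DerivedCategory.Q.map ψ = 0 := by
    have := h (e.inv ≫ DerivedCategory.Q.map ψ)
    exact (cancel_epi e.inv).1 (this.trans comp_zero.symm)
  have h2 : HomologicalComplex.homologyMap ψ n = 0 := by
    have := DerivedCategory.homologyFunctorFactors_hom_naturality ψ n
    rw [hψ, Functor.map_zero, zero_comp] at this
    exact (cancel_epi ((DerivedCategory.homologyFunctorFactors C n).hom.app K)).1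
      (this.symm.trans comp_zero.symm)
  have h3 := HomologicalComplex.homologyι_naturality ψ n
  rw [h2, zero_comp] at h3
  have h4 : HomologicalComplex.opcyclesMap ψ n ≫
      (HomologicalComplex.singleObjOpcyclesSelfIso (ComplexShape.up ℤ) n E).inv = k := by
    rw [← cancel_epi (K.pOpcycles n), HomologicalComplex.p_opcyclesMap_assoc]
    simp [ψ]
  rw [← cancel_epi a.hom, ← hk, ← h4, ← Category.assoc, ← h3, zero_comp, comp_zero]

end cat

/-- The preaisle used to bound `N(f)` from above. -/
def bigS (R : Type) [CommRing R] [HasDerivedCategory.{w} (ModuleCat.{0} R)]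
    (f : ℤ → Set (PrimeSpectrum R)) : Set (DerivedCategory (ModuleCat.{0} R)) :=
  {M | ∀ n : ℤ, ∀ q : PrimeSpectrum R, q ∉ f n → ∀ E, GoodInj R q.asIdeal E →
    ∀ φ : M ⟶ sdeg R n E, φ = 0}

theorem bigS_preaisle (R : Type) [CommRing R] [HasDerivedCategory.{w} (ModuleCat.{0} R)]
    (f : ℤ → Set (PrimeSpectrum R)) (hincr : ∀ n : ℤ, f n ⊆ f (n + 1)) :
    IsCocompletePreaisle R (bigS R f) where
  mem_of_iso X Y e hX n q hq E hE φ := by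
    rw [← cancel_epi e.hom, hX n q hq E hE (e.hom ≫ φ), comp_zero]
  shift_mem X hX n q hq E hE φ := by
    have hq' : q ∉ f (n - 1) := fun h => hq (by simpa using hincr (n - 1) h)
    let i := (DerivedCategory.singleFunctors (ModuleCat.{0} R)).shiftIso (-1) (-(n - 1)) (-n)
      (by lia)
    have h := hX (n - 1) q hq' E hE
      ((shiftShiftNeg X (1 : ℤ)).inv ≫ φ⟦(-1 : ℤ)⟧' ≫ i.hom.app E)
    apply (shiftFunctor (DerivedCategory (ModuleCat.{0} R)) (-1 : ℤ)).map_injective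
    rw [Functor.map_zero]
    have h1 := (cancel_epi (shiftShiftNeg X (1 : ℤ)).inv).1 (h.trans comp_zero.symm)
    exact (cancel_mono (i.hom.app E)).1 (h1.trans zero_comp.symm)
  ext_mem X Y Z u v t hT hX hZ n q hq E hE φ := by
    obtain ⟨ψ, rfl⟩ := Triangle.yoneda_exact₂ _ hT φ (hX n q hq E hE (u ≫ φ))
    have : ψ = 0 := hZ n q hq E hE ψ
    rw [this, comp_zero]
    rfl
  coproduct_mem ι X c hc hX n q hq E hE φ := by
    apply hc.hom_ext
    rintro ⟨i⟩
    rw [comp_zero]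
    exact hX i n q hq E hE _

theorem gen_mem_bigS (R : Type) [CommRing R] [HasDerivedCategory.{w} (ModuleCat.{0} R)]
    (f : ℤ → Set (PrimeSpectrum R))
    (hspec : ∀ n : ℤ, ∀ p ∈ f n, ∀ q : PrimeSpectrum R, p.asIdeal ≤ q.asIdeal → q ∈ f n)
    (m : ℤ) (p : PrimeSpectrum R) (hp : p ∈ f m) :
    sdeg R m (ModuleCat.of R (R ⧸ p.asIdeal)) ∈ bigS R f := by
  intro n q hq E hE φ
  have := hE.1
  refine single_hom_eq_zero _ _ _ _ ?_ φ
  intro hmn g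
  obtain rfl : m = n := by lia
  have hle : ¬ p.asIdeal ≤ q.asIdeal := fun h => hq (hspec m p hp q h)
  obtain ⟨r, hrp, hrq⟩ := SetLike.not_le_iff_exists.mp hle
  apply ModuleCat.hom_ext
  apply LinearMap.ext
  intro x
  change g.hom x = 0
  apply hE.2 r hrq
  have hx : r • x = 0 := by
    obtain ⟨y, rfl⟩ := Ideal.Quotient.mk_surjective x
    change Ideal.Quotient.mk p.asIdeal (r * y) = 0
    exact Ideal.Quotient.eq_zero_iff_mem.mpr (Ideal.mul_mem_right _ _ hrp)
  rw [← map_smul, hx, map_zero]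

theorem sdeg_homology_zero (R : Type) [CommRing R] [HasDerivedCategory.{w} (ModuleCat.{0} R)]
    (n m : ℤ) (A : ModuleCat.{0} R) (h : m ≠ n) : IsZero (Hh R m (sdeg R n A)) := by
  refine IsZero.of_iso (HomologicalComplex.isZero_single_obj_homology (ComplexShape.up ℤ) (-n) A
    (-m) (by lia)) ?_
  exact (DerivedCategory.homologyFunctorFactors (ModuleCat.{0} R) (-m)).app
    ((HomologicalComplex.single (ModuleCat.{0} R) (ComplexShape.up ℤ) (-n)).obj A)

/-- Homology of a module in a single degree. -/
noncomputable def sdegHomologyIso (R : Type) [CommRing R]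
    [HasDerivedCategory.{w} (ModuleCat.{0} R)]
    (n : ℤ) (A : ModuleCat.{0} R) : Hh R n (sdeg R n A) ≅ A :=
  (DerivedCategory.singleFunctorCompHomologyFunctorIso (ModuleCat.{0} R) (-n)).app A

theorem sdeg_memDqc (R : Type) [CommRing R] [HasDerivedCategory.{w} (ModuleCat.{0} R)]
    (n : ℤ) (A : ModuleCat.{0} R) [Module.Finite R A] : memDqc R (sdeg R n A) := by
  constructor
  · intro m
    by_cases h : m = n
    · subst h
      exact Module.Finite.equiv (sdegHomologyIso R m A).toLinearEquiv.symm
    · have := ModuleCat.subsingleton_of_isZero (sdeg_homology_zero R n m A h)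
      infer_instance
  · refine (Set.finite_singleton n).subset ?_
    intro m hm
    by_contra h
    exact hm (sdeg_homology_zero R n m A h)

/-- For every `f ∈ 𝒮` (an increasing function from `ℤ` to
specialization-closed sets of primes), one has `φ(N(f)) = f`. -/
theorem stmt13 (R : Type) [CommRing R] [IsNoetherianRing R]
    [HasDerivedCategory.{w} (ModuleCat R)]
    (f : ℤ → Set (PrimeSpectrum R))
    (hspec : ∀ n : ℤ, ∀ p ∈ f n, ∀ q : PrimeSpectrum R, p.asIdeal ≤ q.asIdeal → q ∈ f n)
    (hincr : ∀ n : ℤ, f n ⊆ f (n + 1)) :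
    phi R (Nfun R f) = f := by
  funext n
  ext p
  constructor
  · rintro ⟨M, ⟨-, hM⟩, q, hq, hqp⟩
    have hMS := hM _ (bigS_preaisle R f hincr) (fun m p hp => gen_mem_bigS R f hspec m p hp)
    have hq' : IsAssociatedPrime q (Hh R n M) := hq
    have hprime : q.IsPrime := hq'.isPrime
    refine hspec n ⟨q, hprime⟩ ?_ p hqp
    by_contra hqf
    obtain ⟨E, hE, e, he, hqe⟩ := exists_goodInj R q
    have := hE.1
    obtain ⟨-, j, hj⟩ := (isAssociatedPrime_iff_exists_injective_linearMap q _).mp hq'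
    let l : R ⧸ q →ₗ[R] E := Submodule.liftQ q (LinearMap.toSpanSingleton R E e)
      (fun r hr => hqe r hr)
    have hl : l (Submodule.Quotient.mk 1) = e := by
      exact one_smul R e
    let j' : ModuleCat.of R (R ⧸ q) ⟶ Hh R n M := ModuleCat.ofHom j
    have : Mono j' := (ModuleCat.mono_iff_injective _).mpr hj
    let g : Hh R n M ⟶ E := Injective.factorThru (ModuleCat.ofHom l) j'
    have hg : j' ≫ g = ModuleCat.ofHom l := Injective.comp_factorThru _ _
    have hg0 : g = 0 := exists_hom_single M E (-n) g (hMS n ⟨q, hprime⟩ hqf E hE)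
    rw [hg0, comp_zero] at hg
    apply he
    rw [← hl]
    exact (DFunLike.congr_fun (congrArg ModuleCat.Hom.hom hg)
      (Submodule.Quotient.mk 1 : R ⧸ q)).symm
  · intro hp
    refine ⟨sdeg R n (ModuleCat.of R (R ⧸ p.asIdeal)), ⟨sdeg_memDqc R n _, ?_⟩,
      p.asIdeal, ?_, le_rfl⟩
    · intro S _ h
      exact h n p hp
    · change IsAssociatedPrime _ _
      rw [isAssociatedPrime_iff_exists_injective_linearMap]
      exact ⟨p.isPrime, (sdegHomologyIso R n
        (ModuleCat.of R (R ⧸ p.asIdeal))).toLinearEquiv.symm.toLinearMap,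
        LinearEquiv.injective _⟩
end

section
/- Let R be a commutative Noetherian ring and let A be a nullity class in D_qc(R). Then N(φ(A)) = A. -/
open CategoryTheory CategoryTheory.Limits CategoryTheory.Pretriangulated

universe w

universe v u
set_option linter.unusedSectionVars false

open CategoryTheory CategoryTheory.Limits CategoryTheory.Pretriangulated

namespace Stmt14
section Coprod
variable {C : Type u} [Category.{v} C] [Abelian C] {J : Type} [HasColimitsOfShape (Discrete J) C]

@[simps]
noncomputable def bigK (X : J → CochainComplex C ℤ) : CochainComplex (Discrete J ⥤ C) ℤ where
  X n := Discrete.functor (fun j => (X j).X n)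
  d i k := Discrete.natTrans (fun j => (X j.as).d i k)
  shape i k h := by
    ext ⟨j⟩
    exact (X j).shape i k h
  d_comp_d' i k l _ _ := by
    ext ⟨j⟩
    exact (X j).d_comp_d i k l

@[simps]
noncomputable def bigKMap {X Y : J → CochainComplex C ℤ} (f : ∀ j, X j ⟶ Y j) : bigK X ⟶ bigK Y where
  f n := Discrete.natTrans (fun j => (f j.as).f n)
  comm' i k _ := by
    ext ⟨j⟩
    exact (f j).comm i k

lemma quasiIso_bigKMap {X Y : J → CochainComplex C ℤ} (f : ∀ j, X j ⟶ Y j)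
    (hf : ∀ j, QuasiIso (f j)) : QuasiIso (bigKMap f) := by
  rw [HomologicalComplex.quasiIso_iff_evaluation]
  rintro ⟨j⟩
  exact hf j

noncomputable def SX (X : J → CochainComplex C ℤ) : CochainComplex C ℤ :=
  ((colim : (Discrete J ⥤ C) ⥤ C).mapHomologicalComplex _).obj (bigK X)

noncomputable def SXmap {X Y : J → CochainComplex C ℤ} (f : ∀ j, X j ⟶ Y j) : SX X ⟶ SX Y :=
  ((colim : (Discrete J ⥤ C) ⥤ C).mapHomologicalComplex _).map (bigKMap f)

lemma quasiIso_SXmap [HasExactColimitsOfShape (Discrete J) C]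
   {X Y : J → CochainComplex C ℤ} (f : ∀ j, X j ⟶ Y j)
    (hf : ∀ j, QuasiIso (f j)) : QuasiIso (SXmap f) := by
  have := quasiIso_bigKMap f hf
  unfold SXmap
  have : PreservesFiniteLimits (colim : (Discrete J ⥤ C) ⥤ C) :=
    HasExactColimitsOfShape.preservesFiniteLimits
  have : (colim : (Discrete J ⥤ C) ⥤ C).PreservesHomology := inferInstance
  exact HomologicalComplex.quasiIso_map_of_preservesHomology (bigKMap f) colim

noncomputable def SXι (X : J → CochainComplex C ℤ) (j : J) : X j ⟶ SX X where
  f n := colimit.ι (Discrete.functor (fun j => (X j).X n)) ⟨j⟩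
  comm' i k _ := by
    exact (colimit.ι_desc _ _)

lemma SX_hom_ext {X : J → CochainComplex C ℤ} {n : ℤ} {Z : C} {f g : (SX X).X n ⟶ Z}
    (h : ∀ j, (SXι X j).f n ≫ f = (SXι X j).f n ≫ g) : f = g :=
  colimit.hom_ext (fun j => h j.as)

noncomputable def SXdescX {X : J → CochainComplex C ℤ} {n : ℤ} {Z : C} (f : ∀ j, (X j).X n ⟶ Z) :
    (SX X).X n ⟶ Z :=
  colimit.desc (Discrete.functor (fun j => (X j).X n)) (Cofan.mk Z f)

lemma SX_fac {X : J → CochainComplex C ℤ} {n : ℤ} {Z : C} (f : ∀ j, (X j).X n ⟶ Z) (j : J) :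
    (SXι X j).f n ≫ SXdescX f = f j := colimit.ι_desc _ _

noncomputable def SXdesc {X : J → CochainComplex C ℤ} {Y : CochainComplex C ℤ} (f : ∀ j, X j ⟶ Y) :
    SX X ⟶ Y where
  f n := SXdescX (fun j => (f j).f n)
  comm' i k _ := by
    apply SX_hom_ext
    intro j
    rw [← Category.assoc, ← Category.assoc, SX_fac, (SXι X j).comm i k, Category.assoc, SX_fac,
      HomologicalComplex.Hom.comm]

lemma SXdesc_fac {X : J → CochainComplex C ℤ} {Y : CochainComplex C ℤ} (f : ∀ j, X j ⟶ Y) (j : J) :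
    SXι X j ≫ SXdesc f = f j := by
  ext n
  exact SX_fac _ _

lemma SXmap_fac {X Y : J → CochainComplex C ℤ} (f : ∀ j, X j ⟶ Y j) (j : J) :
    SXι X j ≫ SXmap f = f j ≫ SXι Y j := by
  ext n
  exact colimit.ι_desc _ _

noncomputable def SXhomotopy {X : J → CochainComplex C ℤ} {Y : CochainComplex C ℤ} (f : SX X ⟶ Y)
    (h : ∀ j, Homotopy (SXι X j ≫ f) 0) : Homotopy f 0 where
  hom i k := SXdescX (fun j => (h j).hom i k)
  zero i k hik := by
    apply SX_hom_ext
    intro j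
    rw [SX_fac, (h j).zero i k hik, comp_zero]
  comm i := by
    apply SX_hom_ext
    intro j
    have := (h j).comm i
    rw [dNext_eq _ (show (ComplexShape.up ℤ).Rel i (i+1) by simp),
      prevD_eq _ (show (ComplexShape.up ℤ).Rel (i-1) i by simp)] at this ⊢
    rw [Preadditive.comp_add, Preadditive.comp_add, ← Category.assoc, HomologicalComplex.Hom.comm,
      Category.assoc, SX_fac, ← Category.assoc, SX_fac]
    simpa using this

variable [HasDerivedCategory.{w} C] [HasExactColimitsOfShape (Discrete J) C]

lemma Q_map_zero_precomp {X Y : CochainComplex C ℤ} (f : X ⟶ Y) (hf : DerivedCategory.Q.map f = 0) :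
    ∃ (X' : CochainComplex C ℤ) (s : X' ⟶ X), QuasiIso s ∧ Nonempty (Homotopy (s ≫ f) 0) := by
  have h : DerivedCategory.Qh.map ((HomotopyCategory.quotient C (.up ℤ)).map f) =
     DerivedCategory.Qh.map ((HomotopyCategory.quotient C (.up ℤ)).map 0) := by
    rw [Functor.map_zero, Functor.map_zero]
    exact hf
  rw [MorphismProperty.map_eq_iff_precomp DerivedCategory.Qh (HomotopyCategory.quasiIso C _)] at h
  obtain ⟨X', s, hs, h⟩ := h
  obtain ⟨X', rfl⟩ := HomotopyCategory.quotient_obj_surjective X'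
  obtain ⟨s, rfl⟩ := (HomotopyCategory.quotient _ _).map_surjective s
  refine ⟨X', s, ?_, ⟨HomotopyCategory.homotopyOfEq _ _ ?_⟩⟩
  · rw [← DerivedCategory.isIso_Qh_map_iff] at hs
    rw [← DerivedCategory.isIso_Q_map_iff_quasiIso]
    exact hs
  · simpa using h

lemma SX_Q_hom_ext {X : J → CochainComplex C ℤ} {Y : DerivedCategory C}
    (f : DerivedCategory.Q.obj (SX X) ⟶ Y)
    (h : ∀ j, DerivedCategory.Q.map (SXι X j) ≫ f = 0) : f = 0 := by
  suffices H : ∀ (Y : CochainComplex C ℤ) (f : DerivedCategory.Q.obj (SX X) ⟶ DerivedCategory.Q.obj Y)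
      (_ : ∀ j, DerivedCategory.Q.map (SXι X j) ≫ f = 0), f = 0 by
    rw [← cancel_mono (DerivedCategory.Q.objObjPreimageIso Y).inv, zero_comp]
    apply H
    intro j
    rw [← Category.assoc, h, zero_comp]
  intro Y f h
  obtain ⟨Y', g, s, hs, rfl⟩ := DerivedCategory.left_fac f
  have h' : ∀ j, DerivedCategory.Q.map (SXι X j ≫ g) = 0 := fun j => by
    rw [← cancel_mono (inv (DerivedCategory.Q.map s)), zero_comp, Functor.map_comp, Category.assoc]
    exact h j
  choose X' t ht hh using fun j => Q_map_zero_precomp _ (h' j)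
  have := quasiIso_SXmap t ht
  have h0 : DerivedCategory.Q.map (SXmap t ≫ g) = 0 := by
    have hz : Homotopy (SXmap t ≫ g) 0 := SXhomotopy _ (fun j => by
      rw [← Category.assoc, SXmap_fac, Category.assoc]; exact (hh j).some)
    have := HomotopyCategory.eq_of_homotopy _ _ hz
    have h2 := congrArg (DerivedCategory.Qh.map) this
    rw [Functor.map_zero, Functor.map_zero] at h2
    exact h2
  rw [Functor.map_comp] at h0
  have i1 : IsIso (DerivedCategory.Q.map (SXmap t)) := by
    rw [DerivedCategory.isIso_Q_map_iff_quasiIso]; infer_instance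
  rw [← cancel_epi (DerivedCategory.Q.map (SXmap t)), ← Category.assoc, h0]
  simp

lemma SX_Q_desc {X : J → CochainComplex C ℤ} {Y : DerivedCategory C}
    (f : ∀ j, DerivedCategory.Q.obj (X j) ⟶ Y) :
    ∃ g : DerivedCategory.Q.obj (SX X) ⟶ Y, ∀ j, DerivedCategory.Q.map (SXι X j) ≫ g = f j := by
  choose X' s hs g hg using fun j =>
    DerivedCategory.right_fac (f j ≫ (DerivedCategory.Q.objObjPreimageIso Y).inv)
  have := quasiIso_SXmap s (fun j => by rw [← DerivedCategory.isIso_Q_map_iff_quasiIso]; exact hs j)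
  have i1 : IsIso (DerivedCategory.Q.map (SXmap s)) := by
    rw [DerivedCategory.isIso_Q_map_iff_quasiIso]; infer_instance
  refine ⟨inv (DerivedCategory.Q.map (SXmap s)) ≫ DerivedCategory.Q.map (SXdesc g) ≫
    (DerivedCategory.Q.objObjPreimageIso Y).hom, fun j => ?_⟩
  have e : DerivedCategory.Q.map (SXι X j) ≫ inv (DerivedCategory.Q.map (SXmap s)) =
     inv (DerivedCategory.Q.map (s j)) ≫ DerivedCategory.Q.map (SXι X' j) := by
    rw [← cancel_epi (DerivedCategory.Q.map (s j)), IsIso.hom_inv_id_assoc, ← Category.assoc,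
      ← Functor.map_comp, ← SXmap_fac, Functor.map_comp, Category.assoc, IsIso.hom_inv_id,
      Category.comp_id]
  rw [← Category.assoc, e, Category.assoc, ← Functor.map_comp_assoc, SXdesc_fac,
    ← Category.assoc, ← hg]
  simp

lemma hasCoproducts_derived : HasColimitsOfShape (Discrete J) (DerivedCategory C) := by
  have : ∀ X : J → DerivedCategory C, HasCoproduct X := fun X => by
    let K := fun j => DerivedCategory.Q.objPreimage (X j)
    let e := fun j => DerivedCategory.Q.objObjPreimageIso (X j)
    have hd : ∀ (s : Cofan X), ∃ g : DerivedCategory.Q.obj (SX K) ⟶ s.pt,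
       ∀ j, DerivedCategory.Q.map (SXι K j) ≫ g = (e j).hom ≫ s.inj j := fun s => SX_Q_desc _
    refine ⟨⟨⟨Cofan.mk (DerivedCategory.Q.obj (SX K))
      (fun j => (e j).inv ≫ DerivedCategory.Q.map (SXι K j)), ?_⟩⟩⟩
    refine Cofan.IsColimit.mk _ (fun s => (hd s).choose) ?_ ?_
    · intro s j
      have := (hd s).choose_spec j
      simp [this]
    · intro s m hm
      rw [← sub_eq_zero]
      apply SX_Q_hom_ext
      intro j
      rw [Preadditive.comp_sub, (hd s).choose_spec j, ← hm j]
      simp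
  exact ⟨fun F => hasColimit_of_iso (Discrete.natIsoFunctor (F := F))⟩
end Coprod
end Stmt14
open CategoryTheory CategoryTheory.Limits CategoryTheory.Pretriangulated

namespace Stmt14
section Tri
variable {T : Type u} [Category.{v} T] [Preadditive T] [HasZeroObject T] [HasShift T ℤ]
  [∀ n : ℤ, Functor.Additive (shiftFunctor T n)] [Pretriangulated T]

section basic
variable {X Y Z : T} {f : X ⟶ Y} {g : Y ⟶ Z} {h : Z ⟶ X⟦(1 : ℤ)⟧}
  (hT : Triangle.mk f g h ∈ distTriang T)
include hT

lemma tri_rot : Triangle.mk g h (-f⟦(1:ℤ)⟧') ∈ distTriang T := rot_of_distTriang _ hT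

lemma tri_12 : f ≫ g = 0 := comp_distTriang_mor_zero₁₂ _ hT
lemma tri_23 : g ≫ h = 0 := comp_distTriang_mor_zero₂₃ _ hT
lemma tri_31 : h ≫ f⟦(1:ℤ)⟧' = 0 := comp_distTriang_mor_zero₃₁ _ hT

lemma tri_y2 {A : T} (a : Y ⟶ A) (ha : f ≫ a = 0) : ∃ b : Z ⟶ A, a = g ≫ b :=
  Triangle.yoneda_exact₂ _ hT a ha
lemma tri_y3 {A : T} (a : Z ⟶ A) (ha : g ≫ a = 0) : ∃ b : X⟦(1:ℤ)⟧ ⟶ A, a = h ≫ b :=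
  Triangle.yoneda_exact₃ _ hT a ha
lemma tri_c2 {A : T} (a : A ⟶ Y) (ha : a ≫ g = 0) : ∃ b : A ⟶ X, a = b ≫ f :=
  Triangle.coyoneda_exact₂ _ hT a ha
lemma tri_c3 {A : T} (a : A ⟶ Z) (ha : a ≫ h = 0) : ∃ b : A ⟶ Y, a = b ≫ g :=
  Triangle.coyoneda_exact₃ _ hT a ha
end basic

lemma tri_of_iso {X Y Z : T} {f : X ⟶ Y} {g : Y ⟶ Z} {h : Z ⟶ X⟦(1 : ℤ)⟧}
    (hT : Triangle.mk f g h ∈ distTriang T)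
    {X' Y' Z' : T} {f' : X' ⟶ Y'} {g' : Y' ⟶ Z'} {h' : Z' ⟶ X'⟦(1 : ℤ)⟧}
    (a : X' ≅ X) (b : Y' ≅ Y) (c : Z' ≅ Z) (h1 : f' ≫ b.hom = a.hom ≫ f)
    (h2 : g' ≫ c.hom = b.hom ≫ g) (h3 : h' ≫ a.hom⟦(1:ℤ)⟧' = c.hom ≫ h) :
    Triangle.mk f' g' h' ∈ distTriang T :=
  isomorphic_distinguished _ hT _ (Triangle.isoMk _ _ a b c h1 h2 h3)

/-- Closed under iso, shift, extensions and coproducts. -/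
structure Pre (U : Set T) : Prop where
  iso : ∀ ⦃X Y : T⦄, (X ≅ Y) → X ∈ U → Y ∈ U
  shift : ∀ ⦃X : T⦄, X ∈ U → X⟦(1 : ℤ)⟧ ∈ U
  ext : ∀ ⦃X Y Z : T⦄ (f : X ⟶ Y) (g : Y ⟶ Z) (h : Z ⟶ X⟦(1 : ℤ)⟧),
    (Triangle.mk f g h ∈ distTriang T) → X ∈ U → Z ∈ U → Y ∈ U
  coprod : ∀ ⦃ι : Type⦄ (X : ι → T) (c : Cofan X), IsColimit c → (∀ i, X i ∈ U) → c.pt ∈ U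

lemma split_tri {P Q X : T} (β : P ⟶ Q) (γ : Q ⟶ P) (s : X ⟶ Q) (π : Q ⟶ X)
    (h1 : β ≫ γ = 𝟙 _) (h2 : s ≫ π = 𝟙 _) (h3 : γ ≫ β + π ≫ s = 𝟙 _) :
    Triangle.mk β π (0 : X ⟶ P⟦(1:ℤ)⟧) ∈ distTriang T := by
  have e1 : s ≫ γ = 0 := by
    have : s ≫ (γ ≫ β + π ≫ s) ≫ γ = s ≫ γ := by rw [h3]; simp
    simp only [Preadditive.add_comp, Preadditive.comp_add, Category.assoc, h1] at this
    rw [← Category.assoc s π, h2] at this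
    simpa using this
  have e2 : β ≫ π = 0 := by
    have : β ≫ (γ ≫ β + π ≫ s) ≫ π = β ≫ π := by rw [h3]; simp
    simp only [Preadditive.add_comp, Preadditive.comp_add, Category.assoc, h2] at this
    rw [← Category.assoc β γ, h1] at this
    simpa using this
  have hb : Triangle.mk (biprod.inl : P ⟶ P ⊞ X) biprod.snd (0 : X ⟶ P⟦(1:ℤ)⟧) ∈ distTriang T :=
    binaryBiproductTriangle_distinguished P X
  have k1 : biprod.lift γ π ≫ biprod.desc β s = 𝟙 _ := (biprod.lift_desc).trans h3
  have k2 : biprod.desc β s ≫ biprod.lift γ π = 𝟙 _ := by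
    apply biprod.hom_ext'
    · apply biprod.hom_ext <;> simp [h1, e2]
    · apply biprod.hom_ext <;> simp [h2, e1]
  refine tri_of_iso hb (Iso.refl _) ⟨biprod.lift γ π, biprod.desc β s, k1, k2⟩ (Iso.refl _) ?_ ?_ ?_
  · apply biprod.hom_ext
    · simp [h1]
    · simp [e2]
  · simp
  · simp

variable {U : Set T} (hU : Pre U)
include hU

lemma Pre.zero {X : T} (hX : IsZero X) : X ∈ U := by
  refine hU.coprod (fun i : Empty => i.elim) (Cofan.mk X (fun i => i.elim)) ?_ (fun i => i.elim)
  exact Cofan.IsColimit.mk _ (fun s => 0) (fun s j => j.elim) (fun s m _ => hX.eq_of_src _ _)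

lemma Pre.shiftn {X : T} (hX : X ∈ U) (n : ℕ) : X⟦(n : ℤ)⟧ ∈ U := by
  induction n with
  | zero => exact hU.iso ((shiftFunctorZero T ℤ).symm.app X) hX
  | succ n ih =>
    exact hU.iso ((shiftFunctorAdd' T (n:ℤ) 1 ((n+1 : ℕ) : ℤ) (by simp)).symm.app X) (hU.shift ih)

/-- third object -/
lemma Pre.third {X Y Z : T} {f : X ⟶ Y} {g : Y ⟶ Z} {h : Z ⟶ X⟦(1 : ℤ)⟧}
    (hT : Triangle.mk f g h ∈ distTriang T) (hY : Y ∈ U) (hX : X ∈ U) : Z ∈ U :=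
  hU.ext _ _ _ (tri_rot hT) hY (hU.shift hX)

lemma Pre.sigma {ι : Type} (X : ι → T) [HasCoproduct X] (h : ∀ i, X i ∈ U) : (∐ X) ∈ U :=
  hU.coprod X _ (coproductIsCoproduct X) h

lemma Pre.retract [HasCoproductsOfShape ℕ T] {X Z : T} (i : X ⟶ Z) (r : Z ⟶ X) (hir : i ≫ r = 𝟙 X)
    (hZ : Z ∈ U) : X ∈ U := by
  let P : T := ∐ (fun _ : ℕ => Z)
  let ι : ℕ → (Z ⟶ P) := fun n => Sigma.ι (fun _ : ℕ => Z) n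
  let β : P ⟶ P := Sigma.desc (fun n => (𝟙 Z - r ≫ i) ≫ ι n + (r ≫ i) ≫ ι (n+1))
  let γ : P ⟶ P := Sigma.desc (fun n => (𝟙 Z - r ≫ i) ≫ ι n +
    (match n with | 0 => 0 | n+1 => (r ≫ i) ≫ ι n))
  let π : P ⟶ X := Sigma.desc (fun n => match n with | 0 => r | _+1 => 0)
  have hβ : ∀ n, ι n ≫ β = (𝟙 Z - r ≫ i) ≫ ι n + (r ≫ i) ≫ ι (n+1) := fun n => Sigma.ι_desc _ _
  have hγ0 : ι 0 ≫ γ = (𝟙 Z - r ≫ i) ≫ ι 0 + 0 := Sigma.ι_desc _ _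
  have hγ : ∀ n, ι (n+1) ≫ γ = (𝟙 Z - r ≫ i) ≫ ι (n+1) + (r ≫ i) ≫ ι n := fun n => Sigma.ι_desc _ _
  have hπ0 : ι 0 ≫ π = r := Sigma.ι_desc _ _
  have hπ : ∀ n, ι (n+1) ≫ π = 0 := fun n => Sigma.ι_desc _ _
  have hir' : ∀ {A : T} (a : X ⟶ A), i ≫ r ≫ a = a := fun a => by
    rw [← Category.assoc, hir, Category.id_comp]
  have ht := split_tri β γ (i ≫ ι 0) π (by
      refine Sigma.hom_ext _ _ (fun n => ?_)
      change ι n ≫ _ = ι n ≫ _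
      rw [← Category.assoc, hβ]
      cases n with
      | zero => 
        simp only [Preadditive.add_comp, Category.assoc, hγ, hγ0]
        simp [Preadditive.add_comp, Preadditive.comp_add, Preadditive.sub_comp, Preadditive.comp_sub, hir']
      | succ n => 
        simp only [Preadditive.add_comp, Category.assoc, hγ]
        simp [Preadditive.add_comp, Preadditive.comp_add, Preadditive.sub_comp, Preadditive.comp_sub, hir'])
    (by rw [Category.assoc, hπ0, hir]) (by
      refine Sigma.hom_ext _ _ (fun n => ?_)
      change ι n ≫ _ = ι n ≫ _
      rw [Preadditive.comp_add, ← Category.assoc, ← Category.assoc]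
      cases n with
      | zero => 
        simp only [Preadditive.add_comp, Category.assoc, hγ0, hβ, hπ0]
        simp [Preadditive.add_comp, Preadditive.comp_add, Preadditive.sub_comp, Preadditive.comp_sub, hir', hβ]
      | succ n => 
        simp only [Preadditive.add_comp, Category.assoc, hγ, hβ, hπ]
        simp [Preadditive.add_comp, Preadditive.comp_add, Preadditive.sub_comp, Preadditive.comp_sub, hir', hβ])
  have hP : P ∈ U := hU.sigma _ (fun _ => hZ)
  exact hU.third ht hP hP
end Tri
end Stmt14
open CategoryTheory CategoryTheory.Limits CategoryTheory.Pretriangulated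

namespace Stmt14
section Tri
variable {T : Type u} [Category.{v} T] [Preadditive T] [HasZeroObject T] [HasShift T ℤ]
  [∀ n : ℤ, Functor.Additive (shiftFunctor T n)] [Pretriangulated T]

section shiftcoprod
variable {ι : Type} (X : ι → T) [HasCoproduct X]

lemma shift_sigma_desc {Y : T} (c : ∀ i, (X i)⟦(1:ℤ)⟧ ⟶ Y) :
    ∃ d : (∐ X)⟦(1:ℤ)⟧ ⟶ Y, ∀ i, (Sigma.ι X i)⟦(1:ℤ)⟧' ≫ d = c i := by
  let h := isColimitCofanMkObjOfIsColimit (shiftFunctor T (1:ℤ)) X _ (coproductIsCoproduct X)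
  exact ⟨Cofan.IsColimit.desc h c, fun i => Cofan.IsColimit.fac h c i⟩

lemma shift_sigma_ext {Y : T} (c d : (∐ X)⟦(1:ℤ)⟧ ⟶ Y)
    (hcd : ∀ i, (Sigma.ι X i)⟦(1:ℤ)⟧' ≫ c = (Sigma.ι X i)⟦(1:ℤ)⟧' ≫ d) : c = d := by
  let h := isColimitCofanMkObjOfIsColimit (shiftFunctor T (1:ℤ)) X _ (coproductIsCoproduct X)
  exact Cofan.IsColimit.hom_ext h _ _ hcd
end shiftcoprod

lemma coprod_tri {ι : Type} [HasCoproductsOfShape ι T] {X Y Z : ι → T} (f : ∀ i, X i ⟶ Y i) (g : ∀ i, Y i ⟶ Z i)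
    (h : ∀ i, Z i ⟶ (X i)⟦(1:ℤ)⟧) (hT : ∀ i, Triangle.mk (f i) (g i) (h i) ∈ distTriang T) :
    ∃ δ : (∐ Z) ⟶ (∐ X)⟦(1:ℤ)⟧, Triangle.mk (Limits.Sigma.map f) (Limits.Sigma.map g) δ ∈ distTriang T := by
  obtain ⟨C, g', h', hT'⟩ := distinguished_cocone_triangle (Limits.Sigma.map f)
  have H : ∀ i, ∃ c : Z i ⟶ C, g i ≫ c = Sigma.ι Y i ≫ g' ∧ h i ≫ (Sigma.ι X i)⟦(1:ℤ)⟧' = c ≫ h' :=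
    fun i => complete_distinguished_triangle_morphism _ _ (hT i) hT' (Sigma.ι X i) (Sigma.ι Y i)
      (Sigma.ι_map f i).symm
  choose φ hφ1 hφ2 using H
  let ψ : ∐ Z ⟶ C := Sigma.desc φ
  have hψ : ∀ i, Sigma.ι Z i ≫ ψ = φ i := fun i => Sigma.ι_desc _ _
  have : IsIso ψ := by
    apply isIso_of_coyoneda_map_bijective
    intro A
    constructor
    · intro a₁ a₂ (ha : ψ ≫ a₁ = ψ ≫ a₂)
      rw [← sub_eq_zero] at ha ⊢
      rw [← Preadditive.comp_sub] at ha
      generalize a₁ - a₂ = a at ha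
      have ha' : ∀ i, φ i ≫ a = 0 := fun i => by rw [← hψ, Category.assoc, ha, comp_zero]
      obtain ⟨b, rfl⟩ := tri_y3 hT' a (by
        refine Sigma.hom_ext _ _ (fun i => ?_)
        rw [← Category.assoc, ← hφ1, Category.assoc, ha', comp_zero, comp_zero])
      have hb : ∀ i, ∃ c : (Y i)⟦(1:ℤ)⟧ ⟶ A, (Sigma.ι X i)⟦(1:ℤ)⟧' ≫ b = (-(f i)⟦(1:ℤ)⟧') ≫ c := fun i =>
        tri_y3 (tri_rot (hT i)) _ (by rw [← Category.assoc, hφ2, Category.assoc, ha'])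
      choose c hc using hb
      obtain ⟨d, hd⟩ := shift_sigma_desc Y c
      have : b = -((Limits.Sigma.map f)⟦(1:ℤ)⟧' ≫ d) := by
        apply shift_sigma_ext
        intro i
        rw [hc, Preadditive.comp_neg, ← Category.assoc, ← Functor.map_comp, Sigma.ι_map,
          Functor.map_comp, Category.assoc, hd, Preadditive.neg_comp]
      rw [this, Preadditive.comp_neg, ← Category.assoc, tri_31 hT', zero_comp, neg_zero]
    · intro b
      obtain ⟨a₀, ha₀⟩ := tri_y2 hT' (Sigma.desc (fun i => g i ≫ Sigma.ι Z i ≫ b)) (by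
        refine Sigma.hom_ext _ _ (fun i => ?_)
        rw [← Category.assoc, Sigma.ι_map, Category.assoc, Sigma.ι_desc, ← Category.assoc, tri_12 (hT i),
          zero_comp, comp_zero])
      have ha₀' : ∀ i, g i ≫ Sigma.ι Z i ≫ b = Sigma.ι Y i ≫ g' ≫ a₀ := fun i => by
        rw [← ha₀, Sigma.ι_desc]
      have hd : ∀ i, ∃ d : (X i)⟦(1:ℤ)⟧ ⟶ A, Sigma.ι Z i ≫ b - φ i ≫ a₀ = h i ≫ d := fun i =>
        tri_y3 (hT i) _ (by
          rw [Preadditive.comp_sub, ha₀', ← Category.assoc (g i), hφ1, Category.assoc, sub_self])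
      choose d hd using hd
      obtain ⟨e, he⟩ := shift_sigma_desc X d
      refine ⟨a₀ + h' ≫ e, ?_⟩
      refine Sigma.hom_ext _ _ (fun i => ?_)
      change Sigma.ι Z i ≫ ψ ≫ _ = _
      rw [← Category.assoc, hψ, Preadditive.comp_add, ← Category.assoc (φ i) h', ← hφ2, Category.assoc, he, ← hd]
      abel
  refine ⟨ψ ≫ h', tri_of_iso hT' (Iso.refl _) (Iso.refl _) (asIso ψ) ?_ ?_ ?_⟩
  · simp
  · refine Sigma.hom_ext _ _ (fun i => ?_)
    simp only [asIso_hom, Iso.refl_hom, Category.id_comp]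
    rw [← Category.assoc, Sigma.ι_map, Category.assoc, hψ, hφ1]
  · simp

lemma solve {Y : T} (m : ℕ) : ∀ (W : ℕ → T) (σ : ∀ j, W j ⟶ W (j+1)) 
    (h : ∀ j, W j ⟶ Y) (_ : ∀ j, m ≤ j → h j = 0), ∃ g : ∀ j, W j ⟶ Y, ∀ j, g j - σ j ≫ g (j+1) = h j := by
  induction m with
  | zero => intro W σ h h0; exact ⟨fun _ => 0, fun j => by simp [h0]⟩
  | succ m ih =>
    intro W σ h h0
    obtain ⟨g, hg⟩ := ih (fun j => W (j+1)) (fun j => σ (j+1)) (fun j => h (j+1))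
      (fun j hj => h0 _ (by omega))
    refine ⟨fun j => match j with | 0 => h 0 + σ 0 ≫ g 0 | j+1 => g j, fun j => ?_⟩
    cases j with
    | zero => simp
    | succ j => exact hg j

lemma solve_uniq {Y : T} (m : ℕ) : ∀ (W : ℕ → T) (σ : ∀ j, W j ⟶ W (j+1)) 
    (g : ∀ j, W j ⟶ Y) (_ : ∀ j, m ≤ j → g j = 0) (_ : ∀ j, g j = σ j ≫ g (j+1)), ∀ j, g j = 0 := by
  induction m with
  | zero => intro W σ g h0 _ j; exact h0 j (by omega)
  | succ m ih =>
    intro W σ g h0 h j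
    refine ih W σ g (fun j hj => ?_) h j
    rw [h, h0 _ (by omega), comp_zero]

noncomputable def oneSubSh [HasCoproductsOfShape ℕ T] {W : ℕ → T} (σ : ∀ j, W j ⟶ W (j+1)) : ∐ W ⟶ ∐ W :=
  Sigma.desc (fun j => Sigma.ι W j - σ j ≫ Sigma.ι W (j+1))

lemma ι_oneSubSh [HasCoproductsOfShape ℕ T] {W : ℕ → T} (σ : ∀ j, W j ⟶ W (j+1)) (j : ℕ) :
    Sigma.ι W j ≫ oneSubSh σ = Sigma.ι W j - σ j ≫ Sigma.ι W (j+1) := Sigma.ι_desc _ _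

lemma isIso_oneSubSh [HasCoproductsOfShape ℕ T] {W : ℕ → T} (σ : ∀ j, W j ⟶ W (j+1)) (G : Set T)
    (hG : ∀ C, (∀ Y ∈ G, ∀ f : C ⟶ Y, f = 0) → IsZero C)
    (hW : ∀ Y ∈ G, ∃ m : ℕ, ∀ j, m ≤ j → (∀ f : W j ⟶ Y, f = 0) ∧ (∀ f : (W j)⟦(1:ℤ)⟧ ⟶ Y, f = 0)) :
    IsIso (oneSubSh σ) := by
  obtain ⟨C, g, h, hT⟩ := distinguished_cocone_triangle (oneSubSh σ)
  refine (Triangle.isZero₃_iff_isIso₁ _ hT).1 (hG C ?_)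
  intro Y hY a
  obtain ⟨m, hm⟩ := hW Y hY
  have h1 : g ≫ a = 0 := by
    refine Sigma.hom_ext _ _ (fun j => ?_)
    rw [comp_zero]
    refine solve_uniq m W σ (fun j => Sigma.ι W j ≫ g ≫ a) (fun j hj => (hm j hj).1 _) (fun j => ?_) j
    have := ι_oneSubSh σ j
    rw [← sub_eq_zero, ← Category.assoc (σ j), ← Preadditive.sub_comp, ← this, Category.assoc,
      ← Category.assoc _ g, tri_12 hT, zero_comp, comp_zero]
  obtain ⟨b, rfl⟩ := tri_y3 hT a h1
  obtain ⟨c, hc⟩ := solve m (fun j => (W j)⟦(1:ℤ)⟧) (fun j => (σ j)⟦(1:ℤ)⟧') 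
    (fun j => (Sigma.ι W j)⟦(1:ℤ)⟧' ≫ b) (fun j hj => (hm j hj).2 _)
  obtain ⟨d, hd⟩ := shift_sigma_desc W c
  have : b = (oneSubSh σ)⟦(1:ℤ)⟧' ≫ d := by
    apply shift_sigma_ext
    intro j
    rw [← hc, ← Category.assoc, ← Functor.map_comp, ι_oneSubSh, Functor.map_sub, Functor.map_comp,
      Preadditive.sub_comp, Category.assoc, hd, hd]
  rw [this, ← Category.assoc]
  have := tri_31 hT
  rw [this, zero_comp]

lemma oneSubSh_const [HasCoproductsOfShape ℕ T] (N : T) :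
    ∃ π : (∐ fun _ : ℕ => N) ⟶ N, Triangle.mk (oneSubSh (W := fun _ : ℕ => N) (fun _ => 𝟙 N)) π 0 ∈ distTriang T := by
  let P : T := ∐ (fun _ : ℕ => N)
  let ι : ℕ → (N ⟶ P) := fun n => Sigma.ι (fun _ : ℕ => N) n
  let β : P ⟶ P := oneSubSh (W := fun _ : ℕ => N) (fun _ => 𝟙 N)
  let γ : P ⟶ P := Sigma.desc (fun n => - ∑ i ∈ Finset.range n, ι i)
  let π : P ⟶ N := Sigma.desc (fun _ => 𝟙 N)
  have hβ : ∀ n, ι n ≫ β = ι n - ι (n+1) := fun n => by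
    have := ι_oneSubSh (W := fun _ : ℕ => N) (fun _ => 𝟙 N) n
    rwa [Category.id_comp] at this
  have hγ : ∀ n, ι n ≫ γ = - ∑ i ∈ Finset.range n, ι i := fun n => Sigma.ι_desc _ _
  have hπ : ∀ n, ι n ≫ π = 𝟙 N := fun n => Sigma.ι_desc _ _
  refine ⟨π, split_tri β γ (ι 0) π ?_ (hπ 0) ?_⟩
  · refine Sigma.hom_ext _ _ (fun n => ?_)
    change ι n ≫ _ = ι n ≫ _
    rw [← Category.assoc, hβ, Preadditive.sub_comp, hγ, hγ, Finset.sum_range_succ]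
    simp
  · refine Sigma.hom_ext _ _ (fun n => ?_)
    change ι n ≫ _ = ι n ≫ _
    rw [Preadditive.comp_add, ← Category.assoc, ← Category.assoc, hγ, hπ, Preadditive.neg_comp,
      Preadditive.sum_comp, Finset.sum_congr rfl (fun i _ => hβ i), Finset.sum_range_sub']
    simp

section tower
variable [IsTriangulated T] {U : Set T} (hU : Pre U)
include hU

/-- fibre of composite -/
lemma Pre.fibre_comp {A B C F G : T} {a : A ⟶ B} {b : B ⟶ C} {i : F ⟶ A} {d : B ⟶ F⟦(1:ℤ)⟧}
    (h1 : Triangle.mk i a d ∈ distTriang T) {k : G ⟶ B} {e : C ⟶ G⟦(1:ℤ)⟧}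
    (h2 : Triangle.mk k b e ∈ distTriang T) (hF : F ∈ U) (hG : G ∈ U) :
    ∃ (H : T) (j : H ⟶ A) (l : C ⟶ H⟦(1:ℤ)⟧), Triangle.mk j (a ≫ b) l ∈ distTriang T ∧ H ∈ U := by
  obtain ⟨H, j, l, h3⟩ := distinguished_cocone_triangle₁ (a ≫ b)
  have o := Triangulated.someOctahedron' rfl h1 h2 h3
  exact ⟨H, j, l, h3, hU.ext _ _ _ o.mem hF hG⟩

open scoped ZeroObject in
lemma Pre.tower [HasCoproductsOfShape ℕ T] {W V : ℕ → T} (σ : ∀ j, W j ⟶ W (j+1))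
    (i : ∀ j, V j ⟶ W j) (d : ∀ j, W (j+1) ⟶ (V j)⟦(1:ℤ)⟧)
    (hT : ∀ j, Triangle.mk (i j) (σ j) (d j) ∈ distTriang T) (hV : ∀ j, V j ∈ U)
    (G : Set T) (hG : ∀ C, (∀ Y ∈ G, ∀ f : C ⟶ Y, f = 0) → IsZero C)
    (hW : ∀ Y ∈ G, ∃ m : ℕ, ∀ j, m ≤ j → (∀ f : W j ⟶ Y, f = 0) ∧ (∀ f : (W j)⟦(1:ℤ)⟧ ⟶ Y, f = 0)) :
    W 0 ∈ U := by
  let τ : ∀ j, W 0 ⟶ W j := fun j => Nat.rec (𝟙 _) (fun j t => t ≫ σ j) j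
  have hτ : ∀ j, τ (j+1) = τ j ≫ σ j := fun j => rfl
  have H : ∀ j, ∃ (F : T) (k : F ⟶ W 0) (l : W j ⟶ F⟦(1:ℤ)⟧), Triangle.mk k (τ j) l ∈ distTriang T ∧ F ∈ U := by
    intro j
    induction j with
    | zero => exact ⟨0, 0, 0, contractible_distinguished₁ (W 0), hU.zero (isZero_zero T)⟩
    | succ j ih =>
      obtain ⟨F, k, l, h1, hF⟩ := ih
      exact hU.fibre_comp h1 (hT j) hF (hV j)
  choose F k l hF hFU using H
  obtain ⟨δ, hδ⟩ := coprod_tri k τ l hF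
  obtain ⟨π, hπ⟩ := oneSubSh_const (W 0)
  have := isIso_oneSubSh σ G hG hW
  have hS : (∐ F) ∈ U := hU.sigma F hFU
  have comm : oneSubSh (W := fun _ : ℕ => W 0) (fun _ => 𝟙 (W 0)) ≫ Limits.Sigma.map τ = 
      Limits.Sigma.map τ ≫ oneSubSh σ := by
    refine Sigma.hom_ext _ _ (fun j => ?_)
    rw [← Category.assoc, ι_oneSubSh, ← Category.assoc, Sigma.ι_map, Preadditive.sub_comp, Category.assoc,
      Category.assoc, Sigma.ι_map, Sigma.ι_map, ι_oneSubSh, Preadditive.comp_sub, hτ]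
    simp
  -- rotate
  have r1 := tri_rot hδ
  have r2 : Triangle.mk (Limits.Sigma.map τ ≫ oneSubSh σ) (inv (oneSubSh σ) ≫ δ) 
      (-(Limits.Sigma.map k)⟦(1:ℤ)⟧') ∈ distTriang T :=
    tri_of_iso r1 (Iso.refl _) (asIso (oneSubSh σ)).symm (Iso.refl _) (by simp) (by simp) (by simp)
  have o := Triangulated.someOctahedron comm hπ r1 r2
  have m := inv_rot_of_distTriang _ o.mem
  refine hU.ext _ _ _ m ?_ (hU.shift hS)
  exact hU.iso ((shiftFunctorCompIsoId T (1:ℤ) (-1) (by simp)).symm.app _) hS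

/-- retract trick: if `a ≫ b = f` on D factoring through N∈U, and cone of f in U, then D ∈ U -/
lemma Pre.trick [HasCoproductsOfShape ℕ T] {D N E : T} (a : D ⟶ N) (b : N ⟶ D) {g : D ⟶ E} {h : E ⟶ D⟦(1:ℤ)⟧}
    (hT : Triangle.mk (a ≫ b) g h ∈ distTriang T) (hN : N ∈ U) (hE : E ∈ U) : D ∈ U := by
  obtain ⟨C, c, d, h1⟩ := distinguished_cocone_triangle b
  obtain ⟨e, he⟩ := tri_y2 hT c (by rw [Category.assoc, tri_12 h1, comp_zero])
  obtain ⟨Y, m, n, h2⟩ := distinguished_cocone_triangle e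
  obtain ⟨H, j, l, h3, hH⟩ := hU.fibre_comp h1 h2 hN hE
  obtain ⟨s, hs⟩ := tri_c2 h3 (𝟙 D) (by
    rw [Category.id_comp, he, Category.assoc, tri_12 h2, comp_zero])
  exact hU.retract s j hs.symm hH
end tower

end Tri
end Stmt14
open CategoryTheory CategoryTheory.Limits CategoryTheory.Pretriangulated

namespace Stmt14
section Der
open DerivedCategory
variable {C : Type u} [Category.{v} C] [Abelian C] [HasDerivedCategory.{w} C]

lemma ses_tri {S : ShortComplex (CochainComplex C ℤ)} (hS : S.ShortExact) :
    ∃ h, Triangle.mk (Q.map S.f) (Q.map S.g) h ∈ distTriang (DerivedCategory C) :=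
  ⟨_, triangleOfSES_distinguished hS⟩

lemma single_tri {S : ShortComplex C} (hS : S.ShortExact) (n : ℤ) :
    ∃ h, Triangle.mk ((singleFunctor C n).map S.f) ((singleFunctor C n).map S.g) h ∈
      distTriang (DerivedCategory C) :=
  ses_tri (hS.map_of_exact (HomologicalComplex.single C (ComplexShape.up ℤ) n))

section
variable {X Y Z : DerivedCategory C} {f : X ⟶ Y} {g : Y ⟶ Z} {h : Z ⟶ X⟦(1 : ℤ)⟧}
  (hT : Triangle.mk f g h ∈ distTriang (DerivedCategory C))
include hT

lemma isIso_H_f (n : ℤ) (h1 : IsZero ((homologyFunctor C (n-1)).obj Z)) 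
    (h2 : IsZero ((homologyFunctor C n).obj Z)) : IsIso ((homologyFunctor C n).map f) := by
  have : Epi ((homologyFunctor C n).map f) :=
    (HomologySequence.epi_homologyMap_mor₁_iff _ hT n).2 (h2.eq_of_tgt _ _)
  have : Mono ((homologyFunctor C n).map f) :=
    (HomologySequence.mono_homologyMap_mor₁_iff _ hT (n-1) n (by omega)).2 (h1.eq_of_src _ _)
  exact isIso_of_mono_of_epi _

lemma isIso_H_g (n : ℤ) (h1 : IsZero ((homologyFunctor C n).obj X)) 
    (h2 : IsZero ((homologyFunctor C (n+1)).obj X)) : IsIso ((homologyFunctor C n).map g) := by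
  have : Epi ((homologyFunctor C n).map g) :=
    (HomologySequence.epi_homologyMap_mor₂_iff _ hT n (n+1) (by omega)).2 (h2.eq_of_tgt _ _)
  have : Mono ((homologyFunctor C n).map g) :=
    (HomologySequence.mono_homologyMap_mor₂_iff _ hT n).2 (h1.eq_of_src _ _)
  exact isIso_of_mono_of_epi _
end

/-- truncation triangle with homology control -/
lemma trunc_tri (X : DerivedCategory C) (n : ℤ) :
    ∃ (A B : DerivedCategory C) (f : A ⟶ X) (g : X ⟶ B) (h : B ⟶ A⟦(1:ℤ)⟧),
      Triangle.mk f g h ∈ distTriang (DerivedCategory C) ∧ A.IsLE (n-1) ∧ B.IsGE n ∧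
      (∀ i, i < n → IsIso ((homologyFunctor C i).map f)) ∧
      (∀ i, n ≤ i → IsIso ((homologyFunctor C i).map g)) := by
  obtain ⟨A, B, hA, hB, f, g, h, hT⟩ := TStructure.t.exists_triangle X (n-1) n (by omega)
  have hA : A.IsLE (n-1) := ⟨hA⟩
  have hB : B.IsGE n := ⟨hB⟩
  refine ⟨A, B, f, g, h, hT, hA, hB, fun i hi => ?_, fun i hi => ?_⟩
  · exact isIso_H_f hT i (B.isZero_of_isGE n _ (by omega)) (B.isZero_of_isGE n _ (by omega))
  · exact isIso_H_g hT i (A.isZero_of_isLE (n-1) _ (by omega)) (A.isZero_of_isLE (n-1) _ (by omega))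

lemma isZero_single (n : ℤ) {Y : C} (hY : IsZero Y) : IsZero ((singleFunctor C n).obj Y) := 
  (singleFunctor C n).map_isZero hY

lemma single_of_amp (X : DerivedCategory C) (n : ℤ) (h1 : X.IsGE n) (h2 : X.IsLE n) :
    Nonempty (X ≅ (singleFunctor C n).obj ((homologyFunctor C n).obj X)) := by
  obtain ⟨Y, ⟨e⟩⟩ := exists_iso_singleFunctor_obj_of_isGE_of_isLE X n
  exact ⟨e ≪≫ (singleFunctor C n).mapIso 
    (((homologyFunctor C n).mapIso e ≪≫ (singleFunctorCompHomologyFunctorIso C n).app Y).symm)⟩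

lemma devissage (P : Set (DerivedCategory C)) (iso : ∀ X Y, (X ≅ Y) → X ∈ P → Y ∈ P)
    (zero : ∀ X, IsZero X → X ∈ P)
    (ext : ∀ (X Y Z : DerivedCategory C) (f : X ⟶ Y) (g : Y ⟶ Z) (h : Z ⟶ X⟦(1 : ℤ)⟧),
      (Triangle.mk f g h ∈ distTriang (DerivedCategory C)) → X ∈ P → Z ∈ P → Y ∈ P) (a : ℤ)
    (k : ℕ) : ∀ (X : DerivedCategory C) (_ : X.IsGE a) (_ : X.IsLE (a+k-1))
      (_ : ∀ n, (singleFunctor C n).obj ((homologyFunctor C n).obj X) ∈ P), X ∈ P := by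
  induction k with
  | zero =>
    intro X h1 h2 _
    exact zero _ (TStructure.t.isZero X _ _ (by simp : a + (0:ℕ) - 1 < a))
  | succ k ih =>
    intro X h1 h2 H
    obtain ⟨A, B, f, g, h, hT, hA, hB, hf, hg⟩ := trunc_tri X (a+k)
    have ef : ∀ i, i < a + k → ((homologyFunctor C i).obj X ≅ (homologyFunctor C i).obj A) := fun i hi => by
      have := hf i hi
      exact (asIso ((homologyFunctor C i).map f)).symm
    have eg : ∀ i, a + k ≤ i → ((homologyFunctor C i).obj X ≅ (homologyFunctor C i).obj B) := fun i hi => by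
      have := hg i hi
      exact (asIso ((homologyFunctor C i).map g))
    refine ext _ _ _ _ _ _ hT ?_ ?_
    · refine ih A ?_ hA ?_
      · rw [isGE_iff]
        intro i hi
        exact (X.isZero_of_isGE a i hi).of_iso (ef i (by omega)).symm
      · intro n
        by_cases hn : n < a + k
        · exact iso _ _ ((singleFunctor C n).mapIso (ef n hn)) (H n)
        · exact zero _ (isZero_single n (A.isZero_of_isLE (a+k-1) n (by omega)))
    · have hB' : B.IsLE (a+k) := by
        rw [isLE_iff]
        intro i hi
        exact (X.isZero_of_isLE (a + (k+1 : ℕ) -1) i (by push_cast; omega)).of_iso (eg i (by omega)).symm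
      obtain ⟨e⟩ := single_of_amp B (a+k) hB hB'
      exact iso _ _ ((singleFunctor C (a+k)).mapIso (eg _ le_rfl) ≪≫ e.symm) (H _)

lemma isZero_of_H (X : DerivedCategory C) (h : ∀ n, IsZero ((homologyFunctor C n).obj X)) : IsZero X := by
  have h1 : X.IsLE 0 := by rw [isLE_iff]; exact fun i _ => h i
  have h2 : X.IsGE 1 := by rw [isGE_iff]; exact fun i _ => h i
  exact TStructure.t.isZero X 0 1

lemma isZero_of_isIso_zero {A B : C} (h : IsIso (0 : A ⟶ B)) : IsZero A := by
  rw [IsZero.iff_id_eq_zero, ← IsIso.hom_inv_id (0 : A ⟶ B), zero_comp]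

lemma isZero_of_hom_ge (X : DerivedCategory C) (h : ∀ Y ∈ {Y : DerivedCategory C | ∃ a : ℤ, Y.IsGE a},
    ∀ f : X ⟶ Y, f = 0) : IsZero X := by
  apply isZero_of_H
  intro n
  obtain ⟨A, B, f, g, _, hT, hA, hB, hf, hg⟩ := trunc_tri X n
  have := hg n le_rfl
  rw [h B ⟨n, hB⟩ g, Functor.map_zero] at this
  exact isZero_of_isIso_zero this

lemma Pre.towerD {U : Set (DerivedCategory C)} (hU : Pre U) [HasCoproductsOfShape ℕ (DerivedCategory C)] 
    {W V : ℕ → DerivedCategory C} (σ : ∀ j, W j ⟶ W (j+1))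
    (i : ∀ j, V j ⟶ W j) (d : ∀ j, W (j+1) ⟶ (V j)⟦(1:ℤ)⟧)
    (hT : ∀ j, Triangle.mk (i j) (σ j) (d j) ∈ distTriang (DerivedCategory C)) (hV : ∀ j, V j ∈ U)
    (b : ℤ) (hW : ∀ j : ℕ, (W j).IsLE (b-j)) : W 0 ∈ U := by
  refine hU.tower σ i d hT hV _ isZero_of_hom_ge ?_
  rintro Y ⟨a, ha⟩
  refine ⟨(b - a + 1).toNat, fun j hj => ⟨fun f => ?_, fun f => ?_⟩⟩
  · have := hW j
    exact TStructure.t.zero f (b-j) a (by omega)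
  · have := hW j
    have := TStructure.t.isLE_shift (W j) (b-j) 1 (b-j-1) (by omega)
    exact TStructure.t.zero f (b-j-1) a (by omega)
end Der
end Stmt14
open CategoryTheory CategoryTheory.Limits CategoryTheory.Pretriangulated

namespace Stmt14
section Mods
open DerivedCategory
variable {R : Type} [CommRing R] [IsNoetherianRing R]

/-- prime filtration -/
lemma primefilt (P : ModuleCat.{0} R → Prop) (V : Set (PrimeSpectrum R))
    (iso : ∀ X Y : ModuleCat.{0} R, (X ≅ Y) → P X → P Y)
    (zero : ∀ X : ModuleCat.{0} R, IsZero X → P X)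
    (ext : ∀ S : ShortComplex (ModuleCat.{0} R), S.ShortExact → P S.X₁ → P S.X₃ → P S.X₂)
    (hV : ∀ p ∈ V, P (ModuleCat.of R (R ⧸ p.asIdeal)))
    (N : Type) [AddCommGroup N] [Module R N] [Module.Finite R N]
    (hN : Module.support R N ⊆ V) : P (ModuleCat.of R N) := by
  revert hN
  refine IsNoetherianRing.induction_on_isQuotientEquivQuotientPrime R (M := N) inferInstance
    (motive := fun N _ _ _ => Module.support R N ⊆ V → P (ModuleCat.of R N)) ?_ ?_ ?_
  · intro N _ _ _ _ _
    exact zero _ (ModuleCat.isZero_of_subsingleton _)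
  · intro N _ _ _ p e hN
    refine iso _ _ e.symm.toModuleIso (hV p (hN ?_))
    rw [e.support_eq, Module.support_eq_zeroLocus, Ideal.annihilator_quotient]
    simp [PrimeSpectrum.mem_zeroLocus]
  · intro N₁ _ _ _ N₂ _ _ _ N₃ _ _ _ f g hf hg hfg h1 h3 hN
    have hS := Module.support_of_exact hfg hf hg
    let S : ShortComplex (ModuleCat.{0} R) := ShortComplex.mk (ModuleCat.ofHom f) (ModuleCat.ofHom g) (by
      ext x; exact hfg.apply_apply_eq_zero x)
    have hSE : S.ShortExact := 
      { exact := (ShortComplex.ShortExact.moduleCat_exact_iff_function_exact S).2 hfg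
        mono_f := (ModuleCat.mono_iff_injective _).2 hf
        epi_g := (ModuleCat.epi_iff_surjective _).2 hg }
    exact ext S hSE (h1 fun p hp => hN (hS ▸ Or.inl hp)) (h3 fun p hp => hN (hS ▸ Or.inr hp))

variable [HasDerivedCategory.{w} (ModuleCat.{0} R)]

lemma Pre.single_filt {U : Set (DerivedCategory (ModuleCat.{0} R))} (hU : Pre U) (m : ℤ)
    (V : Set (PrimeSpectrum R)) 
    (hV : ∀ p ∈ V, (singleFunctor _ m).obj (ModuleCat.of R (R ⧸ p.asIdeal)) ∈ U)
    (N : ModuleCat.{0} R) [Module.Finite R N]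
    (hN : Module.support R N ⊆ V) : (singleFunctor _ m).obj N ∈ U := by
  refine primefilt (fun N => (singleFunctor _ m).obj N ∈ U) V ?_ ?_ ?_ hV N hN
  · intro X Y e h
    exact hU.iso ((singleFunctor _ m).mapIso e) h
  · intro X h
    exact hU.zero (isZero_single m h)
  · intro S hS h1 h3
    obtain ⟨h, hT⟩ := single_tri hS m
    exact hU.ext _ _ _ hT h1 h3

lemma exists_ass (N : Type) [AddCommGroup N] [Module R N] [Module.Finite R N] 
    (p : PrimeSpectrum R) (hp : p ∈ Module.support R N) : ∃ q ∈ associatedPrimes R N, q ≤ p.asIdeal := by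
  rw [Module.support_eq_zeroLocus, PrimeSpectrum.mem_zeroLocus] at hp
  obtain ⟨q, hq, hqp⟩ := Ideal.exists_minimalPrimes_le (J := p.asIdeal) hp
  exact ⟨q, Module.associatedPrimes.minimalPrimes_annihilator_subset_associatedPrimes R N hq, hqp⟩

lemma mem_supp (N : Type) [AddCommGroup N] [Module R N] [Module.Finite R N] 
    (p : PrimeSpectrum R) (q) (hq : q ∈ associatedPrimes R N) (h : q ≤ p.asIdeal) : 
    p ∈ Module.support R N := by
  rw [Module.support_eq_zeroLocus, PrimeSpectrum.mem_zeroLocus]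
  exact (Submodule.annihilator_top (R := R) (M := N)).symm.le.trans ((IsAssociatedPrime.annihilator_le hq).trans h)

/-- map to R/p -/
lemma exists_map (N : Type) [AddCommGroup N] [Module R N] [Module.Finite R N] 
    (p : PrimeSpectrum R) (hp : p ∈ Module.support R N) : 
    ∃ (h : N →ₗ[R] (R ⧸ p.asIdeal)) (x : N), h x ≠ 0 := by
  rw [Module.mem_support_iff_nontrivial_residueField_tensorProduct] at hp
  let κ := p.asIdeal.ResidueField
  obtain ⟨φ, hφ⟩ : ∃ φ : TensorProduct R κ N →ₗ[κ] κ, φ ≠ 0 := by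
    have : Nontrivial (Module.Dual κ (TensorProduct R κ N)) := inferInstance
    exact exists_ne 0
  let g : N →ₗ[R] κ := (φ.restrictScalars R) ∘ₗ (TensorProduct.mk R κ N 1)
  have hg : g ≠ 0 := by
    intro h0
    apply hφ
    ext x
    simpa [g] using congr($h0 x)
  let f : (R ⧸ p.asIdeal) →ₗ[R] κ := (Algebra.linearMap (R ⧸ p.asIdeal) κ).restrictScalars R
  have hsne : ∀ s : p.asIdeal.primeCompl, algebraMap R κ s ≠ 0 := fun s hs =>
    s.2 (by simpa [κ] using hs)
  have : IsLocalizedModule p.asIdeal.primeCompl f := by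
    refine ⟨fun s => ?_, fun y => ?_, fun {a b} hab => ⟨1, ?_⟩⟩
    · rw [Module.End.isUnit_iff]
      constructor
      · intro a b hab
        simp only [Module.algebraMap_end_apply, Algebra.smul_def] at hab
        exact mul_left_cancel₀ (hsne s) hab
      · intro a
        refine ⟨(algebraMap R κ s)⁻¹ * a, ?_⟩
        simp only [Module.algebraMap_end_apply, Algebra.smul_def]
        exact mul_inv_cancel_left₀ (hsne s) a
    · obtain ⟨⟨a, t⟩, hat⟩ := IsLocalization.surj (nonZeroDivisors (R ⧸ p.asIdeal)) y
      obtain ⟨s, hs⟩ := Ideal.Quotient.mk_surjective t.1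
      refine ⟨⟨a, ⟨s, fun h => ?_⟩⟩, ?_⟩
      · exact nonZeroDivisors.ne_zero t.2 (hs ▸ Ideal.Quotient.eq_zero_iff_mem.2 h)
      · change s • y = algebraMap _ _ a
        rw [← hat, ← hs, mul_comm, Algebra.smul_def]
        rfl
    · have := Ideal.injective_algebraMap_quotient_residueField p.asIdeal hab
      rw [this]
  have := Module.finitePresentation_of_finite R N
  obtain ⟨h, s, hs⟩ := Module.FinitePresentation.exists_lift_of_isLocalizedModule p.asIdeal.primeCompl f g
  refine ⟨h, ?_⟩
  by_contra! hx
  apply hg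
  have h0 : h = 0 := by ext x; simp [hx]
  rw [h0, LinearMap.comp_zero] at hs
  ext x
  have := congr($hs x)
  simp only [LinearMap.zero_apply, LinearMap.smul_apply] at this
  have h2 : algebraMap R κ s * g x = 0 := by rw [← Algebra.smul_def]; exact this.symm
  exact (mul_eq_zero.1 h2).resolve_left (hsne s)
end Mods
end Stmt14
open CategoryTheory CategoryTheory.Limits CategoryTheory.Pretriangulated

namespace Stmt14
section Ext
open DerivedCategory

section
variable {C : Type u} [Category.{v} C] [Abelian C] [HasDerivedCategory.{w} C]

lemma exists_bounds (X : DerivedCategory C) (h : {n : ℤ | ¬ IsZero ((homologyFunctor C n).obj X)}.Finite) :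
    ∃ (a : ℤ) (k : ℕ), X.IsGE a ∧ X.IsLE (a + k - 1) := by
  obtain ⟨b, hb⟩ := h.bddAbove
  obtain ⟨a, ha⟩ := h.bddBelow
  refine ⟨a, (b - a + 1).toNat, ?_, ?_⟩
  · rw [isGE_iff]
    intro i hi
    by_contra hc
    have := ha hc
    omega
  · rw [isLE_iff]
    intro i hi
    by_contra hc
    have := hb hc
    have := ha hc
    omega

lemma exists_map_of_isLE (A : DerivedCategory C) (m : ℤ) (hA : A.IsLE m) (D : C) 
    (ψ : (homologyFunctor C m).obj A ⟶ D) :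
    ∃ c : A ⟶ (singleFunctor C m).obj D, 
      (homologyFunctor C m).map c ≫ (singleFunctorCompHomologyFunctorIso C m).hom.app D = ψ := by
  obtain ⟨A', B, f, g, h, hT, hA', hB, hf, hg⟩ := trunc_tri A m
  have hB' : B.IsLE m := by
    rw [isLE_iff]
    intro i hi
    have := hg i hi.le
    exact (A.isZero_of_isLE m i hi).of_iso (asIso ((homologyFunctor C i).map g)).symm
  obtain ⟨e⟩ := single_of_amp B m hB hB'
  have := hg m le_rfl
  let ε := singleFunctorCompHomologyFunctorIso C m
  refine ⟨g ≫ e.hom ≫ (singleFunctor C m).map 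
    (ε.inv.app _ ≫ (homologyFunctor C m).map e.inv ≫ inv ((homologyFunctor C m).map g) ≫ ψ), ?_⟩
  have hn := ε.hom.naturality (ε.inv.app _ ≫ (homologyFunctor C m).map e.inv ≫ inv ((homologyFunctor C m).map g) ≫ ψ)
  rw [Functor.comp_map] at hn
  simp only [Functor.map_comp, Category.assoc] at hn ⊢
  erw [hn]
  have h3 : ε.hom.app ((homologyFunctor C m).obj B) ≫ ε.inv.app ((homologyFunctor C m).obj B) = 𝟙 _ := ε.hom_inv_id_app _
  have h4 : (homologyFunctor C m).map e.hom ≫ (homologyFunctor C m).map e.inv = 𝟙 _ := by 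
    rw [← Functor.map_comp, e.hom_inv_id, CategoryTheory.Functor.map_id]
  simp only [Functor.id_map]
  slice_lhs 3 4 => erw [h3]
  erw [Category.id_comp]
  slice_lhs 2 3 => erw [h4]
  simp
end

variable {R : Type} [CommRing R] [IsNoetherianRing R]
variable [HasDerivedCategory.{w} (ModuleCat.{0} R)]

lemma annih_ext (p : PrimeSpectrum R) (B : DerivedCategory (ModuleCat.{0} R)) (a : ℤ) (k : ℕ) (h1 : B.IsGE a)
    (h2 : B.IsLE (a+k-1)) [∀ n, Module.Finite R ((homologyFunctor (ModuleCat.{0} R) n).obj B)]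
    (H : ∀ n, p ∉ Module.support R ((homologyFunctor (ModuleCat.{0} R) n).obj B)) :
    ∃ s : R, s ∉ p.asIdeal ∧ s • 𝟙 B = 0 := by
  refine devissage {B | ∃ s : R, s ∉ p.asIdeal ∧ s • 𝟙 B = 0} ?_ ?_ ?_ a k B h1 h2 ?_
  · rintro X Y e ⟨s, hs, h⟩
    refine ⟨s, hs, ?_⟩
    rw [← e.inv_hom_id, ← Category.id_comp e.hom, ← Linear.comp_smul, ← Linear.smul_comp, h]
    simp
  · intro X hX
    exact ⟨1, fun h => p.2.ne_top ((Ideal.eq_top_iff_one _).2 h), hX.eq_of_src _ _⟩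
  · rintro X Y Z f g h hT ⟨s, hs, hX⟩ ⟨t, ht, hZ⟩
    refine ⟨s * t, fun h => (p.2.mem_or_mem h).elim hs ht, ?_⟩
    have : (t • 𝟙 Y) ≫ g = 0 := by
      rw [Linear.smul_comp, Category.id_comp, ← Category.comp_id g, ← Linear.comp_smul, hZ, comp_zero]
    obtain ⟨b, hb⟩ := tri_c2 hT _ this
    rw [mul_smul, hb, ← Category.id_comp f, ← Linear.comp_smul, ← Linear.smul_comp, hX]
    simp
  · intro n
    have := H n
    rw [Module.support_eq_zeroLocus, PrimeSpectrum.mem_zeroLocus] at this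
    obtain ⟨s, hs, hsp⟩ := Set.not_subset.1 this
    refine ⟨s, hsp, ?_⟩
    rw [← CategoryTheory.Functor.map_id, ← Functor.map_smul]
    rw [show s • 𝟙 ((homologyFunctor (ModuleCat R) n).obj B) = 0 from ?_, Functor.map_zero]
    ext x
    exact Module.mem_annihilator.1 hs x

lemma tri_y1 {T : Type u} [Category.{v} T] [HasZeroObject T] [HasShift T ℤ] [Preadditive T]
    [∀ n : ℤ, (shiftFunctor T n).Additive] [Pretriangulated T] {X Y Z W : T} {f : X ⟶ Y} {g : Y ⟶ Z} {h : Z ⟶ X⟦(1 : ℤ)⟧}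
    (hT : Triangle.mk f g h ∈ distTriang T) (a : X ⟶ W) (ha : h ≫ a⟦(1:ℤ)⟧' = 0) : ∃ b, a = f ≫ b := by
  obtain ⟨b, hb⟩ := tri_y3 (tri_rot hT) _ ha
  refine ⟨(shiftFunctor T (1:ℤ)).preimage (-b), (shiftFunctor T (1:ℤ)).map_injective ?_⟩
  rw [hb, Functor.map_comp, Functor.map_preimage]
  simp

lemma exists_b (p : PrimeSpectrum R) (M : DerivedCategory (ModuleCat.{0} R)) (a : ℤ) (k : ℕ) (h1 : M.IsGE a)
    (h2 : M.IsLE (a+k-1)) [∀ n, Module.Finite R ((homologyFunctor (ModuleCat.{0} R) n).obj M)] (m : ℤ)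
    (H : ∀ n, m < n → p ∉ Module.support R ((homologyFunctor (ModuleCat.{0} R) n).obj M)) (D : ModuleCat.{0} R)
    (h : (homologyFunctor (ModuleCat.{0} R) m).obj M ⟶ D) :
    ∃ (b : M ⟶ (singleFunctor (ModuleCat.{0} R) m).obj D) (s : R), s ∉ p.asIdeal ∧
      (homologyFunctor (ModuleCat.{0} R) m).map b ≫ (singleFunctorCompHomologyFunctorIso (ModuleCat.{0} R) m).hom.app D = s • h := by
  obtain ⟨A, B, f, g, δ, hT, hA, hB, hf, hg⟩ := trunc_tri M (m+1)
  have hA : A.IsLE m := by simpa using hA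
  have eg : ∀ i, m < i → ((homologyFunctor (ModuleCat.{0} R) i).obj M ≅ (homologyFunctor (ModuleCat.{0} R) i).obj B) := fun i hi => by
      have := hg i (by omega)
      exact (asIso ((homologyFunctor (ModuleCat.{0} R) i).map g))
  have hB1 : B.IsGE (min a (m+1)) := TStructure.t.isGE_of_ge B _ _ (min_le_right _ _)
  have hB2 : B.IsLE (min a (m+1) + ((a + k - 1) - min a (m+1) + 1).toNat - 1) := by
    rw [isLE_iff]
    intro i hi
    by_cases hi' : m < i
    · exact (M.isZero_of_isLE (a+k-1) i (by omega)).of_iso (eg i hi').symm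
    · exact B.isZero_of_isGE (m+1) i (by omega)
  have hB3 : ∀ n, Module.Finite R ((homologyFunctor (ModuleCat.{0} R) n).obj B) := by
    intro i
    by_cases hi' : m < i
    · exact Module.Finite.equiv (eg i hi').toLinearEquiv
    · have := ModuleCat.subsingleton_of_isZero (B.isZero_of_isGE (m+1) i (by omega))
      infer_instance
  obtain ⟨s, hs, hsB⟩ := annih_ext p B _ _ hB1 hB2 (by
    intro i
    by_cases hi' : m < i
    · rw [← (eg i hi').toLinearEquiv.support_eq]
      exact H i hi'
    · have := ModuleCat.subsingleton_of_isZero (B.isZero_of_isGE (m+1) i (by omega))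
      rw [Module.support_eq_empty]
      simp)
  obtain ⟨c, hc⟩ := exists_map_of_isLE A m hA D ((homologyFunctor (ModuleCat.{0} R) m).map f ≫ h)
  obtain ⟨b, hb⟩ := tri_y1 hT (s • c) (by
    rw [Functor.map_smul, Linear.comp_smul, ← Linear.smul_comp, ← Category.id_comp δ, ← Linear.smul_comp, hsB]
    simp)
  refine ⟨b, s, hs, ?_⟩
  have := hf m (by omega)
  rw [← cancel_epi ((homologyFunctor (ModuleCat.{0} R) m).map f), ← Category.assoc, ← Functor.map_comp, ← hb]
  have h5 : s • c = c ≫ (singleFunctor (ModuleCat.{0} R) m).map (s • 𝟙 D) := by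
    rw [Functor.map_smul, Linear.comp_smul, CategoryTheory.Functor.map_id, Category.comp_id]
  rw [h5, Functor.map_comp, Category.assoc]
  have hn := (singleFunctorCompHomologyFunctorIso (ModuleCat.{0} R) m).hom.naturality (s • 𝟙 D)
  rw [Functor.comp_map] at hn
  rw [hn, ← Category.assoc, hc]
  simp [Linear.comp_smul]
end Ext
end Stmt14
open CategoryTheory CategoryTheory.Limits CategoryTheory.Pretriangulated

namespace Stmt14
section Proj
open DerivedCategory

variable {C : Type u} [Category.{v} C] [Abelian C] [HasDerivedCategory.{w} C]

lemma Q_map_surj (K L : CochainComplex C ℤ) [K.IsKProjective] (f : Q.obj K ⟶ Q.obj L) :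
    ∃ φ : K ⟶ L, Q.map φ = f := by
  let e := quotientCompQhIso C
  obtain ⟨g, hg⟩ := (CochainComplex.IsKProjective.Qh_map_bijective K 
    ((HomotopyCategory.quotient _ _).obj L)).2 (e.hom.app K ≫ f ≫ e.inv.app L)
  obtain ⟨φ, rfl⟩ := (HomotopyCategory.quotient C (ComplexShape.up ℤ)).map_surjective g
  refine ⟨φ, ?_⟩
  have := e.hom.naturality φ
  rw [Functor.comp_map, hg] at this
  rw [← cancel_epi (e.hom.app K), ← this]
  simp

lemma shift_proj (K : CochainComplex C ℤ) (h : ∀ i, Projective (K.X i)) (hb : ∃ b : ℤ, ∀ i, b < i → IsZero (K.X i)) (n : ℤ) :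
    (∀ i, Projective ((K⟦n⟧).X i)) ∧ (∃ b : ℤ, ∀ i, b < i → IsZero ((K⟦n⟧).X i)) := by
  refine ⟨fun i => h (i+n), ?_⟩
  obtain ⟨b, hb⟩ := hb
  exact ⟨b - n, fun i hi => hb (i+n) (by omega)⟩

lemma cone_proj {K L : CochainComplex C ℤ} (φ : K ⟶ L) (h : ∀ i, Projective (K.X i)) (hb : ∃ b : ℤ, ∀ i, b < i → IsZero (K.X i)) 
    (h' : ∀ i, Projective (L.X i)) (hb' : ∃ b : ℤ, ∀ i, b < i → IsZero (L.X i)) :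
    (∀ i, Projective ((CochainComplex.mappingCone φ).X i)) ∧ (∃ b : ℤ, ∀ i, b < i → IsZero ((CochainComplex.mappingCone φ).X i)) := by
  refine ⟨fun i => ?_, ?_⟩
  · refine Projective.of_iso (HomologicalComplex.homotopyCofiber.XIsoBiprod φ i (i+1) rfl).symm ?_
    have := h (i+1)
    have := h' i
    infer_instance
  obtain ⟨b, hb⟩ := hb
  obtain ⟨b', hb'⟩ := hb'
  refine ⟨max b b', fun i hi => HomologicalComplex.homotopyCofiber.isZero_X φ i (hb' i (by omega)) ?_⟩
  rintro j rfl
  exact hb _ (by omega)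

lemma kproj_of (K : CochainComplex C ℤ) (h : ∀ i, Projective (K.X i)) (hb : ∃ b : ℤ, ∀ i, b < i → IsZero (K.X i)) :
    K.IsKProjective := by
  obtain ⟨b, hb⟩ := hb
  have : K.IsStrictlyLE b := by
    rw [CochainComplex.isStrictlyLE_iff]
    exact hb
  exact CochainComplex.isKProjective_of_projective K b

lemma exists_model [EnoughProjectives C] (X : DerivedCategory C) (a : ℤ) (k : ℕ) (h1 : X.IsGE a) (h2 : X.IsLE (a+k-1)) :
    ∃ K : CochainComplex C ℤ, (∀ i, Projective (K.X i)) ∧ (∃ b : ℤ, ∀ i, b < i → IsZero (K.X i)) ∧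
      Nonempty (Q.obj K ≅ X) := by
  refine devissage {X | ∃ K : CochainComplex C ℤ, (∀ i, Projective (K.X i)) ∧ (∃ b : ℤ, ∀ i, b < i → IsZero (K.X i)) ∧
      Nonempty (Q.obj K ≅ X)} ?_ ?_ ?_ a k X h1 h2 ?_
  · rintro X Y e ⟨K, h1, h2, ⟨e'⟩⟩
    exact ⟨K, h1, h2, ⟨e' ≪≫ e⟩⟩
  · intro X hX
    have h0 : ∀ i, IsZero ((HomologicalComplex.zero (V := C) (c := ComplexShape.up ℤ)).X i) := fun i =>
      isZero_zero C
    exact ⟨HomologicalComplex.zero, fun i => (h0 i).projective, ⟨0, fun i _ => h0 i⟩, 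
      ⟨(Q.map_isZero HomologicalComplex.isZero_zero).iso hX⟩⟩
  · rintro X Y Z f g h hT ⟨K, hK, hKb, ⟨eK⟩⟩ ⟨L, hL, hLb, ⟨eL⟩⟩
    have := kproj_of L hL hLb
    obtain ⟨φ, hφ⟩ := Q_map_surj L (K⟦(1:ℤ)⟧) (eL.hom ≫ h ≫ (eK.inv⟦(1:ℤ)⟧') ≫ (Q.commShiftIso (1:ℤ)).inv.app K)
    obtain ⟨hK1, hK2⟩ := shift_proj K hK hKb 1
    obtain ⟨hc1, hc2⟩ := cone_proj φ hL hLb hK1 hK2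
    obtain ⟨hd1, hd2⟩ := shift_proj _ hc1 hc2 (-1)
    refine ⟨_, hd1, hd2, ⟨?_⟩⟩
    have hT' := tri_rot (tri_rot hT)
    let e := isoTriangleOfIso₁₂ _ _ (mappingCone_triangle_distinguished φ) hT' eL 
      ((Q.commShiftIso (1:ℤ)).app K ≪≫ (shiftFunctor _ (1:ℤ)).mapIso eK) (by
        change Q.map φ ≫ _ = _ ≫ h
        rw [hφ]
        change _ ≫ ((Q.commShiftIso (1:ℤ)).hom.app K ≫ eK.hom⟦(1:ℤ)⟧') = _
        simp only [Category.assoc, Iso.inv_hom_id_app_assoc, ← Functor.map_comp, Iso.inv_hom_id, CategoryTheory.Functor.map_id, Category.comp_id])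
    exact (Q.commShiftIso (-1:ℤ)).app _ ≪≫ (shiftFunctor _ (-1:ℤ)).mapIso (Triangle.π₃.mapIso e) ≪≫ 
      (shiftEquiv (DerivedCategory C) (1:ℤ)).unitIso.symm.app Y
  · intro n
    let N := (homologyFunctor C n).obj X
    let P := ProjectiveResolution.of N
    obtain ⟨hd1, hd2⟩ := shift_proj P.cochainComplex inferInstance ⟨0, fun i hi => CochainComplex.isZero_of_isStrictlyLE _ 0 _⟩ (-n)
    refine ⟨_, hd1, hd2, ⟨?_⟩⟩
    exact (Q.commShiftIso (-n)).app _ ≪≫ (shiftFunctor _ (-n)).mapIso (asIso (Q.map P.π') ≪≫ 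
      (singleFunctorIsoCompQ C 0).symm.app N) ≪≫ 
      ((singleFunctors C).shiftIso (-n) n 0 (by omega)).app N
end Proj
end Stmt14
open CategoryTheory CategoryTheory.Limits CategoryTheory.Pretriangulated

namespace Stmt14
section Tens
open DerivedCategory MonoidalCategory
variable {R : Type} [CommRing R] [IsNoetherianRing R]
variable [HasDerivedCategory.{w} (ModuleCat.{0} R)]

lemma ses_mk {N₁ N₂ N₃ : Type} [AddCommGroup N₁] [Module R N₁] [AddCommGroup N₂] [Module R N₂]
    [AddCommGroup N₃] [Module R N₃] (f : N₁ →ₗ[R] N₂) (g : N₂ →ₗ[R] N₃)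
    (hf : Function.Injective f) (hg : Function.Surjective g) (hfg : Function.Exact f g) :
    ∃ w, (ShortComplex.mk (ModuleCat.ofHom f) (ModuleCat.ofHom g) w).ShortExact := by
  refine ⟨by ext x; exact hfg.apply_apply_eq_zero x, ?_⟩
  exact { exact := (ShortComplex.ShortExact.moduleCat_exact_iff_function_exact _).2 hfg
          mono_f := (ModuleCat.mono_iff_injective _).2 hf
          epi_g := (ModuleCat.epi_iff_surjective _).2 hg }

lemma free_mem (P : ModuleCat.{0} R → Prop)
    (iso : ∀ X Y : ModuleCat.{0} R, (X ≅ Y) → P X → P Y)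
    (zero : ∀ X : ModuleCat.{0} R, IsZero X → P X)
    (ext : ∀ S : ShortComplex (ModuleCat.{0} R), S.ShortExact → P S.X₁ → P S.X₃ → P S.X₂)
    (hR : P (ModuleCat.of R R)) (n : ℕ) : P (ModuleCat.of R (Fin n → R)) := by
  induction n with
  | zero => exact zero _ (ModuleCat.isZero_of_subsingleton _)
  | succ n ih =>
    refine iso _ _ (Fin.consLinearEquiv R (fun _ : Fin (n+1) => R)).toModuleIso ?_
    obtain ⟨w, hS⟩ := ses_mk (LinearMap.inl R R (Fin n → R)) (LinearMap.snd R R (Fin n → R))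
      LinearMap.inl_injective Prod.snd_surjective Function.Exact.inl_snd
    exact ext _ hS hR ih

lemma exists_res (Z : {Z : ModuleCat.{0} R // Module.Finite R Z}) : 
    ∃ (Z' : {Z : ModuleCat.{0} R // Module.Finite R Z}) (n : ℕ)
     (i : Z'.1 ⟶ ModuleCat.of R (Fin n → R)) (q : ModuleCat.of R (Fin n → R) ⟶ Z.1) (w : i ≫ q = 0), 
     (ShortComplex.mk i q w).ShortExact := by
  obtain ⟨Z, hZ⟩ := Z
  obtain ⟨n, f, hf⟩ := Module.Finite.exists_fin' R Z
  obtain ⟨w, hS⟩ := ses_mk (LinearMap.ker f).subtype f (Submodule.injective_subtype _) hf 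
    (LinearMap.exact_subtype_ker_map f)
  exact ⟨⟨ModuleCat.of R (LinearMap.ker f), inferInstanceAs (Module.Finite R (LinearMap.ker f))⟩, n, _, _, w, hS⟩

lemma tri_iso3 {T : Type u} [Category.{v} T] [HasZeroObject T] [HasShift T ℤ] [Preadditive T]
    [∀ n : ℤ, (shiftFunctor T n).Additive] [Pretriangulated T] {X Y Z Z' : T} {f : X ⟶ Y} {g : Y ⟶ Z} {h : Z ⟶ X⟦(1 : ℤ)⟧}
    (hT : Triangle.mk f g h ∈ distTriang T) (n : ℤ) (e : Z⟦n⟧ ≅ Z') : 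
    ∃ (f' : X⟦n⟧ ⟶ Y⟦n⟧) (g' : Y⟦n⟧ ⟶ Z') (h' : Z' ⟶ (X⟦n⟧)⟦(1 : ℤ)⟧), Triangle.mk f' g' h' ∈ distTriang T := by
  obtain ⟨f', g', h', hT'⟩ : ∃ (f' : X⟦n⟧ ⟶ Y⟦n⟧) (g' : Y⟦n⟧ ⟶ Z⟦n⟧) (h' : Z⟦n⟧ ⟶ (X⟦n⟧)⟦(1 : ℤ)⟧), Triangle.mk f' g' h' ∈ distTriang T :=
    ⟨_, _, _, Triangle.shift_distinguished _ hT n⟩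
  exact ⟨f', g' ≫ e.hom, e.inv ≫ h', tri_of_iso hT' (Iso.refl _) (Iso.refl _) e.symm (by simp) (by simp) (by simp)⟩

lemma Pre.resol {U : Set (DerivedCategory (ModuleCat.{0} R))} (hU : Pre U) 
    [HasCoproductsOfShape ℕ (DerivedCategory (ModuleCat.{0} R))] 
    (E : ModuleCat.{0} R → DerivedCategory (ModuleCat.{0} R))
    (iso : ∀ X Y : ModuleCat.{0} R, (X ≅ Y) → (E X ∈ U) → E Y ∈ U)
    (zero : ∀ X : ModuleCat.{0} R, IsZero X → E X ∈ U)
    (ses : ∀ S : ShortComplex (ModuleCat.{0} R), S.ShortExact → ∃ (f : E S.X₁ ⟶ E S.X₂) (g : E S.X₂ ⟶ E S.X₃) (h : E S.X₃ ⟶ (E S.X₁)⟦(1:ℤ)⟧), 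
      Triangle.mk f g h ∈ distTriang (DerivedCategory (ModuleCat.{0} R)))
    (hR : E (ModuleCat.of R R) ∈ U) (b : ℤ) (hb : ∀ Z, (E Z).IsLE b)
    (D : ModuleCat.{0} R) (hD : Module.Finite R D) : E D ∈ U := by
  have hF : ∀ n : ℕ, E (ModuleCat.of R (Fin n → R)) ∈ U := free_mem (fun Z => E Z ∈ U) iso zero 
    (fun S hS h1 h3 => by
      obtain ⟨f, g, h, hT⟩ := ses S hS
      exact hU.ext _ _ _ hT h1 h3) hR
  choose next n i q w hS using exists_res (R := R)
  let Z : ℕ → {Z : ModuleCat.{0} R // Module.Finite R Z} := fun j => Nat.rec ⟨D, hD⟩ (fun _ z => next z) j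
  have hZ : ∀ j, Z (j+1) = next (Z j) := fun _ => rfl
  have key : ∀ j : ℕ, ∃ (f' : (E (ModuleCat.of R (Fin (n (Z j)) → R)))⟦(j:ℤ)⟧ ⟶ (E (Z j).1)⟦(j:ℤ)⟧) 
      (g' : (E (Z j).1)⟦(j:ℤ)⟧ ⟶ (E (Z (j+1)).1)⟦((j+1 : ℕ):ℤ)⟧) (h' : (E (Z (j+1)).1)⟦((j+1 : ℕ):ℤ)⟧ ⟶ ((E (ModuleCat.of R (Fin (n (Z j)) → R)))⟦(j:ℤ)⟧)⟦(1:ℤ)⟧),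
      Triangle.mk f' g' h' ∈ distTriang (DerivedCategory (ModuleCat.{0} R)) := by
    intro j
    obtain ⟨f, g, h, hT⟩ := ses _ (hS (Z j))
    exact tri_iso3 (tri_rot hT) j ((shiftFunctorAdd' (DerivedCategory (ModuleCat.{0} R)) (1:ℤ) (j:ℤ) ((j+1 : ℕ) : ℤ) (by push_cast; ring)).symm.app _)
  choose f' g' h' hT using key
  have := hU.towerD (W := fun j => (E (Z j).1)⟦(j:ℤ)⟧) g' f' h' hT (fun j => hU.shiftn (hF _) j) b (fun j => by
    have := hb (Z j).1
    exact TStructure.t.isLE_shift (E (Z j).1) b j (b-j) (by omega))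
  exact hU.iso ((shiftFunctorZero (DerivedCategory (ModuleCat.{0} R)) ℤ).app (E D)) this

/-- termwise tensor -/
noncomputable abbrev tens (Z : ModuleCat.{0} R) : CochainComplex (ModuleCat.{0} R) ℤ ⥤ CochainComplex (ModuleCat.{0} R) ℤ :=
  (tensorRight Z).mapHomologicalComplex _

noncomputable abbrev tensMap {Z Z' : ModuleCat.{0} R} (f : Z ⟶ Z') : tens Z ⟶ tens Z' :=
  NatTrans.mapHomologicalComplex ((tensoringRight _).map f) _

lemma tens_ses (K : CochainComplex (ModuleCat.{0} R) ℤ) (hK : ∀ i, Projective (K.X i)) 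
    (S : ShortComplex (ModuleCat.{0} R)) (hS : S.ShortExact) :
    ∃ w, (ShortComplex.mk ((tensMap S.f).app K) ((tensMap S.g).app K) w).ShortExact := by
  refine ⟨?_, ?_⟩
  · ext i : 1
    change K.X i ◁ S.f ≫ K.X i ◁ S.g = 0
    rw [← MonoidalCategory.whiskerLeft_comp, S.zero, MonoidalPreadditive.whiskerLeft_zero]
  · refine HomologicalComplex.shortExact_of_degreewise_shortExact _ fun i => ?_
    have := hK i
    have : Module.Projective R (K.X i) := (IsProjective.iff_projective _).2 this
    have h1 := Module.Flat.lTensor_shortComplex_exact (K.X i) S hS.exact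
    have h2 := (ModuleCat.mono_iff_injective _).1 hS.mono_f
    have h3 := (ModuleCat.epi_iff_surjective _).1 hS.epi_g
    have h4 : Mono (K.X i ◁ S.f) := (ModuleCat.mono_iff_injective _).2 
      (Module.Flat.lTensor_preserves_injective_linearMap (M := K.X i) S.f.hom h2)
    have h5 : Epi (K.X i ◁ S.g) := (ModuleCat.epi_iff_surjective _).2 
      (LinearMap.lTensor_surjective (K.X i) (g := S.g.hom) h3)
    exact { exact := h1, mono_f := h4, epi_g := h5 }

lemma Pre.tens_mem {U : Set (DerivedCategory (ModuleCat.{0} R))} (hU : Pre U) 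
    [HasCoproductsOfShape ℕ (DerivedCategory (ModuleCat.{0} R))] 
    (K : CochainComplex (ModuleCat.{0} R) ℤ) (hK : ∀ i, Projective (K.X i)) 
    (hb : ∃ b : ℤ, ∀ i, b < i → IsZero (K.X i)) (hKU : Q.obj K ∈ U) 
    (D : ModuleCat.{0} R) (hD : Module.Finite R D) : Q.obj ((tens D).obj K) ∈ U := by
  obtain ⟨b, hb⟩ := hb
  refine hU.resol (fun D => Q.obj ((tens D).obj K)) ?_ ?_ ?_ ?_ b ?_ D hD
  · intro X Y e h
    refine hU.iso (Q.mapIso ?_) h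
    exact (NatIso.mapHomologicalComplex ((tensoringRight _).mapIso e) _).app K
  · intro X h
    refine hU.zero (Q.map_isZero ?_)
    rw [IsZero.iff_id_eq_zero]
    ext i : 1
    refine IsZero.eq_of_src ?_ _ _
    exact (tensorLeft (K.X i)).map_isZero h
  · intro S hS
    obtain ⟨w, h⟩ := tens_ses K hK S hS
    exact ⟨_, _, ses_tri h⟩
  · exact hU.iso (Q.mapIso (((NatIso.mapHomologicalComplex (rightUnitorNatIso (ModuleCat.{0} R)) _).app K) ≪≫ 
      (Functor.mapHomologicalComplexIdIso _ _).app K)).symm hKU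
  · intro Z
    have : CochainComplex.IsStrictlyLE ((tens Z).obj K) b := by
      rw [CochainComplex.isStrictlyLE_iff]
      intro i hi
      exact (tensorRight Z).map_isZero (hb i hi)
    rw [isLE_Q_obj_iff]
    infer_instance
end Tens
end Stmt14
open CategoryTheory CategoryTheory.Limits CategoryTheory.Pretriangulated

namespace Stmt14
section Core
open DerivedCategory MonoidalCategory
variable {R : Type} [CommRing R] [IsNoetherianRing R]
variable [HasDerivedCategory.{w} (ModuleCat.{0} R)]

lemma exists_from_single (K : CochainComplex (ModuleCat.{0} R) ℤ) (m : ℤ) (x : K.homology m) :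
    ∃ ξ : (HomologicalComplex.single (ModuleCat.{0} R) (ComplexShape.up ℤ) m).obj (ModuleCat.of R R) ⟶ K,
      ∀ (L : CochainComplex (ModuleCat.{0} R) ℤ) (φ : K ⟶ L), ξ ≫ φ = 0 → HomologicalComplex.homologyMap φ m x = 0 := by
  obtain ⟨z, hz⟩ := (ModuleCat.epi_iff_surjective (K.homologyπ m)).1 inferInstance x
  let ζ : ModuleCat.of R R ⟶ K.cycles m := ModuleCat.ofHom (LinearMap.toSpanSingleton R _ z)
  let ξ := HomologicalComplex.mkHomFromSingle (K := K) (j := m) (ζ ≫ K.iCycles m) (by intro k _; simp)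
  refine ⟨ξ, fun L φ h => ?_⟩
  have h1 : HomologicalComplex.cyclesMap ξ m = (HomologicalComplex.singleObjCyclesSelfIso (ComplexShape.up ℤ) m _).hom ≫ ζ := by
    rw [← cancel_mono (K.iCycles m)]
    rw [HomologicalComplex.cyclesMap_i, HomologicalComplex.singleObjCyclesSelfIso_hom]
    simp [ξ]
  have h2 : ζ ≫ K.homologyπ m ≫ HomologicalComplex.homologyMap φ m = 0 := by
    rw [← cancel_epi (HomologicalComplex.singleObjCyclesSelfIso (ComplexShape.up ℤ) m _).hom, ← Category.assoc, ← h1,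
      ← HomologicalComplex.homologyπ_naturality_assoc, ← HomologicalComplex.homologyMap_comp, h]
    simp
  have h3 := congr($h2 (1:R))
  rw [← hz]
  have h4 : HomologicalComplex.homologyMap φ m (K.homologyπ m ((1:R) • z)) = 0 := h3
  rwa [one_smul] at h4

/-- the composite after tensoring -/
lemma tens_comp (p : PrimeSpectrum R) (m : ℤ) (K : CochainComplex (ModuleCat.{0} R) ℤ)
    (ξ : (HomologicalComplex.single (ModuleCat.{0} R) (ComplexShape.up ℤ) m).obj (ModuleCat.of R R) ⟶ K)
    (φ : K ⟶ (HomologicalComplex.single (ModuleCat.{0} R) (ComplexShape.up ℤ) m).obj (ModuleCat.of R (R ⧸ p.asIdeal)))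
    (ψ : ModuleCat.of R R ⟶ ModuleCat.of R (R ⧸ p.asIdeal)) 
    (h : ξ ≫ φ = (HomologicalComplex.single (ModuleCat.{0} R) (ComplexShape.up ℤ) m).map ψ) :
    ∃ (a : (HomologicalComplex.single (ModuleCat.{0} R) (ComplexShape.up ℤ) m).obj (ModuleCat.of R (R ⧸ p.asIdeal)) ⟶ 
        (tens (ModuleCat.of R (R ⧸ p.asIdeal))).obj K) 
      (b : (tens (ModuleCat.of R (R ⧸ p.asIdeal))).obj K ⟶ (HomologicalComplex.single (ModuleCat.{0} R) (ComplexShape.up ℤ) m).obj (ModuleCat.of R (R ⧸ p.asIdeal))),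
      a ≫ b = (HomologicalComplex.single (ModuleCat.{0} R) (ComplexShape.up ℤ) m).map 
        (ModuleCat.ofHom (LinearMap.mulLeft R (ψ (1:R)))) := by
  let D := ModuleCat.of R (R ⧸ p.asIdeal)
  let e := HomologicalComplex.singleMapHomologicalComplex (tensorRight D) (ComplexShape.up ℤ) m
  let sg := HomologicalComplex.single (ModuleCat.{0} R) (ComplexShape.up ℤ) m
  let mu : D ⊗ D ⟶ D := ModuleCat.ofHom (LinearMap.mul' R (R ⧸ p.asIdeal))
  refine ⟨sg.map (λ_ D).inv ≫ e.inv.app (ModuleCat.of R R) ≫ (tens D).map ξ, (tens D).map φ ≫ e.hom.app _ ≫ sg.map mu, ?_⟩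
  have h1 : (tens D).map ξ ≫ (tens D).map φ = (tens D).map (sg.map ψ) := by rw [← Functor.map_comp, h]
  have h2 := e.hom.naturality ψ
  rw [Functor.comp_map, Functor.comp_map] at h2
  simp only [Category.assoc]
  rw [reassoc_of% h1]
  erw [reassoc_of% h2]
  rw [Iso.inv_hom_id_app_assoc]
  change sg.map _ ≫ sg.map _ ≫ sg.map _ = sg.map _
  rw [← Functor.map_comp, ← Functor.map_comp]
  congr 1

lemma H_zero (K L : CochainComplex (ModuleCat.{0} R) ℤ) (m : ℤ) (φ : K ⟶ L) (M : DerivedCategory (ModuleCat.{0} R))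
    (e : Q.obj K ≅ M) (b : M ⟶ Q.obj L) (hφ : Q.map φ = e.hom ≫ b) (x : (homologyFunctor (ModuleCat.{0} R) m).obj M)
    (h3 : HomologicalComplex.homologyMap φ m ((homologyFunctorFactors (ModuleCat.{0} R) m).hom.app K
      ((homologyFunctor (ModuleCat.{0} R) m).map e.inv x)) = 0) :
    (homologyFunctor (ModuleCat.{0} R) m).map b x = 0 := by
  have hb : b = e.inv ≫ Q.map φ := by rw [hφ, Iso.inv_hom_id_assoc]
  have h4 := (homologyFunctorFactors (ModuleCat.{0} R) m).hom.naturality φ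
  have h5 := congr($h4 ((homologyFunctor (ModuleCat.{0} R) m).map e.inv x))
  have h6 : (homologyFunctorFactors (ModuleCat.{0} R) m).hom.app L 
      ((homologyFunctor (ModuleCat.{0} R) m).map (Q.map φ) ((homologyFunctor (ModuleCat.{0} R) m).map e.inv x)) = 0 := 
    h5.trans h3
  have h7 := (ModuleCat.mono_iff_injective ((homologyFunctorFactors (ModuleCat.{0} R) m).hom.app L)).1 inferInstance (h6.trans (map_zero _).symm)
  rw [hb, Functor.map_comp]
  exact h7

lemma Pre.core {U : Set (DerivedCategory (ModuleCat.{0} R))} (hU : Pre U) 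
    [HasCoproductsOfShape ℕ (DerivedCategory (ModuleCat.{0} R))] 
    (M : DerivedCategory (ModuleCat.{0} R)) (hM : M ∈ U) (a : ℤ) (k : ℕ) (h1 : M.IsGE a)
    (h2 : M.IsLE (a+k-1)) [∀ n, Module.Finite R ((homologyFunctor (ModuleCat.{0} R) n).obj M)] 
    (p : PrimeSpectrum R) (m : ℤ)
    (hm : p ∈ Module.support R ((homologyFunctor (ModuleCat.{0} R) m).obj M))
    (H : ∀ n, m < n → p ∉ Module.support R ((homologyFunctor (ModuleCat.{0} R) n).obj M)) 
    (ih : ∀ q : PrimeSpectrum R, p < q → (singleFunctor (ModuleCat.{0} R) m).obj (ModuleCat.of R (R ⧸ q.asIdeal)) ∈ U) :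
    (singleFunctor (ModuleCat.{0} R) m).obj (ModuleCat.of R (R ⧸ p.asIdeal)) ∈ U := by
  obtain ⟨h, x, hx⟩ := exists_map _ p hm
  obtain ⟨b, s, hs, hb⟩ := exists_b p M a k h1 h2 m H (ModuleCat.of R (R ⧸ p.asIdeal)) (ModuleCat.ofHom h)
  obtain ⟨K, hK, hKb, ⟨e⟩⟩ := exists_model M a k h1 h2
  have := kproj_of K hK hKb
  let sg := HomologicalComplex.single (ModuleCat.{0} R) (ComplexShape.up ℤ) m
  obtain ⟨φ, hφ⟩ := Q_map_surj K (sg.obj (ModuleCat.of R (R ⧸ p.asIdeal))) (e.hom ≫ b)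
  let F := homologyFunctorFactors (ModuleCat.{0} R) m
  let x'' : K.homology m := F.hom.app K ((homologyFunctor (ModuleCat.{0} R) m).map e.inv x)
  obtain ⟨ξ, hξ⟩ := exists_from_single K m x''
  obtain ⟨ψ, hψ⟩ := sg.map_surjective (ξ ≫ φ)
  have hψ0 : ψ (1:R) ≠ 0 := by
    intro h0
    have hz : ψ = 0 := by
      ext
      exact h0
    have h3 := hξ _ φ (by rw [← hψ, hz, Functor.map_zero])
    have h7 := H_zero K _ m φ M e b hφ x h3
    have h7' : (homologyFunctor (ModuleCat.{0} R) m).map b x = 0 := h7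
    have h8 := congr($hb x)
    rw [ModuleCat.comp_apply, h7', map_zero] at h8
    have h9 : s • h x = 0 := h8.symm
    rw [Algebra.smul_def, mul_eq_zero] at h9
    refine h9.elim (fun h => hs ?_) hx
    exact Ideal.Quotient.eq_zero_iff_mem.1 h
  obtain ⟨α, β, hαβ⟩ := tens_comp p m K ξ φ ψ hψ.symm
  have hN := hU.tens_mem K hK hKb (hU.iso e.symm hM) (ModuleCat.of R (R ⧸ p.asIdeal)) (inferInstanceAs (Module.Finite R (R ⧸ p.asIdeal)))
  let μ : (R ⧸ p.asIdeal) →ₗ[R] (R ⧸ p.asIdeal) := LinearMap.mulLeft R (ψ (1:R))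
  obtain ⟨w, hS⟩ := ses_mk μ (LinearMap.range μ).mkQ (fun a b hab => mul_left_cancel₀ hψ0 hab) (Submodule.mkQ_surjective _) 
    (LinearMap.exact_map_mkQ_range μ)
  obtain ⟨δ, hT⟩ := single_tri hS m
  have hE : (singleFunctor (ModuleCat.{0} R) m).obj (ModuleCat.of R ((R ⧸ p.asIdeal) ⧸ LinearMap.range μ)) ∈ U := by
    have : Module.Finite R (ModuleCat.of R ((R ⧸ p.asIdeal) ⧸ LinearMap.range μ)) := inferInstanceAs (Module.Finite R ((R ⧸ p.asIdeal) ⧸ LinearMap.range μ))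
    refine hU.single_filt m {q | p < q} (fun q hq => ih q hq) _ ?_
    intro q hq
    rw [Module.support_eq_zeroLocus, PrimeSpectrum.mem_zeroLocus] at hq
    obtain ⟨r, hr⟩ := Ideal.Quotient.mk_surjective (ψ (1:R))
    have hr1 : r ∉ p.asIdeal := fun h => hψ0 (hr.symm.trans (Ideal.Quotient.eq_zero_iff_mem.2 h))
    have hr2 : r ∈ q.asIdeal := hq (by
      rw [SetLike.mem_coe, Module.mem_annihilator]
      intro y
      obtain ⟨d, rfl⟩ := Submodule.mkQ_surjective (LinearMap.range μ) y
      rw [← map_smul]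
      refine (Submodule.Quotient.mk_eq_zero _).2 ⟨d, ?_⟩
      change ψ (1:R) * d = _
      rw [← hr, Algebra.smul_def]
      rfl)
    have hpq : p ≤ q := fun t ht => hq (by
      rw [SetLike.mem_coe, Module.mem_annihilator]
      intro y
      obtain ⟨d, rfl⟩ := Submodule.mkQ_surjective (LinearMap.range μ) y
      rw [← map_smul, Algebra.smul_def, Ideal.Quotient.algebraMap_eq, Ideal.Quotient.eq_zero_iff_mem.2 ht, zero_mul, map_zero])
    refine lt_of_le_of_ne hpq ?_
    rintro rfl
    exact hr1 hr2
  have hQ : Q.map α ≫ Q.map β = (singleFunctor (ModuleCat.{0} R) m).map (ModuleCat.ofHom μ) := by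
    rw [← Functor.map_comp, hαβ]
    rfl
  exact hU.trick (D := (singleFunctor (ModuleCat.{0} R) m).obj (ModuleCat.of R (R ⧸ p.asIdeal))) 
    (g := (singleFunctor (ModuleCat.{0} R) m).map (ModuleCat.ofHom (LinearMap.range μ).mkQ)) (h := δ) (Q.map α) (Q.map β) 
    (by 
      have h := hT
      change Triangle.mk ((singleFunctor (ModuleCat.{0} R) m).map (ModuleCat.ofHom μ)) _ _ ∈ _ at h
      rw [← hQ] at h
      exact h) hN hE
end Core
end Stmt14

namespace Stmt14
section Final
open DerivedCategory
variable {R : Type} [CommRing R] [IsNoetherianRing R]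
variable [HasDerivedCategory.{w} (ModuleCat.{0} R)]

lemma Pre.main {U : Set (DerivedCategory (ModuleCat.{0} R))} (hU : Pre U)
    (M : DerivedCategory (ModuleCat.{0} R)) (hM : M ∈ U) (a : ℤ) (k : ℕ) (h1 : M.IsGE a)
    (h2 : M.IsLE (a+k-1)) [∀ n, Module.Finite R ((homologyFunctor (ModuleCat.{0} R) n).obj M)] 
    (p : PrimeSpectrum R) : ∀ m, p ∈ Module.support R ((homologyFunctor (ModuleCat.{0} R) m).obj M) →
    (singleFunctor (ModuleCat.{0} R) m).obj (ModuleCat.of R (R ⧸ p.asIdeal)) ∈ U := by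
  have hcop : HasCoproductsOfShape ℕ (DerivedCategory (ModuleCat.{0} R)) := hasCoproducts_derived
  have wf : WellFounded (fun p q : PrimeSpectrum R => q < p) :=
    InvImage.wf (fun p : PrimeSpectrum R => p.asIdeal) (wellFounded_gt (α := Ideal R))
  induction p using wf.induction with
  | _ p ih =>
  intro m hm
  obtain ⟨m', ⟨hmm, hm'⟩, hmax⟩ := Int.exists_greatest_of_bdd (P := fun n => m ≤ n ∧ 
      p ∈ Module.support R ((homologyFunctor (ModuleCat.{0} R) n).obj M))
    ⟨a+k-1, fun n hn => by
      by_contra hc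
      have hz := M.isZero_of_isLE (a+k-1) n (by omega)
      have : Subsingleton ((homologyFunctor (ModuleCat.{0} R) n).obj M) := ModuleCat.subsingleton_of_isZero hz
      have h3 := hn.2
      rw [Module.support_eq_empty] at h3
      exact h3⟩ ⟨m, le_rfl, hm⟩
  have hc := hU.core M hM a k h1 h2 p m' hm' (fun n hn hp => by
      have := hmax n ⟨by omega, hp⟩
      omega) (fun q hq => ih q hq m' (by
        rw [Module.support_eq_zeroLocus, PrimeSpectrum.mem_zeroLocus] at hm' ⊢
        exact hm'.trans hq.le))
  have hs := hU.shiftn hc (m' - m).toNat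
  exact hU.iso (((singleFunctors (ModuleCat.{0} R)).shiftIso ((m' - m).toNat : ℤ) m m' (by omega)).app _) hs

lemma bounds_of (M : DerivedCategory (ModuleCat.{0} R)) (hM : memDqc R M) :
    ∃ (a : ℤ) (k : ℕ), M.IsGE a ∧ M.IsLE (a + k - 1) := by
  apply exists_bounds
  refine (hM.2.image (fun n => -n)).subset ?_
  intro n hn
  refine ⟨-n, ?_, neg_neg n⟩
  change ¬ IsZero ((homologyFunctor (ModuleCat.{0} R) (- -n)).obj M)
  rw [neg_neg]
  exact hn

lemma fin_of (M : DerivedCategory (ModuleCat.{0} R)) (hM : memDqc R M) (n : ℤ) :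
    Module.Finite R ((homologyFunctor (ModuleCat.{0} R) n).obj M) := by
  have h := hM.1 (-n)
  unfold Hh at h
  rwa [neg_neg] at h

lemma pre_of {U : Set (DerivedCategory (ModuleCat.{0} R))} (hU : IsCocompletePreaisle R U) : Pre U :=
  ⟨hU.mem_of_iso, hU.shift_mem, hU.ext_mem, hU.coproduct_mem⟩
end Final
end Stmt14

/-- For every nullity class `A` in `D_qc(R)`, one has `N(φ(A)) = A`. -/
theorem stmt14 (R : Type) [CommRing R] [IsNoetherianRing R]
    [HasDerivedCategory.{w} (ModuleCat R)]
    (A : Set (DerivedCategory (ModuleCat R))) (hA : IsNullityClass R A) :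
    Nfun R (phi R A) = A := by
  obtain ⟨U, hU, rfl⟩ := hA
  ext M
  constructor
  · rintro ⟨hM, hS⟩
    refine ⟨hS U hU ?_, hM⟩
    rintro n p ⟨M', ⟨hM', hq'⟩, q, hq, hqp⟩
    obtain ⟨a, k, h1, h2⟩ := Stmt14.bounds_of M' hq'
    have hf := Stmt14.fin_of M' hq'
    exact (Stmt14.pre_of hU).main M' hM' a k h1 h2 p (-n) (Stmt14.mem_supp _ p q hq hqp)
  · rintro ⟨hMU, hM⟩
    refine ⟨hM, fun S hS H => ?_⟩
    have hM' : memDqc R M := hM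
    obtain ⟨a, k, h1, h2⟩ := Stmt14.bounds_of M hM'
    have hf := Stmt14.fin_of M hM'
    have hP := Stmt14.pre_of hS
    refine Stmt14.devissage S (fun X Y e h => hP.iso e h) (fun X hX => hP.zero hX)
      (fun X Y Z f g h hT hX hZ => hP.ext f g h hT hX hZ) a k M h1 h2 (fun n => ?_)
    refine hP.single_filt n (Module.support R ((DerivedCategory.homologyFunctor (ModuleCat R) n).obj M)) 
      (fun p hp => ?_) _ subset_rfl
    obtain ⟨m, rfl⟩ : ∃ m, n = -m := ⟨-n, (neg_neg n).symm⟩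
    obtain ⟨q, hq, hqp⟩ := Stmt14.exists_ass _ p hp
    exact H m p ⟨M, ⟨hMU, hM⟩, q, hq, hqp⟩
end
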